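/- Let a,m,b>0 satisfy max{9b/2, 4b+1/b} < a/m < 9b/2 + 2/b, and suppose ∫_{U₂}^{9bm/2} (u − 2mb + √(u² − 4umb))/(2b²) du < (1/2)(a − U₂)². Then there exist constants r_I > 0, ν > 0, δ₀ > 0 and C > 0 (depending only on a,b,m) such that for every δ ∈ (0,δ₀) there exist bounded, twice continuously differentiable functions u,v : (0,∞) → ℝ solving u'' + u'/r + a − u − u v² = 0 and δ²(v'' + v'/r) − m v + u v²(1 − b v) = 0 on (0,∞), such that the limit v(0⁺) := lim_{r→0⁺} v(r) exists with 0 ≤ v(0⁺) ≤ C e^{−ν/δ}, the limits of u and v as r → ∞ exist and satisfy |lim_{r→∞} v(r) − V₂| ≤ C δ and |lim_{r→∞} u(r) − U₂| ≤ C δ, and there is a radius r_δ with |r_δ − r_I| ≤ C δ at which v(r_δ) = 1/(3b). (Existence of radially symmetric vegetation gap solutions with a single interface at radius r_I + O(δ).) -/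

import Mathlib

set_option autoImplicit false
set_option linter.all false
local notation:max "lA" x:max => by linarith only [x]
local notation:max "lB" x:max y:max => by linarith only [x, y]
local notation:max "lC" x:max y:max z:max => by linarith only [x, y, z]
local notation:max "lD" x:max y:max z:max u:max => by linarith only [x, y, z, u]
local notation:max "lE" x:max y:max z:max u:max v:max => by linarith only [x, y, z, u, v]
local notation:max "mA" x:max => by linarith [x]
local notation:max "mB" x:max y:max => by linarith [x, y]
local notation "ll" => by linarith
local notation "pv" => by positivity
local notation "mL" => mul_le_mul_of_nonneg_left
local notation "mR" => mul_le_mul_of_nonneg_right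

def brV {n : ℕ} (q : Fin n → ℕ) (π : Equiv.Perm (Fin n)) (k : ℕ) : Fin n → ℕ :=
  fun i => q i+if (π.symm i).val < k then 1 else 0

lemma br_tel (N : ℕ) (H : ℕ → ZMod 2) : ∑ x : Fin N, (H (x.val+1)+H x.val) = H N+H 0 := by
  rw [Fin.sum_univ_eq_sum_range (fun x => H (x+1)+H x)]
  induction N with
  | zero => simp [CharTwo.add_self_eq_zero]
  | succ k ih =>
    rw [Finset.sum_range_succ, ih]
    have := CharTwo.add_self_eq_zero (H k)
    linear_combination this

def brG {n : ℕ} (f : ℕ → (Fin (n+1) → ℕ) → ZMod 2) (y : ℕ → Fin (n+1) → ℕ) : ZMod 2 :=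
  f 0 (y 0) * ∏ j ∈ Finset.range n, (f (j+1) (y (j+1))+f (j+1) (y j))

lemma br_swap {n : ℕ} (p : Fin (n+1) → ℕ) (π : Equiv.Perm (Fin (n+1))) (k : ℕ) (hk : k < n) (j : ℕ)
    (hj : j ≠ k+1) :
    brV p (π*Equiv.swap ⟨k, by omega⟩ ⟨k+1, by omega⟩) j = brV p π j := by
  funext i
  unfold brV
  have : (π*Equiv.swap (⟨k, by omega⟩ : Fin (n+1)) ⟨k+1, by omega⟩).symm i
      = Equiv.swap (⟨k, by omega⟩ : Fin (n+1)) ⟨k+1, by omega⟩ (π.symm i) := by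
    rw [Equiv.symm_apply_eq]; simp
  rw [this]
  congr 1
  generalize π.symm i = x
  rw [Equiv.swap_apply_def]
  split_ifs with h1 h2 h3 h4 h5 h6 <;> simp_all [Fin.ext_iff] <;> omega

def brT {n : ℕ} (f : ℕ → (Fin (n+1) → ℕ) → ZMod 2) (p : Fin (n+1) → ℕ) (k : ℕ) : ZMod 2 :=
  ∑ π : Equiv.Perm (Fin (n+1)), f 0 (brV p π 0) * ∏ j ∈ Finset.range n,
    (if j < k then f (j+1) (brV p π (j+1))+f (j+1) (brV p π j)
      else f (j+1) (brV p π (j+2))+f (j+1) (brV p π (j+1)))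

lemma brT_succ {n : ℕ} (f : ℕ → (Fin (n+1) → ℕ) → ZMod 2) (p : Fin (n+1) → ℕ) (k : ℕ) (hk : k < n) :
    brT f p k = brT f p (k+1) := by
  rw [← sub_eq_zero]
  unfold brT
  rw [← Finset.sum_sub_distrib]
  have key : ∀ π : Equiv.Perm (Fin (n+1)), (f 0 (brV p π 0) * ∏ j ∈ Finset.range n,
    (if j < k then f (j+1) (brV p π (j+1))+f (j+1) (brV p π j)
      else f (j+1) (brV p π (j+2))+f (j+1) (brV p π (j+1)))) -
      (f 0 (brV p π 0) * ∏ j ∈ Finset.range n,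
    (if j < k+1 then f (j+1) (brV p π (j+1))+f (j+1) (brV p π j)
      else f (j+1) (brV p π (j+2))+f (j+1) (brV p π (j+1)))) =
      f 0 (brV p π 0)*((f (k+1) (brV p π (k+2))+f (k+1) (brV p π k)) *
        ∏ j ∈ (Finset.range n).erase k, (if j < k then f (j+1) (brV p π (j+1))+f (j+1) (brV p π j)
      else f (j+1) (brV p π (j+2))+f (j+1) (brV p π (j+1)))) := by
    intro π
    rw [← Finset.mul_prod_erase _ _ (Finset.mem_range.2 hk)]
    rw [← Finset.mul_prod_erase (Finset.range n) (fun j => if j < k+1 then _ else _) (Finset.mem_range.2 hk)]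
    have : ∏ x ∈ (Finset.range n).erase k, (if x < k+1 then f (x+1) (brV p π (x+1))+f (x+1) (brV p π x)
      else f (x+1) (brV p π (x+2))+f (x+1) (brV p π (x+1))) = ∏ j ∈ (Finset.range n).erase k, (if j < k then f (j+1) (brV p π (j+1))+f (j+1) (brV p π j)
      else f (j+1) (brV p π (j+2))+f (j+1) (brV p π (j+1))) := by
      apply Finset.prod_congr rfl
      intro x hx
      have : x ≠ k := Finset.ne_of_mem_erase hx
      have h2 : (x < k+1) ↔ x < k := by omega
      simp only [h2]
    rw [this]
    simp only [lt_irrefl, if_false, Nat.lt_succ_self, if_true]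
    have h1 : (f (k+1) (brV p π k)) = - (f (k+1) (brV p π k)) := by
      rw [CharTwo.neg_eq]
    linear_combination (-(f 0 (brV p π 0)) * ∏ j ∈ (Finset.range n).erase k, (if j < k then f (j+1) (brV p π (j+1))+f (j+1) (brV p π j)
      else f (j+1) (brV p π (j+2))+f (j+1) (brV p π (j+1))))*h1
  rw [Finset.sum_congr rfl (fun π _ => key π)]
  refine Finset.sum_involution (fun π _ => π*Equiv.swap ⟨k, by omega⟩ ⟨k+1, by omega⟩) ?_ ?_ ?_ ?_
  · intro π _
    rw [br_swap p π k hk 0 (by omega), br_swap p π k hk (k+2) (by omega), br_swap p π k hk k (by omega)]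
    have : ∏ j ∈ (Finset.range n).erase k, (if j < k then f (j+1) (brV p (π*Equiv.swap ⟨k, by omega⟩ ⟨k+1, by omega⟩) (j+1))+f (j+1) (brV p (π*Equiv.swap ⟨k, by omega⟩ ⟨k+1, by omega⟩) j)
      else f (j+1) (brV p (π*Equiv.swap ⟨k, by omega⟩ ⟨k+1, by omega⟩) (j+2))+f (j+1) (brV p (π*Equiv.swap ⟨k, by omega⟩ ⟨k+1, by omega⟩) (j+1))) = ∏ j ∈ (Finset.range n).erase k, (if j < k then f (j+1) (brV p π (j+1))+f (j+1) (brV p π j)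
      else f (j+1) (brV p π (j+2))+f (j+1) (brV p π (j+1))) := by
      apply Finset.prod_congr rfl
      intro x hx
      have : x ≠ k := Finset.ne_of_mem_erase hx
      split_ifs with h
      · rw [br_swap p π k hk (x+1) (by omega), br_swap p π k hk x (by omega)]
      · rw [br_swap p π k hk (x+2) (by omega), br_swap p π k hk (x+1) (by omega)]
    rw [this]
    exact CharTwo.add_self_eq_zero _
  · intro π _ _ h
    have h2 : Equiv.swap (⟨k, by omega⟩ : Fin (n+1)) ⟨k+1, by omega⟩ = 1 := by
      simpa using h
    rw [Equiv.swap_eq_one_iff] at h2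
    simp at h2
  · intro π _; exact Finset.mem_univ _
  · intro π _; simp [mul_assoc]

def brS (N n : ℕ) (f : ℕ → (Fin n → ℕ) → ZMod 2) : ZMod 2 :=
  ∑ p : Fin n → Fin N, ∑ π : Equiv.Perm (Fin n), ∏ j ∈ Finset.range n,
    (f j (brV (fun i => (p i).val) π (j+1))+f j (brV (fun i => (p i).val) π j))

lemma br_inner {n : ℕ} (f : ℕ → (Fin (n+1) → ℕ) → ZMod 2) (p : Fin (n+1) → ℕ) :
    ∑ π : Equiv.Perm (Fin (n+1)), ∏ j ∈ Finset.range (n+1),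
      (f j (brV p π (j+1))+f j (brV p π j)) =
    ∑ π : Equiv.Perm (Fin (n+1)), (brG f (fun k => brV p π (k+1))+brG f (brV p π)) := by
  have h0 : ∀ k, k ≤ n → brT f p 0 = brT f p k := by
    intro k hk
    induction k with
    | zero => rfl
    | succ k ih => rw [ih (by omega), brT_succ f p k (by omega)]
  have h1 := h0 n le_rfl
  rw [Finset.sum_add_distrib]
  have h2 : brT f p n = ∑ π : Equiv.Perm (Fin (n+1)), brG f (brV p π) := by
    unfold brT brG
    refine Finset.sum_congr rfl fun π _ => ?_
    congr 1
    refine Finset.prod_congr rfl fun j hj => ?_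
    rw [if_pos (Finset.mem_range.1 hj)]
  rw [← h2, ← h1]
  unfold brT brG
  rw [← Finset.sum_add_distrib]
  refine Finset.sum_congr rfl fun π _ => ?_
  rw [Finset.prod_range_succ']
  simp only [Nat.not_lt_zero, if_false]
  ring_nf

lemma br_rot_symm {n : ℕ} (π : Equiv.Perm (Fin (n+1))) (i : Fin (n+1)) (k : ℕ) (hk : k ≤ n) :
    (((π*finRotate (n+1)).symm i).val < k) ↔ ((π.symm i).val ≠ 0 ∧ (π.symm i).val ≤ k) := by
  have h : (π*finRotate (n+1)).symm i = (finRotate (n+1)).symm (π.symm i) := by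
    rw [Equiv.symm_apply_eq]; simp
  rw [h]
  generalize hx : (finRotate (n+1)).symm (π.symm i) = x
  have hx2 : π.symm i = finRotate (n+1) x := by
    rw [← hx]; simp
  rw [hx2]
  by_cases hl : x = Fin.last n
  · subst hl
    rw [finRotate_last]
    simp; omega
  · rw [coe_finRotate_of_ne_last hl]
    omega

def brY {n : ℕ} (q : Fin (n+1) → ℕ) (π : Equiv.Perm (Fin (n+1))) (k : ℕ) : Fin (n+1) → ℕ :=
  fun i => q i+if (π.symm i).val ≠ 0 ∧ (π.symm i).val ≤ k then 1 else 0

lemma brG_congr {n : ℕ} (f : ℕ → (Fin (n+1) → ℕ) → ZMod 2) (y y' : ℕ → Fin (n+1) → ℕ)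
    (h : ∀ k ≤ n, y k = y' k) : brG f y = brG f y' := by
  unfold brG
  rw [h 0 (by omega)]
  congr 1
  refine Finset.prod_congr rfl fun j hj => ?_
  have := Finset.mem_range.1 hj
  rw [h (j+1) (by omega), h j (by omega)]

lemma br_inner2 {n : ℕ} (f : ℕ → (Fin (n+1) → ℕ) → ZMod 2) (p : Fin (n+1) → ℕ) :
    ∑ π : Equiv.Perm (Fin (n+1)), ∏ j ∈ Finset.range (n+1),
      (f j (brV p π (j+1))+f j (brV p π j)) =
    ∑ π : Equiv.Perm (Fin (n+1)),
      (brG f (brY (fun i => p i+if i = π 0 then 1 else 0) π)+brG f (brY p π)) := by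
  rw [br_inner, Finset.sum_add_distrib, Finset.sum_add_distrib]
  congr 1
  · refine Finset.sum_congr rfl fun π _ => brG_congr _ _ _ fun k hk => ?_
    funext i
    unfold brV brY
    have h1 : i = π 0 ↔ (π.symm i).val = 0 := by
      rw [← Equiv.symm_apply_eq, Fin.ext_iff]; simp
    simp only [h1]
    generalize (π.symm i).val = x
    split_ifs <;> omega
  · rw [← Equiv.sum_comp (Equiv.mulRight (finRotate (n+1)))]
    refine Finset.sum_congr rfl fun π _ => brG_congr _ _ _ fun k hk => ?_
    funext i
    unfold brV brY
    simp only [Equiv.coe_mulRight, br_rot_symm π i k hk]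

lemma br_main (N : ℕ) (hN : 0 < N) : ∀ (n : ℕ) (f : ℕ → (Fin n → ℕ) → ZMod 2)
    (_h0 : ∀ (i : Fin n) (x : Fin n → ℕ), x i = 0 → f i x = 0)
    (_h1 : ∀ (i : Fin n) (x : Fin n → ℕ), x i = N → f i x = 1), brS N n f = 1 := by
  intro n
  induction n with
  | zero =>
    intro f _ _
    simp [brS]
  | succ n ih =>
    intro f h0 h1
    unfold brS
    have e1 : ∀ p : Fin (n+1) → Fin N, _ := fun p => br_inner2 f (fun i => (p i).val)
    rw [Finset.sum_congr rfl (fun p _ => e1 p), Finset.sum_comm]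
    have fix : ∀ (π : Equiv.Perm (Fin (n+1))) (q : Fin (n+1) → ℕ) (k : ℕ), brY q π k (π 0) = q (π 0) := by
      intro π q k; simp [brY]
    have e2 : ∀ π : Equiv.Perm (Fin (n+1)), ∑ p : Fin (n+1) → Fin N,
        (brG f (brY (fun i => (p i).val+if i = π 0 then 1 else 0) π)+brG f (brY (fun i => (p i).val) π))
        = ∑ p' : Fin n → Fin N, (brG f (brY ((π 0).insertNth (α := fun _ => ℕ) N (fun i => (p' i).val)) π)
          + brG f (brY ((π 0).insertNth (α := fun _ => ℕ) 0 (fun i => (p' i).val)) π)) := by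
      intro π
      rw [← Equiv.sum_comp (Fin.insertNthEquiv (fun _ => Fin N) (π 0)), Fintype.sum_prod_type, Finset.sum_comm]
      refine Finset.sum_congr rfl fun p' _ => ?_
      rw [← br_tel N (fun x => brG f (brY ((π 0).insertNth (α := fun _ => ℕ) x (fun i => (p' i).val)) π))]
      refine Finset.sum_congr rfl fun x _ => ?_
      congr 3
      · funext i
        refine Fin.succAboveCases (π 0) ?_ (fun j => ?_) i
        · simp
        · simp [Fin.succAbove_ne]
      · funext i
        refine Fin.succAboveCases (π 0) ?_ (fun j => ?_) i
        · simp
        · simp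
    rw [Finset.sum_congr rfl (fun π _ => e2 π)]
    have z0 : ∀ (π : Equiv.Perm (Fin (n+1))) (q : Fin (n+1) → ℕ), q (π 0) = 0 → brG f (brY q π) = 0 := by
      intro π q hq
      unfold brG
      by_cases h : π 0 = 0
      · have hf := fix π q 0
        rw [h] at hf hq
        have h00 : f 0 (brY q π 0) = 0 := h0 0 _ (by rw [hf, hq])
        rw [h00, zero_mul]
      · obtain ⟨j, hj⟩ := Fin.exists_succ_eq.2 h
        rw [Finset.prod_eq_zero (i := j.val) (Finset.mem_range.2 j.2), mul_zero]
        have a1 := h0 (π 0) (brY q π (j+1)) (by rw [fix, hq])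
        have a2 := h0 (π 0) (brY q π j) (by rw [fix, hq])
        rw [← hj] at a1 a2
        simp only [Fin.val_succ] at a1 a2
        rw [a1, a2, add_zero]
    have zN : ∀ (π : Equiv.Perm (Fin (n+1))) (q : Fin (n+1) → ℕ), q (π 0) = N → π 0 ≠ 0 → brG f (brY q π) = 0 := by
      intro π q hq h
      unfold brG
      obtain ⟨j, hj⟩ := Fin.exists_succ_eq.2 h
      rw [Finset.prod_eq_zero (i := j.val) (Finset.mem_range.2 j.2), mul_zero]
      have a1 := h1 (π 0) (brY q π (j+1)) (by rw [fix, hq])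
      have a2 := h1 (π 0) (brY q π j) (by rw [fix, hq])
      rw [← hj] at a1 a2
      simp only [Fin.val_succ] at a1 a2
      rw [a1, a2]; decide
    rw [← Equiv.sum_comp Equiv.Perm.decomposeFin.symm, Fintype.sum_prod_type, Fin.sum_univ_succ]
    have hz : ∑ i : Fin n, ∑ σ : Equiv.Perm (Fin n), ∑ p' : Fin n → Fin N,
        (brG f (brY (((Equiv.Perm.decomposeFin.symm (i.succ, σ)) 0).insertNth (α := fun _ => ℕ) N (fun i => (p' i).val)) (Equiv.Perm.decomposeFin.symm (i.succ, σ)))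
          + brG f (brY (((Equiv.Perm.decomposeFin.symm (i.succ, σ)) 0).insertNth (α := fun _ => ℕ) 0 (fun i => (p' i).val)) (Equiv.Perm.decomposeFin.symm (i.succ, σ)))) = 0 := by
      refine Finset.sum_eq_zero fun i _ => Finset.sum_eq_zero fun σ _ => Finset.sum_eq_zero fun p' _ => ?_
      rw [zN (Equiv.Perm.decomposeFin.symm (i.succ, σ)) _ (by simp) (by simp), zero_add]
      exact z0 (Equiv.Perm.decomposeFin.symm (i.succ, σ)) _ (by simp)
    rw [hz, add_zero]
    have ihf := ih (fun j x => f (j+1) (Fin.cons N x))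
      (fun i x hx => by
        have := h0 i.succ (Fin.cons N x) (by simpa using hx)
        simpa using this)
      (fun i x hx => by
        have := h1 i.succ (Fin.cons N x) (by simpa using hx)
        simpa using this)
    rw [← ihf]
    unfold brS
    rw [Finset.sum_comm]
    refine Finset.sum_congr rfl fun p' _ => Finset.sum_congr rfl fun σ _ => ?_
    have hz0 := z0 (Equiv.Perm.decomposeFin.symm (0, σ)) (((Equiv.Perm.decomposeFin.symm (0, σ)) 0).insertNth (α := fun _ => ℕ) 0 (fun i => (p' i).val)) (by simp)
    rw [hz0, add_zero]
    have hy : ∀ k, brY (((Equiv.Perm.decomposeFin.symm (0, σ)) 0).insertNth (α := fun _ => ℕ) N (fun i => (p' i).val)) (Equiv.Perm.decomposeFin.symm (0, σ)) k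
        = Fin.cons N (brV (fun i => (p' i).val) σ k) := by
      intro k
      funext i
      refine Fin.cases ?_ (fun i => ?_) i
      · have : (Equiv.Perm.decomposeFin.symm ((0 : Fin (n+1)), σ)).symm 0 = 0 := by
          rw [Equiv.symm_apply_eq]; simp
        simp [brY, this]
      · have : (Equiv.Perm.decomposeFin.symm ((0 : Fin (n+1)), σ)).symm i.succ = (σ.symm i).succ := by
          rw [Equiv.symm_apply_eq]; simp
        simp [brY, brV, this, Nat.succ_le_iff]
    unfold brG
    rw [show f 0 _ = 1 from h1 0 _ (by rw [hy]; simp), one_mul]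
    refine Finset.prod_congr rfl fun j _ => ?_
    rw [hy, hy]

lemma br_exists (N n : ℕ) (hN : 0 < N) (f : ℕ → (Fin n → ℕ) → ZMod 2)
    (h0 : ∀ (i : Fin n) (x : Fin n → ℕ), x i = 0 → f i x = 0)
    (h1 : ∀ (i : Fin n) (x : Fin n → ℕ), x i = N → f i x = 1) :
    ∃ p : Fin n → ℕ, (∀ i, p i < N) ∧ ∀ i : Fin n, ∃ x y : Fin n → ℕ,
      (∀ j, p j ≤ x j ∧ x j ≤ p j+1) ∧ (∀ j, p j ≤ y j ∧ y j ≤ p j+1) ∧ f i x = 0 ∧ f i y = 1 := by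
  have h := br_main N hN n f h0 h1
  have hne : brS N n f ≠ 0 := by rw [h]; decide
  unfold brS at hne
  obtain ⟨p, _, hp⟩ := Finset.exists_ne_zero_of_sum_ne_zero hne
  obtain ⟨π, _, hπ⟩ := Finset.exists_ne_zero_of_sum_ne_zero hp
  rw [Finset.prod_ne_zero_iff] at hπ
  refine ⟨fun i => (p i).val, fun i => (p i).2, fun i => ?_⟩
  have hi := hπ i (Finset.mem_range.2 i.2)
  have hb : ∀ k j, (p j).val ≤ brV (fun i => (p i).val) π k j ∧ brV (fun i => (p i).val) π k j ≤ (p j).val+1 := by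
    intro k j; unfold brV; split_ifs <;> simp
  have hd : ∀ s t : ZMod 2, s+t ≠ 0 → (s = 0 ∧ t = 1) ∨ (s = 1 ∧ t = 0) := by decide
  rcases hd _ _ hi with ⟨a1, a2⟩ | ⟨a1, a2⟩
  · exact ⟨_, _, hb _, hb _, a1, a2⟩
  · exact ⟨_, _, hb _, hb _, a2, a1⟩

open Real MeasureTheory Set Filter
set_option hygiene false
local notation "hI_" => ⟨hr.1.le, hr.2.le⟩
local notation "Sm_" => Sm a m b U V rI η κ1 κ2 B0 δ R w u u1 v v1 ρ c
local notation "Bs_" => Bs a m b U V rI L0 d1 η κ1 κ2 B0 w w1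
local notation "PH_" => PH a m b U V
local notation "cη" => (cl (w r-η) (w r+η) (u r))
local notation "b9" => (9*b*m/2)
local notation "σN" => (σ*(N*δ))
local notation "Nδ" => (N*δ)
local notation "eθ" => exp (-|r-ρ|/(θ*δ))
local notation:max "ΛR" e => ∀ r ∈ Icc 0 R, e
local notation:max "ΛI" e => ∀ r ∈ Icc p q, e
local notation:max "Λp" e => ∀ r ∈ Ioo p q, e
local notation:max "λr" e => fun r => e
local notation:max "λh" e => fun r hr => e
local notation:max "λR" e => fun r _ => e
local notation:max "λx" e => fun x => e
local notation:max "λN" e => fun n r hr => e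
local notation:max "λi" e => fun i => e
local notation:max "λs" e => fun s => e
local notation:max "λ_" e => fun _ => e
local notation:max "λt" e => fun t => e
local notation:max "λn" e => fun n => e
set_option hygiene true

section
variable {a m b U V rI L0 d1 η κ1 κ2 B0 δ R ρ c x y B k p q r t rl rh P s A lo hi e σ N ρ0 κ θ d ε y0 vR M τ : ℝ} {f w w1 g u u1 v v1 f' : ℝ → ℝ}

lemma br_cube {n : ℕ} (g : (Fin n → ℝ) → (Fin n → ℝ)) (hg : ContinuousOn g (Icc 0 1))
    (hm : ∀ x ∈ Icc (0 : Fin n → ℝ) 1, g x ∈ Icc (0 : Fin n → ℝ) 1) :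
    ∃ x ∈ Icc (0 : Fin n → ℝ) 1, g x = x := by
  classical
  have main : ∀ k : ℕ, ∃ c ∈ Icc (0 : Fin n → ℝ) 1, ∀ i : Fin n, ∃ x ∈ Icc (0 : Fin n → ℝ) 1,
      ∃ y ∈ Icc (0 : Fin n → ℝ) 1, dist x c ≤ 1/((k:ℝ)+1) ∧ dist y c ≤ 1/((k:ℝ)+1) ∧ x i ≤ g x i ∧ g y i ≤ y i := by
    intro k
    have hk : (0:ℝ) < (k:ℝ)+1 := pv
    obtain ⟨p, hp, h⟩ := br_exists (k+1) n (by omega)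
      (fun i x => if h : i < n then (if x ⟨i, h⟩ = 0 then 0 else if x ⟨i, h⟩ = k+1 then 1 else
        if (fun j => (x j : ℝ)/((k:ℝ)+1)) ⟨i, h⟩ ≤ g (fun j => (x j : ℝ)/((k:ℝ)+1)) ⟨i, h⟩ then 0 else 1) else 0)
      (by intro i x hx; simp [hx]) (by intro i x hx; simp [hx])
    have cube : ∀ x : Fin n → ℕ, (∀ j, p j ≤ x j ∧ x j ≤ p j+1) →
        (fun j => (x j : ℝ)/((k:ℝ)+1)) ∈ Icc (0 : Fin n → ℝ) 1 := by
      intro x hx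
      refine ⟨fun j => by simp only [Pi.zero_apply]; positivity, fun j => ?_⟩
      simp only [Pi.one_apply]
      rw [div_le_one hk]
      have := (hx j).2
      have := hp j
      have h3 : x j ≤ k+1 := by omega
      exact_mod_cast h3
    have dst : ∀ x : Fin n → ℕ, (∀ j, p j ≤ x j ∧ x j ≤ p j+1) →
        dist (fun j => (x j : ℝ)/((k:ℝ)+1)) (fun j => (p j : ℝ)/((k:ℝ)+1)) ≤ 1/((k:ℝ)+1) := by
      intro x hx
      rw [dist_pi_le_iff pv]
      intro j
      rw [Real.dist_eq, ← sub_div, abs_div, abs_of_pos hk]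
      gcongr
      have h1 : (p j : ℝ) ≤ x j := by exact_mod_cast (hx j).1
      have h2 : (x j : ℝ) ≤ p j+1 := by exact_mod_cast (hx j).2
      rw [abs_le]; constructor <;> linarith
    refine ⟨fun j => (p j : ℝ)/((k:ℝ)+1), cube p (fun j => ⟨le_rfl, by omega⟩), λi ?_⟩
    obtain ⟨x, y, hx, hy, fx, fy⟩ := h i
    refine ⟨_, cube x hx, _, cube y hy, dst x hx, dst y hy, ?_, ?_⟩
    · simp only [i.2, dite_true, Fin.eta] at fx
      split_ifs at fx with h1 h2 h3
      · simp only [h1]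
        have := (hm _ (cube x hx)).1 i
        simpa using this
      · exact absurd fx (by decide)
      · exact h3
      · exact absurd fx (by decide)
    · simp only [i.2, dite_true, Fin.eta] at fy
      split_ifs at fy with h1 h2 h3
      · exact absurd fy (by decide)
      · have := (hm _ (cube y hy)).2 i
        simp only [h2]
        push_cast
        rw [div_self hk.ne']
        exact this
      · exact absurd fy (by decide)
      · exact le_of_lt (not_le.1 h3)
  choose c hc hcx using main
  obtain ⟨c0, hc0, φ, hφ, hlim⟩ := (isCompact_Icc (a := (0 : Fin n → ℝ)) (b := 1)).tendsto_subseq hc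
  refine ⟨c0, hc0, ?_⟩
  funext i
  choose x hx y hy dx dy fx fy using fun k => hcx k i
  have hz : Tendsto (fun k => 1/(((φ k : ℕ) : ℝ)+1)) atTop (nhds 0) :=
    tendsto_one_div_add_atTop_nhds_zero_nat.comp hφ.tendsto_atTop
  have cv : ∀ z : ℕ → Fin n → ℝ, (∀ k, z k ∈ Icc (0 : Fin n → ℝ) 1) → (∀ k, dist (z k) (c k) ≤ 1/((k:ℝ)+1)) →
      Tendsto (fun k => z (φ k)) atTop (nhds c0) ∧ Tendsto (fun k => g (z (φ k))) atTop (nhds (g c0)) := by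
    intro z hz1 hz2
    have t1 : Tendsto (fun k => z (φ k)) atTop (nhds c0) := by
      rw [tendsto_iff_dist_tendsto_zero] at hlim ⊢
      have hs := hz.add hlim
      rw [add_zero] at hs
      refine squeeze_zero (λ_ dist_nonneg) (fun k => ?_) hs
      calc dist (z (φ k)) c0 ≤ dist (z (φ k)) (c (φ k))+dist (c (φ k)) c0 := dist_triangle _ _ _
        _ ≤ _ := add_le_add (hz2 _) le_rfl
    refine ⟨t1, ?_⟩
    exact (hg c0 hc0).tendsto.comp (tendsto_nhdsWithin_iff.2 ⟨t1, Eventually.of_forall fun k => hz1 _⟩)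
  obtain ⟨a1, a2⟩ := cv x hx dx
  obtain ⟨b1, b2⟩ := cv y hy dy
  rw [tendsto_pi_nhds] at a1 a2 b1 b2
  have l1 := le_of_tendsto_of_tendsto' (a1 i) (a2 i) (fun k => fx _)
  have l2 := le_of_tendsto_of_tendsto' (b2 i) (b1 i) (fun k => fy _)
  exact le_antisymm l2 l1

lemma br_box {ι : Type} [Fintype ι] (lo hi : ι → ℝ) (hlh : ∀ i, lo i < hi i) (g : (ι → ℝ) → (ι → ℝ))
    (hg : ContinuousOn g (Icc lo hi)) (hm : ∀ x ∈ Icc lo hi, g x ∈ Icc lo hi) :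
    ∃ x ∈ Icc lo hi, g x = x := by
  classical
  let e := (Fintype.equivFin ι)
  let A : (Fin (Fintype.card ι) → ℝ) → (ι → ℝ) := fun x i => lo i+x (e i)*(hi i-lo i)
  let B : (ι → ℝ) → (Fin (Fintype.card ι) → ℝ) := fun y j => (y (e.symm j)-lo (e.symm j))/(hi (e.symm j)-lo (e.symm j))
  have hA : ∀ x ∈ Icc (0 : Fin (Fintype.card ι) → ℝ) 1, A x ∈ Icc lo hi := by
    intro x hx
    refine ⟨λi ?_, λi ?_⟩
    · have := hx.1 (e i); have := hlh i
      simp only [A, Pi.zero_apply] at *; nlinarith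
    · have := hx.2 (e i); have := hlh i
      simp only [A, Pi.one_apply] at *; nlinarith
  have hB : ∀ y ∈ Icc lo hi, B y ∈ Icc (0 : Fin (Fintype.card ι) → ℝ) 1 := by
    intro y hy
    refine ⟨fun j => ?_, fun j => ?_⟩
    · have := hy.1 (e.symm j); have := hlh (e.symm j)
      simp only [B, Pi.zero_apply]; apply div_nonneg <;> linarith
    · have := hy.2 (e.symm j); have := hlh (e.symm j)
      simp only [B, Pi.one_apply]; rw [div_le_one ll]; linarith
  have hAB : ∀ y, A (B y) = y := by
    intro y; funext i
    have h1 := hlh i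
    have : hi i-lo i ≠ 0 := ll
    simp only [A, B, Equiv.symm_apply_apply]; field_simp; ring
  have cA : Continuous A := by fun_prop
  have cB : Continuous B := by fun_prop
  obtain ⟨x, hx, hfx⟩ := br_cube (λx B (g (A x)))
    (cB.comp_continuousOn (hg.comp cA.continuousOn hA)) (fun x hx => hB _ (hm _ (hA x hx)))
  refine ⟨A x, hA x hx, ?_⟩
  have := congrArg A hfx
  simp only [hAB] at this
  exact this

noncomputable def rH (f : ℝ → ℝ) (s : ℝ) : ℝ := (∫ t in (0:ℝ)..s, t*f t)/s
noncomputable def rJ (f : ℝ → ℝ) (r : ℝ) : ℝ := ∫ s in (0:ℝ)..r, rH f s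

lemma rI_int (hf : Measurable f) (hB : ∀ t, |f t| ≤ B) (p q : ℝ) :
    IntervalIntegrable (λt t*f t) volume p q := by
  have h1 : IntervalIntegrable f volume p q := by
    refine (intervalIntegrable_const (c := B)).mono_fun hf.aestronglyMeasurable ?_
    refine Eventually.of_forall λt ?_
    simp only [Real.norm_eq_abs]
    exact (hB t).trans (le_abs_self B)
  exact h1.continuousOn_mul continuousOn_id

lemma rI_bd (hB : ∀ t, |f t| ≤ B) (hs : 0 ≤ s) :
    |∫ t in (0:ℝ)..s, t*f t| ≤ B*s*s := by
  have := intervalIntegral.norm_integral_le_of_norm_le_const (a := 0) (b := s) (f := λt t*f t) (C := B*s) ?_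
  · rw [Real.norm_eq_abs, sub_zero, abs_of_nonneg hs] at this
    exact this
  · intro t ht
    rw [uIoc_of_le hs] at ht
    rw [Real.norm_eq_abs, abs_mul, abs_of_pos ht.1, mul_comm]
    have h0 := abs_nonneg (f t)
    exact mul_le_mul (hB t) ht.2 ht.1.le (h0.trans (hB t))

lemma rH_bd (hB : ∀ t, |f t| ≤ B) (hs : 0 ≤ s) : |rH f s| ≤ B*s := by
  unfold rH
  rcases hs.eq_or_lt with h | h
  · simp [← h]
  · rw [abs_div, abs_of_pos h, div_le_iff₀ h]
    exact rI_bd hB hs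

lemma rI_cont (hf : Measurable f) (hB : ∀ t, |f t| ≤ B) :
    Continuous (λs ∫ t in (0:ℝ)..s, t*f t) :=
  intervalIntegral.continuous_primitive (fun p q => rI_int hf hB p q) 0

lemma rH_meas (hf : Measurable f) (hB : ∀ t, |f t| ≤ B) : Measurable (rH f) :=
  (rI_cont hf hB).measurable.div measurable_id

lemma rH_cont (hf : Measurable f) (hB : ∀ t, |f t| ≤ B) (hs : 0 < s) :
    ContinuousAt (rH f) s :=
  (rI_cont hf hB).continuousAt.div continuousAt_id hs.ne'

lemma rH_int (hf : Measurable f) (hB : ∀ t, |f t| ≤ B) (hp : 0 ≤ p) (hq : 0 ≤ q) :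
    IntervalIntegrable (rH f) volume p q := by
  have hm := rH_meas hf hB
  have key : ∀ R, 0 ≤ R → IntervalIntegrable (rH f) volume 0 R := by
    intro R hR
    refine (intervalIntegrable_const (c := B*R)).mono_fun' hm.aestronglyMeasurable ?_
    rw [uIoc_of_le hR]
    refine (ae_restrict_iff' measurableSet_Ioc).2 (Eventually.of_forall fun s hs => ?_)
    have hB0 : 0 ≤ B := (abs_nonneg _).trans (hB 0)
    exact (rH_bd hB hs.1.le).trans (mL hs.2 hB0)
  exact (key p hp).symm.trans (key q hq)

lemma rJ_deriv (hf : Measurable f) (hB : ∀ t, |f t| ≤ B) (hr : 0 < r) :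
    HasDerivAt (rJ f) (rH f r) r :=
  intervalIntegral.integral_hasDerivAt_right (rH_int hf hB le_rfl hr.le)
    ((rH_meas hf hB).stronglyMeasurable.stronglyMeasurableAtFilter) (rH_cont hf hB hr)

lemma rH_deriv (hf : Measurable f) (hB : ∀ t, |f t| ≤ B) (hr : 0 < r)
    (hc : ContinuousAt f r) : HasDerivAt (rH f) (f r-rH f r/r) r := by
  have h1 : HasDerivAt (λs ∫ t in (0:ℝ)..s, t*f t) (r*f r) r :=
    intervalIntegral.integral_hasDerivAt_right (rI_int hf hB 0 r)
      ((measurable_id.mul hf).stronglyMeasurable.stronglyMeasurableAtFilter) (continuousAt_id.mul hc)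
  have h2 := h1.div (hasDerivAt_id r) hr.ne'
  refine h2.congr_deriv ?_
  unfold rH
  simp only [id]
  field_simp

lemma rH_derivR (hf : Measurable f) (hB : ∀ t, |f t| ≤ B) (hr : 0 < r)
    (hc : ContinuousWithinAt f (Ici r) r) : HasDerivWithinAt (rH f) (f r-rH f r/r) (Ici r) r := by
  have h1 : HasDerivWithinAt (λs ∫ t in (0:ℝ)..s, t*f t) (r*f r) (Ici r) r :=
    intervalIntegral.integral_hasDerivWithinAt_right (rI_int hf hB 0 r)
      ((measurable_id.mul hf).stronglyMeasurable.stronglyMeasurableAtFilter)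
      ((continuousWithinAt_id.mul hc).mono Ioi_subset_Ici_self)
  have h2 := h1.div (hasDerivWithinAt_id r _) hr.ne'
  refine h2.congr_deriv ?_
  unfold rH
  simp only [id]
  field_simp

lemma rJ_lip (hf : Measurable f) (hB : ∀ t, |f t| ≤ B)     (hr : r ∈ Icc 0 R) (hs : s ∈ Icc 0 R) : |rJ f r-rJ f s| ≤ B*R * |r-s| := by
  unfold rJ
  rw [intervalIntegral.integral_interval_sub_left (rH_int hf hB le_rfl hr.1) (rH_int hf hB le_rfl hs.1)]
  refine intervalIntegral.norm_integral_le_of_norm_le_const (a := s) (b := r) (f := rH f) (C := B*R) ?_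
  intro t ht
  have hB0 : 0 ≤ B := (abs_nonneg _).trans (hB 0)
  have h0 : 0 ≤ t := (le_min hs.1 hr.1).trans ht.1.le
  have h1 : t ≤ R := ht.2.trans (max_le hs.2 hr.2)
  exact (rH_bd hB h0).trans (mL h1 hB0)

lemma rJ_zero (f : ℝ → ℝ) : rJ f 0 = 0 := by simp [rJ]

lemma rJ_bd (hf : Measurable f) (hB : ∀ t, |f t| ≤ B)     (hr : r ∈ Icc 0 R) : |rJ f r| ≤ B*R*R := by
  have hB0 : 0 ≤ B := (abs_nonneg _).trans (hB 0)
  have hR : 0 ≤ R := hr.1.trans hr.2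
  have := rJ_lip hf hB hr (⟨le_rfl, hR⟩ : (0:ℝ) ∈ Icc 0 R)
  rw [rJ_zero, sub_zero, sub_zero, abs_of_nonneg hr.1] at this
  exact this.trans (mL hr.2 pv)

lemma rJ_tendsto {ι : Type*} {l : Filter ι} [l.IsCountablyGenerated] {F : ι → ℝ → ℝ}     (hF : ∀ i, Measurable (F i)) (hB : ∀ i t, |F i t| ≤ B) (hr : 0 ≤ r)
    (hl : ∀ᵐ t, t ∈ Ioc 0 r → Tendsto (λi F i t) l (nhds (f t))) :
    Tendsto (λi rJ (F i) r) l (nhds (rJ f r)) := by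
  unfold rJ
  refine intervalIntegral.tendsto_integral_filter_of_dominated_convergence (λ_ B*r) ?_ ?_ ?_ ?_
  · exact Eventually.of_forall λi (rH_meas (hF i) (hB i)).aestronglyMeasurable
  · refine Eventually.of_forall λi Eventually.of_forall fun s hs => ?_
    rw [uIoc_of_le hr] at hs
    have hB0 : 0 ≤ B := (abs_nonneg _).trans (hB i 0)
    exact (rH_bd (hB i) hs.1.le).trans (mL hs.2 hB0)
  · exact intervalIntegrable_const
  · refine Eventually.of_forall fun s hs => ?_
    rw [uIoc_of_le hr] at hs
    unfold rH
    refine Tendsto.div_const ?_ s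
    refine intervalIntegral.tendsto_integral_filter_of_dominated_convergence (λ_ B*r) ?_ ?_ ?_ ?_
    · exact Eventually.of_forall λi (measurable_id.mul (hF i)).aestronglyMeasurable
    · refine Eventually.of_forall λi Eventually.of_forall fun t ht => ?_
      rw [uIoc_of_le hs.1.le] at ht
      rw [Real.norm_eq_abs, abs_mul, abs_of_pos ht.1, mul_comm]
      exact mul_le_mul (hB i t) (ht.2.trans hs.2) ht.1.le ((abs_nonneg _).trans (hB i t))
    · exact intervalIntegrable_const
    · filter_upwards [hl] with t ht ht2
      rw [uIoc_of_le hs.1.le] at ht2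
      exact (ht ⟨ht2.1, ht2.2.trans hs.2⟩).const_mul t

lemma rJ_tendsto2 {ι : Type*} {l : Filter ι} [l.IsCountablyGenerated] {F : ι → ℝ → ℝ}     (hF : ∀ i, Measurable (F i)) (hB : ∀ i t, |F i t| ≤ B) {ρ : ι → ℝ} (hr : r ∈ Icc 0 R)
    (hρ : Tendsto ρ l (nhds r)) (hρ2 : ∀ᶠ i in l, ρ i ∈ Icc 0 R)
    (hl : ∀ᵐ t, t ∈ Ioc 0 r → Tendsto (λi F i t) l (nhds (f t))) :
    Tendsto (λi rJ (F i) (ρ i)) l (nhds (rJ f r)) := by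
  have h1 := rJ_tendsto hF hB hr.1 hl
  have h2 : Tendsto (λi rJ (F i) (ρ i)-rJ (F i) r) l (nhds 0) := by
    have h3 : Tendsto (λi B*R * |ρ i-r|) l (nhds 0) := by
      have := ((hρ.sub_const r).abs).const_mul (B*R)
      simpa using this
    refine squeeze_zero_norm' ?_ h3
    filter_upwards [hρ2] with i hi
    exact rJ_lip (hF i) (hB i) hi hr
  simpa using h2.add h1

lemma sub_lip (w : ℕ → ℝ → ℝ) (M L : ℝ) (hM : ∀ n x, |w n x| ≤ M) (hL : ∀ n x y, |w n x-w n y| ≤ L * |x-y|) :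
    ∃ φ : ℕ → ℕ, StrictMono φ ∧ ∃ W : ℝ → ℝ, ∀ x, Tendsto (λn w (φ n) x) atTop (nhds (W x)) := by
  have hL0 : 0 ≤ L := by
    have := (abs_nonneg _).trans (hL 0 1 0); simpa using this
  have hK : IsCompact (Set.pi univ (fun _ : ℚ => Icc (-M) M)) := isCompact_univ_pi λ_ isCompact_Icc
  obtain ⟨q, _, φ, hφ, hlim⟩ := hK.tendsto_subseq (x := fun n (x : ℚ) => w n x)
    (fun n x _ => abs_le.1 (hM n x))
  rw [tendsto_pi_nhds] at hlim
  refine ⟨φ, hφ, ?_⟩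
  have : ∀ x, ∃ l, Tendsto (λn w (φ n) x) atTop (nhds l) := by
    intro x
    apply cauchySeq_tendsto_of_complete
    rw [Metric.cauchySeq_iff']
    intro ε hε
    obtain ⟨z, hz1, hz2⟩ := exists_rat_btwn (show x < x+ε/(4*(L+1)) by
      have : 0 < ε/(4*(L+1)) := pv
      linarith)
    have hc := (hlim z).cauchySeq
    rw [Metric.cauchySeq_iff'] at hc
    obtain ⟨N, hN⟩ := hc (ε/2) pv
    refine ⟨N, fun n hn => ?_⟩
    have h1 := hN n hn
    rw [Real.dist_eq] at h1 ⊢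
    have hz : L * |x-z| < ε/4 := by
      rw [abs_sub_comm, abs_of_pos ll]
      have h2 : (z:ℝ)-x < ε/(4*(L+1)) := ll
      rw [lt_div_iff₀ pv] at h2
      have : (0:ℝ) < z-x := ll
      nlinarith
    have h2 := hL (φ n) x z
    have h3 := hL (φ N) x z
    simp only [Function.comp] at h1
    rw [abs_lt] at h1 ⊢
    rw [abs_le] at h2 h3
    constructor <;> linarith
  choose W hW using this
  exact ⟨W, hW⟩

noncomputable def sel (F1 F2 : ℝ → ℝ → ℝ → ℝ → ℝ) (ρ t x y : ℝ) : ℝ := if t < ρ then F1 ρ t x y else F2 ρ t x y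

def C4 (F : ℝ → ℝ → ℝ → ℝ → ℝ) : Prop := Continuous (fun p : ℝ × ℝ × ℝ × ℝ => F p.1 p.2.1 p.2.2.1 p.2.2.2)

noncomputable def rlp (ρ r : ℝ) : ℝ := log (max r ρ)-log ρ

lemma C4.tendsto {F : ℝ → ℝ → ℝ → ℝ → ℝ} (hF : C4 F) {ι : Type*} {l : Filter ι} {ρ x y : ι → ℝ} {x0 : ℝ} (t : ℝ)
    (h1 : Tendsto ρ l (nhds ρ0)) (h2 : Tendsto x l (nhds x0)) (h3 : Tendsto y l (nhds y0)) :
    Tendsto (λi F (ρ i) t (x i) (y i)) l (nhds (F ρ0 t x0 y0)) := by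
  have := (Continuous.tendsto hF (ρ0, t, x0, y0)).comp
    (h1.prodMk_nhds ((tendsto_const_nhds (x := t)).prodMk_nhds (h2.prodMk_nhds h3)))
  exact this

lemma sel_tendsto {F1 F2 : ℝ → ℝ → ℝ → ℝ → ℝ} (h1 : C4 F1) (h2 : C4 F2) {ι : Type*} {l : Filter ι} {ρ x y : ι → ℝ}
    {x0 : ℝ} (ht : t ≠ ρ0) (hρ : Tendsto ρ l (nhds ρ0)) (hx : Tendsto x l (nhds x0)) (hy : Tendsto y l (nhds y0)) :
    Tendsto (λi sel F1 F2 (ρ i) t (x i) (y i)) l (nhds (sel F1 F2 ρ0 t x0 y0)) := by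
  unfold sel
  rcases lt_or_gt_of_ne ht with h | h
  · rw [if_pos h]
    refine (h1.tendsto t hρ hx hy).congr' ?_
    filter_upwards [hρ.eventually (lt_mem_nhds h)] with i hi
    rw [if_pos hi]
  · rw [if_neg (not_lt.2 h.le)]
    refine (h2.tendsto t hρ hx hy).congr' ?_
    filter_upwards [hρ.eventually (gt_mem_nhds h)] with i hi
    rw [if_neg (not_lt.2 hi.le)]

lemma sel_meas {F1 F2 : ℝ → ℝ → ℝ → ℝ → ℝ} (h1 : C4 F1) (h2 : C4 F2) (ρ : ℝ) {x y : ℝ → ℝ} (hx : Measurable x) (hy : Measurable y) :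
    Measurable (λt sel F1 F2 ρ t (x t) (y t)) := by
  unfold sel
  refine Measurable.ite measurableSet_Iio ?_ ?_
  · exact (Continuous.measurable h1).comp (measurable_const.prodMk (measurable_id.prodMk (hx.prodMk hy)))
  · exact (Continuous.measurable h2).comp (measurable_const.prodMk (measurable_id.prodMk (hx.prodMk hy)))

lemma sel_bd {F1 F2 : ℝ → ℝ → ℝ → ℝ → ℝ} (h1 : ∀ p t x y, |F1 p t x y| ≤ B) (h2 : ∀ p t x y, |F2 p t x y| ≤ B)
    (p t x y : ℝ) : |sel F1 F2 p t x y| ≤ B := by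
  unfold sel; split_ifs
  · exact h1 _ _ _ _
  · exact h2 _ _ _ _

lemma log_lip (ha : 0 < a) (hx : a ≤ x) (hy : a ≤ y) : |log x-log y| ≤ |x-y| / a := by
  have key : ∀ x y, a ≤ x → a ≤ y → log x-log y ≤ |x-y| / a := by
    intro x y hx hy
    have hx0 := ha.trans_le hx
    have hy0 := ha.trans_le hy
    rw [← Real.log_div hx0.ne' hy0.ne']
    refine (Real.log_le_sub_one_of_pos pv).trans ?_
    rw [div_sub_one hy0.ne', div_le_div_iff₀ hy0 ha]
    have h1 := le_abs_self (x-y)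
    have h2 := abs_nonneg (x-y)
    nlinarith
  rw [abs_le]
  have h1 := key x y hx hy
  have h2 := key y x hy hx
  rw [abs_sub_comm] at h2
  constructor <;> linarith

lemma rlp_lip (hl : 0 < rl) (hρ : rl ≤ ρ) : |rlp ρ x-rlp ρ y| ≤ |x-y| / rl := by
  unfold rlp
  rw [sub_sub_sub_cancel_right]
  refine (log_lip hl (hρ.trans (le_max_right _ _)) (hρ.trans (le_max_right _ _))).trans ?_
  exact div_le_div_of_nonneg_right (abs_max_sub_max_le_abs _ _ _) hl.le

lemma rlp_bd (hl : 0 < rl) (hρ : rl ≤ ρ) (hR : ρ ≤ R) (hx : x ≤ R) (hx0 : 0 ≤ x) : |rlp ρ x| ≤ R/rl := by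
  have := rlp_lip (x := x) (y := 0) hl hρ
  have h0 : rlp ρ 0 = 0 := by unfold rlp; rw [max_eq_right ll]; ring
  rw [h0, sub_zero, sub_zero, abs_of_nonneg hx0] at this
  exact this.trans (by gcongr)

lemma rlp_tendsto {ι : Type*} {l : Filter ι} {ρ : ι → ℝ} (r : ℝ) (h0 : 0 < ρ0) (hρ : Tendsto ρ l (nhds ρ0)) :
    Tendsto (λi rlp (ρ i) r) l (nhds (rlp ρ0 r)) := by
  unfold rlp
  exact ((tendsto_const_nhds.max hρ).log pv).sub (hρ.log h0.ne')

noncomputable def cc (g : ℝ → ℝ) (θ vR R ρ : ℝ) : ℝ := (vR-θ-rJ g R+rJ g ρ)/rlp ρ R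

lemma rlp_pos (hl : 0 < rl) (hR : rh < R) (hρ : ρ ∈ Icc rl rh) : log (R/rh) ≤ rlp ρ R ∧ 0 < log (R/rh) := by
  have h1 : 0 < ρ := hl.trans_le hρ.1
  have h2 : 0 < rh := h1.trans_le hρ.2
  constructor
  · unfold rlp
    rw [max_eq_left (hρ.2.trans hR.le), Real.log_div (h2.trans hR).ne' h2.ne']
    linarith [Real.log_le_log h1 hρ.2]
  · apply Real.log_pos
    rw [lt_div_iff₀ h2]; linarith

lemma cc_bd (hg : Measurable g) (hB : ∀ t, |g t| ≤ B) (hl : 0 < rl) (hR : rh < R)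
    (hρ : ρ ∈ Icc rl rh) : |cc g θ vR R ρ| ≤ (|vR| + |θ| + 2*(B*R*R))/log (R/rh) := by
  have h1 : 0 < ρ := hl.trans_le hρ.1
  have h2 : 0 < rh := h1.trans_le hρ.2
  obtain ⟨a1, a2⟩ := rlp_pos hl hR hρ
  have j1 := rJ_bd (R := R) hg hB (⟨ll, le_rfl⟩ : R ∈ Icc 0 R)
  have j2 := rJ_bd (R := R) hg hB (⟨ll, mA hρ.2⟩ : ρ ∈ Icc 0 R)
  unfold cc
  rw [abs_div, abs_of_pos (a2.trans_le a1)]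
  have n : |vR-θ-rJ g R+rJ g ρ| ≤ |vR| + |θ| + 2*(B*R*R) := by
    linarith [abs_add_le (vR-θ-rJ g R) (rJ g ρ), abs_sub (vR-θ) (rJ g R), abs_sub vR θ]
  have n0 := (abs_nonneg _).trans n
  gcongr

lemma cc_tendsto {ι : Type*} {l : Filter ι} [l.IsCountablyGenerated] {G : ι → ℝ → ℝ} {ρ : ι → ℝ}
    (hG : ∀ i, Measurable (G i)) (hB : ∀ i t, |G i t| ≤ B) (hl : 0 < rl) (hR : rh < R)
    (hρ0 : ρ0 ∈ Icc rl rh) (hρ : Tendsto ρ l (nhds ρ0)) (hρ2 : ∀ᶠ i in l, ρ i ∈ Icc rl rh)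
    (hlim : ∀ᵐ t, t ∈ Ioc 0 R → Tendsto (λi G i t) l (nhds (g t))) :
    Tendsto (λi cc (G i) θ vR R (ρ i)) l (nhds (cc g θ vR R ρ0)) ∧
    Tendsto (λi rJ (G i) (ρ i)) l (nhds (rJ g ρ0)) := by
  have h1 : 0 < ρ0 := hl.trans_le hρ0.1
  obtain ⟨a1, a2⟩ := rlp_pos hl hR hρ0
  have h3 : Tendsto (λi rJ (G i) (ρ i)) l (nhds (rJ g ρ0)) := by
    refine rJ_tendsto2 (R := R) hG hB ⟨h1.le, mA hρ0.2⟩ hρ ?_ ?_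
    · filter_upwards [hρ2] with i hi
      exact ⟨mA hi.1, mA hi.2⟩
    · filter_upwards [hlim] with t ht ht2
      exact ht ⟨ht2.1, mB ht2.2 hρ0.2⟩
  refine ⟨?_, h3⟩
  unfold cc
  refine Tendsto.div ?_ (rlp_tendsto R h1 hρ) (a2.trans_le a1).ne'
  refine Tendsto.add (tendsto_const_nhds.sub ?_) h3
  exact rJ_tendsto hG hB mA hρ0.2 hlim

noncomputable def gi (R : ℝ) (N : ℕ) (t : ℝ) : Fin (N+2) := ⟨min ⌊((N:ℝ)+1)*t/R⌋₊ (N+1), by omega⟩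

lemma gi_meas (R : ℝ) (N : ℕ) : Measurable (gi R N) := by
  have h1 : Measurable (fun t : ℝ => ⌊((N:ℝ)+1)*t/R⌋₊) :=
    Nat.measurable_floor.comp (by fun_prop)
  have h2 : Measurable (fun k : ℕ => (⟨min k (N+1), by omega⟩ : Fin (N+2))) := measurable_from_top
  exact h2.comp h1

lemma gi_close (hR : 0 < R) (N : ℕ) (ht : t ∈ Icc 0 R) :
    |R*((gi R N t).val : ℝ)/((N:ℝ)+1)-t| ≤ R/((N:ℝ)+1) ∧ R*((gi R N t).val : ℝ)/((N:ℝ)+1) ∈ Icc 0 R := by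
  have hN : (0:ℝ) < (N:ℝ)+1 := pv
  have h1 : ((N:ℝ)+1)*t/R ≤ N+1 := by
    rw [div_le_iff₀ hR]; have := ht.2; nlinarith
  have h0 : 0 ≤ ((N:ℝ)+1)*t/R := by have := ht.1; positivity
  have h2 := Nat.floor_le h0
  have h3 := Nat.lt_floor_add_one (((N:ℝ)+1)*t/R)
  have h4 : ⌊((N:ℝ)+1)*t/R⌋₊ ≤ N+1 := by
    have : (⌊((N:ℝ)+1)*t/R⌋₊ : ℝ) ≤ ((N+1 : ℕ) : ℝ) := by push_cast; linarith
    exact_mod_cast this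
  have h5 : (gi R N t).val = ⌊((N:ℝ)+1)*t/R⌋₊ := by simp [gi, h4]
  rw [h5]
  set k := (⌊((N:ℝ)+1)*t/R⌋₊ : ℝ) with hk
  have hk0 : 0 ≤ k := pv
  have e : t = R*(((N:ℝ)+1)*t/R)/((N:ℝ)+1) := by field_simp
  refine ⟨?_, pv, ?_⟩
  · rw [abs_sub_comm, abs_le]
    constructor
    · have : R*k/((N:ℝ)+1) ≤ t := by
        rw [e]; gcongr
      have : 0 < R/((N:ℝ)+1) := pv
      linarith
    · have : t ≤ R*(k+1)/((N:ℝ)+1) := by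
        conv_lhs => rw [e]
        gcongr
      have e2 : R*(k+1)/((N:ℝ)+1) = R*k/((N:ℝ)+1)+R/((N:ℝ)+1) := by ring
      linarith
  · rw [div_le_iff₀ hN]
    nlinarith

lemma fp_disc {F1 F2 G1 G2 : ℝ → ℝ → ℝ → ℝ → ℝ} (cF1 : C4 F1) (cF2 : C4 F2) (cG1 : C4 G1) (cG2 : C4 G2)
    (bF1 : ∀ p t x y, |F1 p t x y| ≤ B) (bF2 : ∀ p t x y, |F2 p t x y| ≤ B)
    (bG1 : ∀ p t x y, |G1 p t x y| ≤ B) (bG2 : ∀ p t x y, |G2 p t x y| ≤ B)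
    (hl : 0 < rl) (hlh : rl < rh) (hR : rh < R) (uR θ vR : ℝ) (N : ℕ) :
    ∃ U V : ℝ → ℝ, ∃ ρ ∈ Icc rl rh, Measurable U ∧ Measurable V ∧
      ρ = max rl (min rh (ρ-cc (λt sel G1 G2 ρ t (U t) (V t)) θ vR R ρ)) ∧
      ∀ t, U t = uR+rJ (λt sel F1 F2 ρ t (U t) (V t)) (R*((gi R N t).val : ℝ)/((N:ℝ)+1))
            - rJ (λt sel F1 F2 ρ t (U t) (V t)) R ∧
          V t = θ+rJ (λt sel G1 G2 ρ t (U t) (V t)) (R*((gi R N t).val : ℝ)/((N:ℝ)+1))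
            - rJ (λt sel G1 G2 ρ t (U t) (V t)) ρ
            + cc (λt sel G1 G2 ρ t (U t) (V t)) θ vR R ρ*rlp ρ (R*((gi R N t).val : ℝ)/((N:ℝ)+1)) := by
  have hR0 : 0 < R := ll
  have hN : (0:ℝ) < (N:ℝ)+1 := pv
  have hB0 : 0 ≤ B := (abs_nonneg _).trans (bF1 0 0 0 0)
  let ι := Option (Bool × Fin (N+2))
  let pt : Fin (N+2) → ℝ := λi R*(i.val : ℝ)/((N:ℝ)+1)
  have hpt : ∀ i, pt i ∈ Icc 0 R := by
    intro i
    refine ⟨pv, ?_⟩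
    simp only [pt]
    rw [div_le_iff₀ hN]
    have : (i.val : ℝ) ≤ ((N+1 : ℕ) : ℝ) := by exact_mod_cast Nat.lt_succ_iff.1 i.2
    push_cast at this
    nlinarith
  let f : (ι → ℝ) → ℝ → ℝ := fun x t => sel F1 F2 (x none) t (x (some (true, gi R N t))) (x (some (false, gi R N t)))
  let g : (ι → ℝ) → ℝ → ℝ := fun x t => sel G1 G2 (x none) t (x (some (true, gi R N t))) (x (some (false, gi R N t)))
  have mU : ∀ (x : ι → ℝ) (b : Bool), Measurable (λt x (some (b, gi R N t))) := fun x b =>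
    (measurable_from_top (f := fun i : Fin (N+2) => x (some (b, i)))).comp (gi_meas R N)
  have mf : ∀ x, Measurable (f x) := λx sel_meas cF1 cF2 _ (mU x true) (mU x false)
  have mg : ∀ x, Measurable (g x) := λx sel_meas cG1 cG2 _ (mU x true) (mU x false)
  have bf : ∀ x t, |f x t| ≤ B := fun x t => sel_bd bF1 bF2 _ _ _ _
  have bg : ∀ x t, |g x t| ≤ B := fun x t => sel_bd bG1 bG2 _ _ _ _
  let c : (ι → ℝ) → ℝ := λx cc (g x) θ vR R (x none)
  let T : (ι → ℝ) → (ι → ℝ) := fun x j => match j with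
    | none => max rl (min rh (x none-c x))
    | some (true, i) => uR+rJ (f x) (pt i)-rJ (f x) R
    | some (false, i) => θ+rJ (g x) (pt i)-rJ (g x) (x none)+c x*rlp (x none) (pt i)
  set D := (|vR| + |θ| + 2*(B*R*R))/log (R/rh) with hD
  have hD0 : 0 ≤ D := (abs_nonneg _).trans (cc_bd (θ := θ) (vR := vR) (mg 0) (bg 0) hl hR (⟨le_rfl, hlh.le⟩ : rl ∈ Icc rl rh))
  let M : ℝ := |uR| + |θ| + 2*(B*R*R)+D*(R/rl)+1
  have hM : 0 < M := pv
  let lo : ι → ℝ := fun j => match j with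
    | none => rl
    | some _ => -M
  let hi : ι → ℝ := fun j => match j with
    | none => rh
    | some _ => M
  have hρ : ∀ x ∈ Icc lo hi, x none ∈ Icc rl rh := fun x hx => ⟨hx.1 none, hx.2 none⟩
  have jb := fun (x : ι → ℝ) (r : ℝ) (hr : r ∈ Icc 0 R) => abs_le.1 (rJ_bd (mf x) (bf x) hr)
  have jg := fun (x : ι → ℝ) (r : ℝ) (hr : r ∈ Icc 0 R) => abs_le.1 (rJ_bd (mg x) (bg x) hr)
  have hRR : R ∈ Icc 0 R := ⟨hR0.le, le_rfl⟩
  have hmap : ∀ x ∈ Icc lo hi, T x ∈ Icc lo hi := by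
    intro x hx
    have hr := hρ x hx
    have key : ∀ j, lo j ≤ T x j ∧ T x j ≤ hi j := by
      intro j
      match j with
      | none => exact ⟨le_max_left _ _, max_le hlh.le (min_le_left _ _)⟩
      | some (true, i) =>
        rw [← abs_le]
        show |uR+rJ (f x) (pt i)-rJ (f x) R| ≤ M
        have a1 := jb x _ (hpt i); have a2 := jb x R hRR
        have a3 := abs_le.1 (le_refl |uR|)
        have a4 := abs_nonneg θ
        have : 0 ≤ D*(R/rl) := pv
        rw [abs_le]; constructor <;> simp only [M] <;> linarith
      | some (false, i) =>
        rw [← abs_le]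
        show |θ+rJ (g x) (pt i)-rJ (g x) (x none)+c x*rlp (x none) (pt i)| ≤ M
        have a1 := jg x _ (hpt i); have a2 := jg x (x none) ⟨mA hr.1, mA hr.2⟩
        have a3 := abs_le.1 (le_refl |θ|)
        have a4 := abs_nonneg uR
        have a5 : |c x*rlp (x none) (pt i)| ≤ D*(R/rl) := by
          rw [abs_mul]
          exact mul_le_mul (cc_bd (mg x) (bg x) hl hR hr) (rlp_bd hl hr.1 mA hr.2 (hpt i).2 (hpt i).1)
            (abs_nonneg _) hD0
        have a6 := abs_le.1 a5
        rw [abs_le]; constructor <;> simp only [M] <;> linarith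
    exact ⟨fun j => (key j).1, fun j => (key j).2⟩
  have hcont : ContinuousOn T (Icc lo hi) := by
    intro x0 hx0
    have hr := hρ x0 hx0
    have ev : ∀ j, Tendsto (fun x : ι → ℝ => x j) (nhdsWithin x0 (Icc lo hi)) (nhds (x0 j)) := fun j =>
      ((continuous_apply j).tendsto x0).mono_left nhdsWithin_le_nhds
    have hae : ∀ᵐ t : ℝ, t ≠ x0 none := by simp [ae_iff]
    have lf : ∀ᵐ t : ℝ, Tendsto (λx f x t) (nhdsWithin x0 (Icc lo hi)) (nhds (f x0 t)) := by
      filter_upwards [hae] with t ht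
      exact sel_tendsto cF1 cF2 ht (ev _) (ev _) (ev _)
    have lg : ∀ᵐ t : ℝ, Tendsto (λx g x t) (nhdsWithin x0 (Icc lo hi)) (nhds (g x0 t)) := by
      filter_upwards [hae] with t ht
      exact sel_tendsto cG1 cG2 ht (ev _) (ev _) (ev _)
    have jf : ΛR Tendsto (λx rJ (f x) r) (nhdsWithin x0 (Icc lo hi)) (nhds (rJ (f x0) r)) := by
      intro r h
      exact rJ_tendsto mf bf h.1 (by filter_upwards [lf] with t ht _ using ht)
    have jg : ΛR Tendsto (λx rJ (g x) r) (nhdsWithin x0 (Icc lo hi)) (nhds (rJ (g x0) r)) := by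
      intro r h
      exact rJ_tendsto mg bg h.1 (by filter_upwards [lg] with t ht _ using ht)
    obtain ⟨lc, lr⟩ := cc_tendsto (θ := θ) (vR := vR) mg bg hl hR hr (ev none)
      (by filter_upwards [self_mem_nhdsWithin] with x hx using hρ x hx) (by filter_upwards [lg] with t ht _ using ht)
    rw [ContinuousWithinAt, tendsto_pi_nhds]
    intro j
    match j with
    | none => exact tendsto_const_nhds.max (tendsto_const_nhds.min ((ev none).sub lc))
    | some (true, i) => exact (tendsto_const_nhds.add (jf _ (hpt i))).sub (jf _ hRR)
    | some (false, i) =>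
      exact ((tendsto_const_nhds.add (jg _ (hpt i))).sub lr).add (lc.mul (rlp_tendsto _ (hl.trans_le hr.1) (ev none)))
  obtain ⟨x, hx, hfx⟩ := br_box lo hi (by
    intro j
    match j with
    | none => exact hlh
    | some _ => show -M < M; linarith) T hcont hmap
  refine ⟨λt x (some (true, gi R N t)), λt x (some (false, gi R N t)), x none, hρ x hx, mU x true, mU x false, ?_, ?_⟩
  · exact (congrFun hfx none).symm
  · intro t
    exact ⟨(congrFun hfx (some (true, gi R N t))).symm, (congrFun hfx (some (false, gi R N t))).symm⟩

noncomputable def cl (lo hi x : ℝ) : ℝ := max lo (min hi x)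

lemma cl_mem (h : lo ≤ hi) (x : ℝ) : cl lo hi x ∈ Icc lo hi :=
  ⟨le_max_left _ _, max_le h (min_le_left _ _)⟩

lemma cl_id (h : x ∈ Icc lo hi) : cl lo hi x = x := by
  unfold cl; rw [min_eq_right h.2, max_eq_right h.1]

lemma cl_lip (lo hi x y : ℝ) : |cl lo hi x-cl lo hi y| ≤ |x-y| := by
  unfold cl
  rw [max_comm lo, max_comm lo]
  refine (abs_max_sub_max_le_abs _ _ _).trans ?_
  have := abs_min_sub_min_le_max hi x hi y
  simpa using this

lemma lip_cont {L : ℝ} (h : ∀ x y, |w x-w y| ≤ L * |x-y|) : Continuous w := by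
  have hL0 : 0 ≤ L := by
    have := (abs_nonneg _).trans (h 1 0); simpa using this
  refine (LipschitzWith.of_dist_le_mul (K := ⟨L, hL0⟩) fun x y => ?_).continuous
  exact h x y

lemma fp_lem {F1 F2 G1 G2 : ℝ → ℝ → ℝ → ℝ → ℝ} (cF1 : C4 F1) (cF2 : C4 F2) (cG1 : C4 G1) (cG2 : C4 G2)
    (bF1 : ∀ p t x y, |F1 p t x y| ≤ B) (bF2 : ∀ p t x y, |F2 p t x y| ≤ B)
    (bG1 : ∀ p t x y, |G1 p t x y| ≤ B) (bG2 : ∀ p t x y, |G2 p t x y| ≤ B)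
    (hl : 0 < rl) (hlh : rl < rh) (hR : rh < R) (uR θ vR : ℝ) :
    ∃ u v : ℝ → ℝ, ∃ ρ ∈ Icc rl rh, ∃ c : ℝ, Continuous u ∧ Continuous v ∧
      (c = 0 ∨ (ρ = rl ∧ 0 < c) ∨ (ρ = rh ∧ c < 0)) ∧ u R = uR ∧ v ρ = θ ∧ v R = vR ∧
      ΛR u r = uR+rJ (λt sel F1 F2 ρ t (u t) (v t)) r-rJ (λt sel F1 F2 ρ t (u t) (v t)) R ∧
          v r = θ+rJ (λt sel G1 G2 ρ t (u t) (v t)) r-rJ (λt sel G1 G2 ρ t (u t) (v t)) ρ+c*rlp ρ r := by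
  have hR0 : 0 < R := ll
  have hB0 : 0 ≤ B := (abs_nonneg _).trans (bF1 0 0 0 0)
  choose U V ρ hρ mU mV hfix hUV using fun N => fp_disc cF1 cF2 cG1 cG2 bF1 bF2 bG1 bG2 hl hlh hR uR θ vR N
  let f : ℕ → ℝ → ℝ := fun n t => sel F1 F2 (ρ n) t (U n t) (V n t)
  let g : ℕ → ℝ → ℝ := fun n t => sel G1 G2 (ρ n) t (U n t) (V n t)
  have mf : ∀ n, Measurable (f n) := λn sel_meas cF1 cF2 _ (mU n) (mV n)
  have mg : ∀ n, Measurable (g n) := λn sel_meas cG1 cG2 _ (mU n) (mV n)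
  have bf : ∀ n t, |f n t| ≤ B := fun x t => sel_bd bF1 bF2 _ _ _ _
  have bg : ∀ n t, |g n t| ≤ B := fun x t => sel_bd bG1 bG2 _ _ _ _
  let c : ℕ → ℝ := λn cc (g n) θ vR R (ρ n)
  set D := (|vR| + |θ| + 2*(B*R*R))/log (R/rh) with hD
  have cD : ∀ n, |c n| ≤ D := λn cc_bd (mg n) (bg n) hl hR (hρ n)
  have hD0 : 0 ≤ D := (abs_nonneg _).trans (cD 0)
  let uu : ℕ → ℝ → ℝ := fun n r => uR+rJ (f n) (cl 0 R r)-rJ (f n) R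
  let vv : ℕ → ℝ → ℝ := fun n r => θ+rJ (g n) (cl 0 R r)-rJ (g n) (ρ n)+c n*rlp (ρ n) (cl 0 R r)
  have hcl := λr cl_mem hR0.le r
  have hRR : R ∈ Icc 0 R := ⟨hR0.le, le_rfl⟩
  have hρR : ∀ n, ρ n ∈ Icc 0 R := λn ⟨by linarith [(hρ n).1], by linarith [(hρ n).2]⟩
  let M : ℝ := |uR| + |θ| + 2*(B*R*R)+D*(R/rl)
  let L : ℝ := B*R+D/rl
  have uM : ∀ n x, |uu n x| ≤ M := by
    intro n x
    have h1 := abs_le.1 (rJ_bd (mf n) (bf n) (hcl x))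
    have h2 := abs_le.1 (rJ_bd (mf n) (bf n) hRR)
    have h3 := abs_le.1 (le_refl |uR|)
    have h4 := abs_nonneg θ
    have h5 : 0 ≤ D*(R/rl) := pv
    rw [abs_le]; constructor <;> simp only [uu, M] <;> linarith
  have vM : ∀ n x, |vv n x| ≤ M := by
    intro n x
    have h1 := abs_le.1 (rJ_bd (mg n) (bg n) (hcl x))
    have h2 := abs_le.1 (rJ_bd (mg n) (bg n) (hρR n))
    have h3 := abs_le.1 (le_refl |θ|)
    have h4 := abs_nonneg uR
    have h5 : |c n*rlp (ρ n) (cl 0 R x)| ≤ D*(R/rl) := by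
      rw [abs_mul]
      exact mul_le_mul (cD n) (rlp_bd hl (hρ n).1 (hρR n).2 (hcl x).2 (hcl x).1) (abs_nonneg _) hD0
    have h5 := abs_le.1 h5
    rw [abs_le]; constructor <;> simp only [vv, M] <;> linarith
  have uL : ∀ n x y, |uu n x-uu n y| ≤ L * |x-y| := by
    intro n x y
    have h1 := rJ_lip (mf n) (bf n) (hcl x) (hcl y)
    have h2 : B*R * |cl 0 R x-cl 0 R y| ≤ B*R * |x-y| :=
      mL (cl_lip _ _ _ _) pv
    have h3 : 0 ≤ D/rl * |x-y| := pv
    have h4 : uu n x-uu n y = rJ (f n) (cl 0 R x)-rJ (f n) (cl 0 R y) := by simp only [uu]; ring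
    rw [h4]; simp only [L]; linarith
  have vL : ∀ n x y, |vv n x-vv n y| ≤ L * |x-y| := by
    intro n x y
    have h1 := rJ_lip (mg n) (bg n) (hcl x) (hcl y)
    have h2 : B*R * |cl 0 R x-cl 0 R y| ≤ B*R * |x-y| :=
      mL (cl_lip _ _ _ _) pv
    have h3 : |c n*(rlp (ρ n) (cl 0 R x)-rlp (ρ n) (cl 0 R y))| ≤ D*(|x-y| / rl) := by
      rw [abs_mul]
      refine mul_le_mul (cD n) ((rlp_lip hl (hρ n).1).trans ?_) (abs_nonneg _) hD0
      exact div_le_div_of_nonneg_right (cl_lip _ _ _ _) hl.le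
    have h4 : vv n x-vv n y = (rJ (g n) (cl 0 R x)-rJ (g n) (cl 0 R y))+c n*(rlp (ρ n) (cl 0 R x)-rlp (ρ n) (cl 0 R y)) := by
      simp only [vv]; ring
    rw [h4]
    refine (abs_add_le _ _).trans ?_
    have h5 : L * |x-y| = B*R * |x-y| + D*(|x-y| / rl) := by simp only [L]; ring
    linarith
  obtain ⟨ρ0, hρ0, φ0, hφ0, lρ⟩ := isCompact_Icc.tendsto_subseq hρ
  obtain ⟨φ1, hφ1, u, lu⟩ := sub_lip (λn uu (φ0 n)) M L (λn uM _) (λn uL _)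
  obtain ⟨φ2, hφ2, v, lv⟩ := sub_lip (λn vv (φ0 (φ1 n))) M L (λn vM _) (λn vL _)
  let ψ : ℕ → ℕ := λn φ0 (φ1 (φ2 n))
  have hψ : Tendsto ψ atTop atTop := (hφ0.comp (hφ1.comp hφ2)).tendsto_atTop
  have lρ' : Tendsto (λn ρ (ψ n)) atTop (nhds ρ0) := lρ.comp (hφ1.comp hφ2).tendsto_atTop
  have lu' : ∀ x, Tendsto (λn uu (ψ n) x) atTop (nhds (u x)) := λx (lu x).comp hφ2.tendsto_atTop
  have lv' : ∀ x, Tendsto (λn vv (ψ n) x) atTop (nhds (v x)) := lv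
  have step : ∀ (w : ℕ → ℝ → ℝ) (S : ℕ → ℝ → ℝ) (w0 : ℝ) (t : ℝ), t ∈ Icc 0 R → (∀ n x y, |w n x-w n y| ≤ L * |x-y|) →
      (∀ n, S n t = w n (R*((gi R n t).val : ℝ)/((n:ℝ)+1))) → Tendsto (λn w (ψ n) t) atTop (nhds w0) →
      Tendsto (λn S (ψ n) t) atTop (nhds w0) := by
    intro w S w0 t ht hw hS hlim
    have hL0 : 0 ≤ L := pv
    have h1 : Tendsto (fun n : ℕ => L*(R/((n:ℝ)+1))) atTop (nhds 0) := by
      have := (tendsto_one_div_add_atTop_nhds_zero_nat (𝕜 := ℝ)).const_mul (L*R)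
      rw [mul_zero] at this
      refine this.congr λn by ring
    have h2 : Tendsto (λn S (ψ n) t-w (ψ n) t) atTop (nhds 0) := by
      refine squeeze_zero_norm (λn ?_) (h1.comp hψ)
      rw [hS, Real.norm_eq_abs]
      refine (hw _ _ _).trans ?_
      exact mL (gi_close hR0 _ ht).1 hL0
    have h3 := h2.add hlim
    simpa using h3
  have lU : ∀ t ∈ Icc 0 R, Tendsto (λn U (ψ n) t) atTop (nhds (u t)) := by
    intro t ht
    refine step uu U _ t ht uL (λn ?_) (lu' t)
    simp only [uu]
    rw [cl_id (gi_close hR0 n ht).2]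
    exact (hUV n t).1
  have lV : ∀ t ∈ Icc 0 R, Tendsto (λn V (ψ n) t) atTop (nhds (v t)) := by
    intro t ht
    refine step vv V _ t ht vL (λn ?_) (lv' t)
    simp only [vv]
    rw [cl_id (gi_close hR0 n ht).2]
    exact (hUV n t).2
  have hne : ∀ᵐ t : ℝ, t ≠ ρ0 := by
    rw [ae_iff]; simp
  let f0 : ℝ → ℝ := λt sel F1 F2 ρ0 t (u t) (v t)
  let g0 : ℝ → ℝ := λt sel G1 G2 ρ0 t (u t) (v t)
  have lf : ∀ᵐ t, t ∈ Ioc 0 R → Tendsto (λn f (ψ n) t) atTop (nhds (f0 t)) := by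
    filter_upwards [hne] with t ht hm
    exact sel_tendsto cF1 cF2 ht lρ' (lU t ⟨hm.1.le, hm.2⟩) (lV t ⟨hm.1.le, hm.2⟩)
  have lg : ∀ᵐ t, t ∈ Ioc 0 R → Tendsto (λn g (ψ n) t) atTop (nhds (g0 t)) := by
    filter_upwards [hne] with t ht hm
    exact sel_tendsto cG1 cG2 ht lρ' (lU t ⟨hm.1.le, hm.2⟩) (lV t ⟨hm.1.le, hm.2⟩)
  have jf : ΛR Tendsto (λn rJ (f (ψ n)) r) atTop (nhds (rJ f0 r)) := λh
    rJ_tendsto (λn mf _) (λn bf _) hr.1 (lf.mono fun t h1 h2 => h1 ⟨h2.1, h2.2.trans hr.2⟩)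
  have jg : ΛR Tendsto (λn rJ (g (ψ n)) r) atTop (nhds (rJ g0 r)) := λh
    rJ_tendsto (λn mg _) (λn bg _) hr.1 (lg.mono fun t h1 h2 => h1 ⟨h2.1, h2.2.trans hr.2⟩)
  obtain ⟨lc, lr⟩ := cc_tendsto (θ := θ) (vR := vR) (λn mg (ψ n)) (λn bg (ψ n)) hl hR hρ0 lρ'
    (Eventually.of_forall λn hρ _) lg
  set c0 := cc g0 θ vR R ρ0 with hc0
  have hpos : 0 < ρ0 := hl.trans_le hρ0.1
  have hρ0R : ρ0 ∈ Icc 0 R := ⟨hpos.le, mA hρ0.2⟩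
  have eqs : ΛR u r = uR+rJ f0 r-rJ f0 R ∧ v r = θ+rJ g0 r-rJ g0 ρ0+c0*rlp ρ0 r := by
    intro r hr
    constructor
    · refine tendsto_nhds_unique (lu' r) ?_
      simp only [uu]
      rw [cl_id hr]
      exact (tendsto_const_nhds.add (jf r hr)).sub (jf R hRR)
    · refine tendsto_nhds_unique (lv' r) ?_
      simp only [vv]
      rw [cl_id hr]
      exact ((tendsto_const_nhds.add (jg r hr)).sub lr).add (lc.mul (rlp_tendsto r hpos lρ'))
  have limL : ∀ (w : ℕ → ℝ → ℝ) (w0 : ℝ → ℝ), (∀ n x y, |w n x-w n y| ≤ L * |x-y|) →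
      (∀ x, Tendsto (λn w (ψ n) x) atTop (nhds (w0 x))) → Continuous w0 := by
    intro w w0 h1 h2
    refine lip_cont (L := L) fun x y => ?_
    exact le_of_tendsto ((h2 x).sub (h2 y)).abs (Eventually.of_forall λn h1 _ _ _)
  have hfix0 : ρ0 = max rl (min rh (ρ0-c0)) :=
    tendsto_nhds_unique lρ' ((tendsto_const_nhds.max (tendsto_const_nhds.min (lρ'.sub lc))).congr λn (hfix _).symm)
  refine ⟨u, v, ρ0, hρ0, c0, limL uu u uL lu', limL vv v vL lv', ?_, ?_, ?_, ?_, eqs⟩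
  · rcases lt_trichotomy c0 0 with h | h | h
    · right; right
      refine ⟨?_, h⟩
      rcases le_total rh (ρ0-c0) with h1 | h1
      · rw [min_eq_left h1, max_eq_right hlh.le] at hfix0; exact hfix0
      · rw [min_eq_right h1, max_eq_right mA hρ0.1] at hfix0; linarith
    · left; exact h
    · right; left
      refine ⟨?_, h⟩
      rw [min_eq_right mA hρ0.2] at hfix0
      rcases le_total rl (ρ0-c0) with h1 | h1
      · rw [max_eq_right h1] at hfix0; linarith
      · rw [max_eq_left h1] at hfix0; exact hfix0
  · rw [(eqs R hRR).1]; ring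
  · rw [(eqs ρ0 hρ0R).2]
    have : rlp ρ0 ρ0 = 0 := by unfold rlp; simp
    rw [this]; ring
  · rw [(eqs R hRR).2, hc0]
    unfold cc
    obtain ⟨a1, a2⟩ := rlp_pos hl hR hρ0
    rw [div_mul_cancel₀ _ (a2.trans_le a1).ne']
    ring

def RL (p q : ℝ) (w w1 f : ℝ → ℝ) : Prop :=
  Λp HasDerivAt w (w1 r) r ∧ HasDerivWithinAt w1 (f r-w1 r/r) (Ici r) r

lemma RL.sub {z z1 : ℝ → ℝ} (h : RL p q w w1 f) (k : RL p q z z1 g) :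
    RL p q (λr w r-z r) (λr w1 r-z1 r) (λr f r-g r) := λh
  ⟨(h r hr).1.sub (k r hr).1, ((h r hr).2.sub (k r hr).2).congr_deriv (by ring)⟩

lemma RL.neg (h : RL p q w w1 f) :
    RL p q (λr - w r) (λr - w1 r) (λr - f r) := λh
  ⟨(h r hr).1.neg, (h r hr).2.neg.congr_deriv (by ring)⟩

lemma RL.mono {p' q' : ℝ} (h : RL p q w w1 f) (hp : p ≤ p') (hq : q' ≤ q) : RL p' q' w w1 f :=
  λh h r ⟨hp.trans_lt hr.1, hr.2.trans_le hq⟩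

lemma RL_of {w2 : ℝ → ℝ} (h : Λp HasDerivAt w (w1 r) r) (k : Λp HasDerivAt w1 (w2 r) r)
    (e : Λp f r = w2 r+w1 r/r) : RL p q w w1 f := λh
  ⟨h r hr, (k r hr).hasDerivWithinAt.congr_deriv (by rw [e r hr]; ring)⟩

lemma right_inc (hd : 0 < d) (hpq : p < q) (h : HasDerivWithinAt w d (Ici p) p) :
    ∃ r ∈ Ioo p q, w p < w r := by
  have h1 := (hasDerivWithinAt_iff_tendsto_slope' (by simp : p ∉ Ioi p)).1 (h.mono Ioi_subset_Ici_self)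
  have h2 := h1.eventually (lt_mem_nhds hd)
  have h3 : ∀ᶠ r in nhdsWithin p (Ioi p), r ∈ Ioo p q := Ioo_mem_nhdsGT hpq
  obtain ⟨r, h4, h5⟩ := (h2.and h3).exists
  refine ⟨r, h5, ?_⟩
  rw [slope_def_field] at h4
  linarith [(div_pos_iff_of_pos_right (sub_pos.2 h5.1)).1 h4]

lemma cmp0 (hpq : p < q) (hc : ContinuousOn w (Icc p q)) (h : RL p q w w1 f)
    (hl : w p ≤ 0 ∨ ∃ d > 0, HasDerivWithinAt w d (Ici p) p) (hq : w q ≤ 0) (hf : Λp 0 < w r → 0 < f r) :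
    ΛI w r ≤ 0 := by
  intro r hr
  by_contra hcon
  push Not at hcon
  obtain ⟨x, hx, hmax⟩ := isCompact_Icc.exists_isMaxOn ⟨r, hr⟩ hc
  have hwx : 0 < w x := hcon.trans_le (hmax hr)
  have hxq : x ≠ q := by rintro rfl; linarith
  have hxq' : x < q := lt_of_le_of_ne hx.2 hxq
  have key : ∀ d, 0 < d → ¬ HasDerivWithinAt w d (Ici x) x := by
    intro d hd hh
    obtain ⟨y, hy, hxy⟩ := right_inc hd hxq' hh
    have := hmax (⟨hx.1.trans hy.1.le, hy.2.le⟩ : y ∈ Icc p q)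
    simp only [mem_ofPred_eq] at this
    linarith
  rcases hx.1.eq_or_lt with hpx | hpx
  · subst hpx
    rcases hl with hl | ⟨d, hd, hh⟩
    · linarith
    · exact key d hd hh
  · have hxm : x ∈ Ioo p q := ⟨hpx, hxq'⟩
    obtain ⟨h1, h2⟩ := h x hxm
    have hloc : IsLocalMax w x := hmax.isLocalMax (Icc_mem_nhds hpx hxq')
    have h0 : w1 x = 0 := hloc.hasDerivAt_eq_zero h1
    rw [h0, zero_div, sub_zero] at h2
    have hfx := hf x hxm hwx
    have h3 := (hasDerivWithinAt_iff_tendsto_slope' (by simp : x ∉ Ioi x)).1 (h2.mono Ioi_subset_Ici_self)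
    have h4 := h3.eventually (lt_mem_nhds hfx)
    obtain ⟨y, hy, hy2⟩ := mem_nhdsGT_iff_exists_Ioo_subset.1 h4
    set z := min y ((x+q)/2) with hz
    have hxz : x < z := lt_min hy ll
    have hzq : z < q := (min_le_right _ _).trans_lt ll
    obtain ⟨s, hs, hs2⟩ := exists_hasDerivAt_eq_slope w w1 hxz (hc.mono (Icc_subset_Icc hpx.le hzq.le))
      (fun t ht => (h t ⟨hpx.trans ht.1, ht.2.trans hzq⟩).1)
    have h5 : 0 < slope w1 x s := hy2 ⟨hs.1, hs.2.trans_le (min_le_left _ _)⟩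
    rw [slope_def_field, h0, sub_zero] at h5
    have h6 := (div_pos_iff_of_pos_right (sub_pos.2 hs.1)).1 h5
    rw [hs2] at h6
    have h7 := (div_pos_iff_of_pos_right (sub_pos.2 hxz)).1 h6
    have := hmax (⟨hx.1.trans hxz.le, hzq.le⟩ : z ∈ Icc p q)
    simp only [mem_ofPred_eq] at this
    linarith

lemma cmpr (hp : 0 ≤ p) (hpq : p < q) (hc : ContinuousOn w (Icc p q)) (h : RL p q w w1 f)
    (hl : w p ≤ 0 ∨ ∃ d ≥ 0, HasDerivWithinAt w d (Ici p) p) (hq : w q ≤ 0) (hf : Λp 0 < w r → 0 < f r) :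
    ΛI w r ≤ 0 := by
  intro r hr
  have key : ∀ σ > 0, w r+σ*(r-q) ≤ 0 := by
    intro σ hσ
    refine cmp0 (w := λr w r+σ*(r-q)) (w1 := λr w1 r+σ) (f := λr f r+σ/r) hpq ?_ ?_ ?_ ?_ ?_ r hr
    · fun_prop
    · intro s hs
      obtain ⟨h1, h2⟩ := h s hs
      refine ⟨(h1.add (((hasDerivAt_id s).sub_const q).const_mul σ)).congr_deriv (by ring), (h2.add_const σ).congr_deriv (by ring)⟩
    · rcases hl with hl | ⟨d, hd, hh⟩
      · left; nlinarith
      · right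
        exact ⟨d+σ, ll, (hh.add (((hasDerivWithinAt_id p _).sub_const q).const_mul σ)).congr_deriv (by ring)⟩
    · linarith
    · intro s hs h0
      have h1 : 0 < w s := by nlinarith [hs.2]
      have h2 := hf s hs h1
      have : 0 < s := hp.trans_lt hs.1
      positivity
  refine le_of_forall_pos_le_add fun e he => ?_
  have hd : 0 < q-p := ll
  have := key (e/(q-p)) pv
  have h2 : e/(q-p)*(q-r) ≤ e := by
    rw [div_mul_eq_mul_div, div_le_iff₀ hd]
    have := hr.1
    nlinarith
  nlinarith

lemma uc {C0 : ℝ} (hp : 0 ≤ p) (hpq : p < q) (hε : 0 < ε) (hε2 : ε ≤ 1/2) (hC0 : 0 < C0) {D D1 : ℝ → ℝ}     (hc : ContinuousOn D (Icc p q)) (h : RL p q D D1 f)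
    (hl : D p ≤ 16*C0*ε ∨ ∃ d ≥ 0, HasDerivWithinAt D d (Ici p) p) (hq : D q ≤ 16*C0*ε)
    (hf : Λp 0 < D r → D r-C0*(exp (-|r-ρ| / ε)+ε) ≤ f r) :
    ΛI D r ≤ 32*C0*ε := by
  let e : ℝ → ℝ := λr exp ((r-ρ)/(2*ε))
  let s : ℝ → ℝ := λr e r/(1+e r)
  let g : ℝ → ℝ := λr exp (-(2*ε*log (1+e r)))
  have he : ∀ r, 0 < e r := λr exp_pos _
  have he1 : ∀ r, 0 < 1+e r := λr by linarith [he r]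
  have hs : ∀ r, 0 < s r := λr div_pos (he r) (he1 r)
  have hs1 : ∀ r, s r < 1 := λr by
    simp only [s]; rw [div_lt_one (he1 r)]; linarith
  have hg : ∀ r, 0 < g r := λr exp_pos _
  have hg1 : ∀ r, g r ≤ 1 := λr by
    simp only [g]; rw [exp_le_one_iff]
    have : 0 ≤ log (1+e r) := log_nonneg (by linarith [he r])
    have : 0 ≤ 2*ε*log (1+e r) := pv
    linarith
  have de : ∀ r, HasDerivAt e (e r/(2*ε)) r := λr
    (((hasDerivAt_id r).sub_const ρ).div_const (2*ε)).exp.congr_deriv (by simp only [e, id]; ring)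
  have ds : ∀ r, HasDerivAt s (s r*(1-s r)/(2*ε)) r := λr by
    refine ((de r).div ((de r).const_add 1) (he1 r).ne').congr_deriv ?_
    simp only [s]; have := (he1 r).ne'; field_simp
    try ring
  have dg : ∀ r, HasDerivAt g (-(s r)*g r) r := λr by
    refine (((((de r).const_add 1).log (he1 r).ne').const_mul (2*ε)).neg.exp).congr_deriv ?_
    simp only [s, g, Pi.neg_apply]; have := (he1 r).ne'; field_simp
  let ψ : ℝ → ℝ := λr 16*C0*ε*(1+g r)
  let ψ1 : ℝ → ℝ := λr -(16*C0*ε*(s r*g r))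
  have dψ : ∀ r, HasDerivAt ψ (ψ1 r) r := λr
    (((dg r).const_add 1).const_mul (16*C0*ε)).congr_deriv (by simp only [ψ1]; ring)
  have dψ1 : ∀ r, HasDerivAt ψ1 (16*C0*ε*((s r)^2*g r-s r*(1-s r)/(2*ε)*g r)) r := λr
    ((((ds r).mul (dg r)).const_mul (16*C0*ε)).neg).congr_deriv (by ring)
  have key : ΛI (D r-ψ r) ≤ 0 := by
    refine cmpr hp hpq (w := λr D r-ψ r) (hc.sub (λR (dψ r).continuousAt.continuousWithinAt))
      (h.sub (RL_of (λR dψ r) (λR dψ1 r) (λR rfl))) ?_ ?_ ?_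
    · rcases hl with hl | ⟨d, hd, hh⟩
      · left; have := hg p; simp only [ψ]; nlinarith [mul_pos hC0 hε]
      · right
        refine ⟨d-ψ1 p, ?_, hh.sub (dψ p).hasDerivWithinAt⟩
        have : 0 ≤ 16*C0*ε*(s p*g p) := by have := hs p; have := hg p; positivity
        simp only [ψ1]; linarith
    · have := hg q; simp only [ψ]; nlinarith [mul_pos hC0 hε]
    · intro r hr hpos
      have hr0 : 0 < r := hp.trans_lt hr.1
      have hψ : 16*C0*ε ≤ ψ r := by have := hg r; simp only [ψ]; nlinarith [mul_pos hC0 hε]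
      have h1 := hf r hr (by linarith [mul_pos hC0 hε])
      have h2 : ψ1 r/r ≤ 0 := div_nonpos_of_nonpos_of_nonneg (by
        have : 0 ≤ 16*C0*ε*(s r*g r) := by have := hs r; have := hg r; positivity
        simp only [ψ1]; linarith) hr0.le
      have h3 : (s r)^2*g r ≤ g r := by
        have := hg r; have := hs r; have := hs1 r
        have : (s r)^2 ≤ 1 := by nlinarith
        nlinarith
      have h4 : exp (-|r-ρ| / ε) ≤ 8*(s r*(1-s r)*g r) := by
        have e1 : s r*(1-s r) = e r/(1+e r)^2 := by
          simp only [s]; have := (he1 r).ne'; field_simp; ring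
        have lg2 : log 2 ≤ 0.7 := by have := Real.log_two_lt_d9; exact lC hε hε2 this
        have hinv : exp (-log 2) = 1/2 := by rw [Real.exp_neg, Real.exp_log (by norm_num)]; norm_num
        rcases le_total r ρ with hy | hy
        · have a1 : e r ≤ 1 := exp_le_one_iff.2 (div_nonpos_of_nonpos_of_nonneg ll ll)
          have a2 : (1:ℝ)/2 ≤ g r := by
            rw [← hinv]; simp only [g]
            apply exp_le_exp.2
            have : log (1+e r) ≤ log 2 := Real.log_le_log (he1 r) ll
            have : 0 ≤ log (1+e r) := log_nonneg (by linarith [he r])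
            nlinarith
          have a3 : e r/4 ≤ e r/(1+e r)^2 := by
            have := he r
            gcongr
            nlinarith
          have a4 : exp (-|r-ρ| / ε) ≤ e r := by
            simp only [e]; apply exp_le_exp.2
            rw [abs_of_nonpos ll, div_le_div_iff₀ hε lA hε]
            nlinarith
          rw [e1]
          have : e r/4*(1/2) ≤ e r/(1+e r)^2*g r := mul_le_mul a3 a2 (by norm_num) (by have := he r; positivity)
          exact lB a4 this
        · have a1 : 1 ≤ e r := one_le_exp (div_nonneg ll ll)
          have a3 : 1/(4*e r) ≤ e r/(1+e r)^2 := by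
            rw [div_le_div_iff₀ ll pv]; nlinarith
          have a2 : exp (-(r-ρ))*(1/2) ≤ g r := by
            rw [← hinv, ← exp_add]; simp only [g]
            apply exp_le_exp.2
            have b1 : log (1+e r) ≤ log (2*e r) := Real.log_le_log (he1 r) ll
            rw [log_mul (by norm_num) (he r).ne'] at b1
            have b2 : log (e r) = (r-ρ)/(2*ε) := log_exp _
            rw [b2] at b1
            have b3 : 2*ε*log (1+e r) ≤ 2*ε*(log 2+(r-ρ)/(2*ε)) := by gcongr
            have b4 : 2*ε*((r-ρ)/(2*ε)) = r-ρ := by field_simp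
            have b5 : 0 < log 2 := log_pos (by norm_num)
            nlinarith
          have a4 : exp (-|r-ρ| / ε) ≤ exp (-(r-ρ))/e r := by
            simp only [e]; rw [← exp_sub]; apply exp_le_exp.2
            rw [abs_of_nonneg ll]
            have c1 : (r-ρ)/(2*ε) = (r-ρ)/ε/2 := by rw [div_div]; ring_nf
            have c2 : 2*(r-ρ) ≤ (r-ρ)/ε := by
              rw [le_div_iff₀ hε]; nlinarith
            rw [c1, neg_div]; exact lA c2
          rw [e1]
          have : 1/(4*e r)*(exp (-(r-ρ))*(1/2)) ≤ e r/(1+e r)^2*g r := mul_le_mul a3 a2 pv (by have := he r; positivity)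
          have e2 : 1/(4*e r)*(exp (-(r-ρ))*(1/2)) = exp (-(r-ρ))/e r/8 := by
            have := (he r).ne'; field_simp; ring
          exact lC a4 this e2
      have h5 : 16*C0*ε*(s r*(1-s r)/(2*ε)*g r) = C0*(8*(s r*(1-s r)*g r)) := by
        field_simp; ring
      have h6 : C0*exp (-|r-ρ| / ε) ≤ C0*(8*(s r*(1-s r)*g r)) := by gcongr
      have h7 : 16*C0*ε*((s r)^2*g r) ≤ 16*C0*ε*g r := by gcongr
      have h8 : ψ r = 16*C0*ε+16*C0*ε*g r := by simp only [ψ]; ring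
      have h9 : 0 < C0*ε := mul_pos hC0 hε
      have h10 : 16*C0*ε*((s r)^2*g r-s r*(1-s r)/(2*ε)*g r) = 16*C0*ε*((s r)^2*g r)-16*C0*ε*(s r*(1-s r)/(2*ε)*g r) := by ring
      nlinarith
  intro r hr
  have := key r hr
  have h1 := hg1 r
  have : ψ r ≤ 32*C0*ε := by simp only [ψ]; nlinarith [mul_pos hC0 hε]
  linarith

lemma abs_le_cosh (x : ℝ) : |x| ≤ cosh x := by
  rw [← Real.cosh_abs]
  exact (Real.self_le_sinh_iff.2 (abs_nonneg x)).trans (Real.sinh_lt_cosh _).le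

lemma zest {μ l : ℝ} (hp : 0 < p) (hpR : p < R) (hδ : 0 < δ) (hμ : 0 < μ) (hκ : 4*μ^2 ≤ κ) (hδp : δ ≤ μ*p)
    {q : ℝ → ℝ} (hc : ContinuousOn v (Icc p R)) (h : RL p R v v1 g) (hl : 0 ≤ l)
    (hq : ∀ x ∈ Icc p R, ∀ y ∈ Icc p R, |q x-q y| ≤ l * |x-y|)
    (hf : ∀ r ∈ Ioo p R, q r < v r → κ*(v r-q r) ≤ δ^2*g r) (hA : 0 ≤ A) (hvp : v p-q p ≤ A) (hvR : v R ≤ q R) :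
    ∀ r ∈ Icc p R, v r-q r ≤ A*exp (-(μ*(r-p)/δ))+2*l/μ*δ := by
  intro r0 hr0
  have hκ0 : 0 < κ := by linarith [sq_pos_of_pos hμ]
  set M := 2*l/μ with hM
  have hM0 : 0 ≤ M := pv
  let ch : ℝ → ℝ := λr cosh (μ*(r-r0)/δ)
  let sh : ℝ → ℝ := λr sinh (μ*(r-r0)/δ)
  let E : ℝ → ℝ := λr exp (-(μ*(r-p)/δ))
  have dl : ∀ r, HasDerivAt (λr μ*(r-r0)/δ) (μ/δ) r := λr
    ((((hasDerivAt_id r).sub_const r0).const_mul μ).div_const δ).congr_deriv (by ring)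
  have dch : ∀ r, HasDerivAt ch (sh r*(μ/δ)) r := λr (dl r).cosh
  have dsh : ∀ r, HasDerivAt sh (ch r*(μ/δ)) r := λr (dl r).sinh
  have dE : ∀ r, HasDerivAt E (-(E r*(μ/δ))) r := λr
    (((((hasDerivAt_id r).sub_const p).const_mul μ).div_const δ).neg.exp).congr_deriv (by
      simp only [E, Pi.neg_apply, id]; ring)
  let Ψ : ℝ → ℝ := λr q r0+M*δ*ch r+A*E r
  let Ψ1 : ℝ → ℝ := λr M*δ*(sh r*(μ/δ))-A*(E r*(μ/δ))
  have dΨ : ∀ r, HasDerivAt Ψ (Ψ1 r) r := λr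
    ((((dch r).const_mul (M*δ)).const_add (q r0)).add ((dE r).const_mul A)).congr_deriv (by simp only [Ψ1]; ring)
  have dΨ1 : ∀ r, HasDerivAt Ψ1 (M*δ*(ch r*(μ/δ)*(μ/δ))+A*(E r*(μ/δ)*(μ/δ))) r := λr
    ((((dsh r).mul_const (μ/δ)).const_mul (M*δ)).sub (((dE r).mul_const (μ/δ)).const_mul A)).congr_deriv (by ring)
  have hE : ∀ r, 0 < E r := λr exp_pos _
  have hch : ∀ r, l * |r-r0| ≤ M/2*δ*ch r := by
    intro r
    have h1 := abs_le_cosh (μ*(r-r0)/δ)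
    rw [abs_div, abs_mul, abs_of_pos hμ, abs_of_pos hδ] at h1
    have h2 : M/2*δ*(μ * |r-r0| / δ) ≤ M/2*δ*ch r := by gcongr
    have h3 : M/2*δ*(μ * |r-r0| / δ) = l * |r-r0| := by rw [hM]; field_simp
    exact lB h2 h3
  have hch0 : ∀ r, 0 < ch r := λr cosh_pos _
  have hqq : ∀ r ∈ Icc p R, q r ≤ q r0+l * |r-r0| := λh by
    linarith [(abs_le.1 (hq r hr r0 hr0)).2]
  have key : v r0-Ψ r0 ≤ 0 := by
    refine cmpr hp.le hpR (w := λr v r-Ψ r) (hc.sub (λR (dΨ r).continuousAt.continuousWithinAt))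
      (h.sub (RL_of (λR dΨ r) (λR dΨ1 r) (λR rfl))) ?_ ?_ ?_ r0 hr0
    · left
      have h1 := hqq p ⟨le_rfl, hpR.le⟩
      have h2 := hch p
      have h3 : E p = 1 := by simp [E]
      have h4 : 0 ≤ M/2*δ*ch p := by have := hch0 p; positivity
      simp only [Ψ, h3]; exact lD hvp h1 h2 h4
    · have h1 := hqq R ⟨hpR.le, le_rfl⟩
      have h2 := hch R
      have h3 : 0 ≤ A*E R := by have := hE R; positivity
      have h4 : 0 ≤ M/2*δ*ch R := by have := hch0 R; positivity
      simp only [Ψ]; linarith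
    · intro r hr hpos
      have h1 := hqq r hI_
      have h2 := hch r
      have h3 : 0 ≤ A*E r := by have := hE r; positivity
      have h4 : 0 ≤ M/2*δ*ch r := by have := hch0 r; positivity
      have hΨ : Ψ r = q r0+M*δ*ch r+A*E r := rfl
      have h5 : κ*(M/2*δ*ch r+A*E r) < κ*(v r-q r) := mul_lt_mul_of_pos_left lC hpos h1 h2 hκ0
      have h6 := hf r hr lE hpos h1 h2 h3 h4
      have hr0' : 0 < r := hp.trans hr.1
      have h7 : δ^2*(M*δ*(ch r*(μ/δ)*(μ/δ))+A*(E r*(μ/δ)*(μ/δ))+Ψ1 r/r)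
          = μ^2*(M*δ*ch r)+(δ*μ/r)*(M*δ*sh r)+(μ^2-δ*μ/r)*(A*E r) := by
        simp only [Ψ1]; field_simp; ring
      have h8 : δ*μ/r ≤ μ^2 := by
        rw [div_le_iff₀ hr0']; have := hr.1; nlinarith
      have h8' : 0 ≤ δ*μ/r := pv
      have h9 : sh r ≤ ch r := (sinh_lt_cosh _).le
      have h10 : (δ*μ/r)*(M*δ*sh r) ≤ μ^2*(M*δ*ch r) := by
        have : (δ*μ/r)*(M*δ*sh r) ≤ (δ*μ/r)*(M*δ*ch r) := by gcongr
        have : (δ*μ/r)*(M*δ*ch r) ≤ μ^2*(M*δ*ch r) :=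
          mR h8 (by have := hch0 r; positivity)
        linarith
      have h11 : (μ^2-δ*μ/r)*(A*E r) ≤ κ*(A*E r) := by
        apply mR _ h3
        have := sq_nonneg μ; exact lC hκ hκ0 h8'
      have h12 : 4*μ^2*(M/2*δ*ch r) ≤ κ*(M/2*δ*ch r) := by gcongr
      have h13 : δ^2*(M*δ*(ch r*(μ/δ)*(μ/δ))+A*(E r*(μ/δ)*(μ/δ))+Ψ1 r/r) < δ^2*g r := by
        rw [h7]; exact lE h5 h6 h10 h11 h12
      have := lt_of_mul_lt_mul_left h13 pv
      exact lA this
  have h1 : ch r0 = 1 := by simp [ch]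
  have h2 : Ψ r0 = q r0+M*δ*1+A*E r0 := by simp only [Ψ, h1]
  have h3 : E r0 = exp (-(μ*(r0-p)/δ)) := rfl
  rw [h3] at h2
  exact lB key h2

lemma dbd (hp : 0 ≤ p) (hc : ContinuousOn w (Icc p q)) (h : RL p q w w1 f)
    (h1 : ContinuousOn w1 (Ioo p q)) (hA : ΛI |w r| ≤ A) (hB : Λp |f r| ≤ B)
    (hr : p+1 ≤ r) (hrq : r < q) : |w1 r| ≤ 2*A+B := by
  have hr0 : 0 < r := ll
  obtain ⟨ξ, hξ, hs⟩ := exists_hasDerivAt_eq_slope w w1 (show r-1 < r from ll)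
    (hc.mono (Icc_subset_Icc ll hrq.le)) (fun t ht => (h t ⟨mA ht.1, mA ht.2⟩).1)
  have hξp : p < ξ := mA hξ.1
  have hB0 : 0 ≤ B := (abs_nonneg _).trans (hB r ⟨ll, hrq⟩)
  have hw : |w1 ξ| ≤ 2*A := by
    rw [hs, show r-(r-1) = 1 by ring, div_one]
    have h2 := abs_le.1 (hA r ⟨ll, hrq.le⟩)
    have h3 := abs_le.1 (hA (r-1) ⟨ll, ll⟩)
    rw [abs_le]; constructor <;> linarith
  have hsub : Icc ξ r ⊆ Ioo p q := fun t ht => ⟨hξp.trans_le ht.1, ht.2.trans_lt hrq⟩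
  have h2 := norm_image_sub_le_of_norm_deriv_right_le_segment (f := λt t*w1 t) (f' := λt t*f t) (a := ξ) (b := r) (C := B*r)
    (continuousOn_id.mul (h1.mono hsub))
    (fun t ht => by
      have ht' := hsub ⟨ht.1, ht.2.le⟩
      have : t ≠ 0 := (hp.trans_lt ht'.1).ne'
      refine ((hasDerivWithinAt_id t _).mul (h t ht').2).congr_deriv ?_
      simp only [id]; field_simp; ring)
    (fun t ht => by
      have ht' := hsub ⟨ht.1, ht.2.le⟩
      have h3 := hB t ht'
      have h4 : 0 < t := hp.trans_lt ht'.1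
      rw [Real.norm_eq_abs, abs_mul, abs_of_pos h4, mul_comm]
      exact mul_le_mul h3 ht.2.le h4.le hB0)
    r ⟨hξ.2.le, le_rfl⟩
  rw [Real.norm_eq_abs] at h2
  have h3 : |r*w1 r| ≤ |ξ*w1 ξ| + B*r*(r-ξ) := by
    linarith [abs_sub_abs_le_abs_sub (r*w1 r) (ξ*w1 ξ)]
  have hξ0 : 0 < ξ := hp.trans_lt hξp
  rw [abs_mul, abs_mul, abs_of_pos hr0, abs_of_pos hξ0] at h3
  have h4 : ξ * |w1 ξ| ≤ r*(2*A) := mul_le_mul hξ.2.le hw (abs_nonneg _) hr0.le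
  have h5 : B*r*(r-ξ) ≤ B*r*1 := by
    have := hξ.1
    gcongr; linarith
  have h6 : r * |w1 r| ≤ r*(2*A+B) := by nlinarith
  exact le_of_mul_le_mul_left h6 hr0

lemma right_slope {φ : ℝ → ℝ} (h : HasDerivAt φ d ρ) (he : ρ < e) (hm : ∀ r ∈ Ioo ρ e, φ ρ ≤ φ r) : 0 ≤ d := by
  by_contra hd
  push Not at hd
  obtain ⟨r, hr, h2⟩ := right_inc (neg_pos.2 hd) he h.neg.hasDerivWithinAt
  have := hm r hr
  simp only [Pi.neg_apply] at h2
  linarith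

lemma left_slope {φ : ℝ → ℝ} (h : HasDerivAt φ d ρ) (he : e < ρ) (hm : ∀ r ∈ Ioo e ρ, φ r ≤ φ ρ) : 0 ≤ d := by
  have h1 : HasDerivAt (λx - φ (-x)) d (-ρ) := by
    have h2 : HasDerivAt φ d (-(-ρ)) := by rwa [neg_neg]
    refine ((h2.comp (-ρ) (hasDerivAt_neg (-ρ))).neg).congr_deriv (by ring)
  refine right_slope h1 (e := -e) ll λh ?_
  have := hm (-r) ⟨mA hr.2, mA hr.1⟩
  simp only [neg_neg]; linarith

lemma sel_rc {F1 F2 : ℝ → ℝ → ℝ → ℝ → ℝ} (h1 : C4 F1) (h2 : C4 F2) (ρ : ℝ) (hu : Continuous u) (hv : Continuous v) (t : ℝ) :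
    ContinuousWithinAt (λt sel F1 F2 ρ t (u t) (v t)) (Ici t) t := by
  have c1 : Continuous (λt F1 ρ t (u t) (v t)) := Continuous.comp (g := fun p : ℝ × ℝ × ℝ × ℝ => F1 p.1 p.2.1 p.2.2.1 p.2.2.2) h1 (f := λt (ρ, t, u t, v t)) (by fun_prop)
  have c2 : Continuous (λt F2 ρ t (u t) (v t)) := Continuous.comp (g := fun p : ℝ × ℝ × ℝ × ℝ => F2 p.1 p.2.1 p.2.2.1 p.2.2.2) h2 (f := λt (ρ, t, u t, v t)) (by fun_prop)
  rcases lt_or_ge t ρ with h | h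
  · refine (c1.continuousAt.congr ?_).continuousWithinAt
    filter_upwards [gt_mem_nhds h] with s hs
    unfold sel; rw [if_pos hs]
  · refine c2.continuousWithinAt.congr (fun s hs => ?_) ?_
    · unfold sel; rw [if_neg (not_lt.2 (h.trans hs))]
    · unfold sel; rw [if_neg (not_lt.2 h)]

lemma sol_RL (hf : Measurable f) (hB : ∀ t, |f t| ≤ B) (hp : 0 ≤ p)
    (hrc : ∀ t, ContinuousWithinAt f (Ici t) t) (hw : Λp w r = A+rJ f r+c*log r) :
    RL p q w (λr rH f r+c/r) f := by
  intro r hr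
  have hr0 : 0 < r := hp.trans_lt hr.1
  constructor
  · have h1 : HasDerivAt (λr A+rJ f r+c*log r) (rH f r+c/r) r :=
      (((rJ_deriv hf hB hr0).const_add A).add ((hasDerivAt_log hr0.ne').const_mul c)).congr_deriv (by ring)
    refine h1.congr_of_eventuallyEq ?_
    filter_upwards [isOpen_Ioo.mem_nhds hr] with s hs using hw s hs
  · refine ((rH_derivR hf hB hr0 (hrc r)).add ((hasDerivWithinAt_const r _ c).div (hasDerivWithinAt_id r _) hr0.ne')).congr_deriv ?_
    simp only [id]; field_simp; ring

lemma sol_zero (hf : Measurable f) (hB : ∀ t, |f t| ≤ B) (hq : 0 < q)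
    (hw : ∀ r ∈ Icc 0 q, w r = A+rJ f r) : HasDerivWithinAt w 0 (Ici 0) 0 := by
  have hB0 : 0 ≤ B := (abs_nonneg _).trans (hB 0)
  · have h0 : HasDerivWithinAt w 0 (Ioi 0) 0 := by
      rw [hasDerivWithinAt_iff_tendsto_slope' (by simp)]
      have h1 : Tendsto (fun r : ℝ => B*r) (nhdsWithin 0 (Ioi 0)) (nhds 0) := by
        have : Continuous (fun r : ℝ => B*r) := by fun_prop
        have := this.tendsto 0
        rw [mul_zero] at this
        exact this.mono_left nhdsWithin_le_nhds
      refine squeeze_zero_norm' ?_ h1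
      filter_upwards [Ioo_mem_nhdsGT hq] with r hr
      rw [slope_def_field, hw r hI_, hw 0 ⟨le_rfl, hq.le⟩, rJ_zero, sub_zero, Real.norm_eq_abs, abs_div, abs_of_pos hr.1, div_le_iff₀ hr.1]
      have := rJ_bd hf hB (⟨hr.1.le, le_rfl⟩ : r ∈ Icc 0 r)
      rw [show A+rJ f r-(A+0) = rJ f r by ring]
      exact this
    exact hasDerivWithinAt_Ioi_iff_Ici.1 h0

noncomputable def Qf (m b s : ℝ) : ℝ := (s-2*m*b+Real.sqrt (s^2-4*s*m*b))/(2*b^2)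
noncomputable def Vp (m b s : ℝ) : ℝ := (1+Real.sqrt (1-4*m*b/s))/(2*b)

structure PH (a m b U V : ℝ) : Prop where
  ha : 0 < a
  hm : 0 < m
  hb : 0 < b
  h1 : 1/2 < b*V
  h2 : b*V < 2/3
  hUV : U*V*(1-b*V) = m
  hA : U*(1+V^2) = a
  h4 : 4*m*b < U
  h5 : U < b9
  h6 : b9 < a
  hc : (∫ s in U..(b9), Qf m b s) < (1/2)*(a-U)^2

set_option maxHeartbeats 1000000 in
lemma PH_of (a m b : ℝ) (ha : 0 < a) (hm : 0 < m) (hb : 0 < b)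
    (hparam₁ : max (9*b/2) (4*b+1/b) < a/m) (hparam₂ : a/m < 9*b/2+2/b)
    (V₂ : ℝ) (hV₂ : V₂ = (a/m+Real.sqrt ((a/m)^2-4*(1+a*b/m)))/(2*(1+a*b/m)))
    (U₂ : ℝ) (hU₂ : U₂ = m*(a/m-V₂/(1-b*V₂)))
    (hcond : (∫ s in U₂..(b9), (s-2*m*b+Real.sqrt (s^2-4*s*m*b))/(2*b^2))
        < (1/2)*(a-U₂)^2) : PH a m b U₂ V₂ := by
  have hp1 := (le_max_left _ _).trans_lt hparam₁
  have hp2 := (le_max_right _ _).trans_lt hparam₁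
  set x := a/m with hx
  have hax : a = m*x := by rw [hx]; field_simp
  have habx : a*b/m = b*x := by rw [hx]; ring
  rw [habx] at hV₂
  have hib : b*(1/b) = 1 := by field_simp
  set β := 1/b with hβ
  have hβ0 : 0 < β := by rw [hβ]; positivity
  have hx0 : 0 < x := by rw [hx]; positivity
  have h2b : 2/b = 2*β := by rw [hβ]; ring
  rw [h2b] at hparam₂
  set D := x^2-4*(1+b*x) with hD
  have hD1 : β^2 < D := by
    have h1 : 0 < x-(4*b+β) := lA hp2
    have e : D-β^2 = (x-(4*b+β))*(x+β)+4*(b*β-1) := by rw [hD]; ring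
    rw [hib] at e
    nlinarith [mul_pos h1 (show 0 < x+β from lC hb hparam₂ hp2)]
  set S := Real.sqrt D with hS
  have hD0 : 0 ≤ D := by nlinarith
  have hSS : S^2 = D := Real.sq_sqrt hD0
  have hS1 : β < S := by rw [hS]; exact Real.lt_sqrt_of_sq_lt hD1
  have hk : 0 < 1+b*x := pv
  have hV : V₂*(2*(1+b*x)) = x+S := by rw [hV₂]; field_simp
  have hV1 : 1/2 < b*V₂ := by
    have : b*V₂*(2*(1+b*x)) = b*x+b*S := by rw [mul_assoc, hV]; ring
    have h3 : 1 < b*S := by nlinarith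
    by_contra hcon
    push Not at hcon
    linarith [mR hcon (show 0 ≤ 2*(1+b*x) from lA hk)]
  have hV0 : 0 < V₂ := by rw [hV₂]; apply div_pos <;> linarith
  have hpoly : (1+b*x)*V₂^2-x*V₂+1 = 0 := by
    have h3 : 4*(1+b*x)*((1+b*x)*V₂^2-x*V₂+1) = (V₂*(2*(1+b*x))-x)^2-D := by rw [hD]; ring
    rw [hV] at h3
    have h4 : 4*(1+b*x)*((1+b*x)*V₂^2-x*V₂+1) = 0 := by rw [h3, ← hSS]; ring
    rcases mul_eq_zero.1 h4 with h5 | h5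
    · exact lB hk h5
    · exact h5
  have hV2 : b*V₂ < 2/3 := by
    by_contra hcon
    push Not at hcon
    set s := b*V₂ with hs
    have e1 : b^2*((1+b*x)*V₂^2-x*V₂+1) = (1+b*x)*s^2-b*x*s+b^2 := by rw [hs]; ring
    rw [hpoly, mul_zero] at e1
    have e2 : b*x < 9*b^2/2+2 := by
      have := mul_lt_mul_of_pos_left hparam₂ hb
      have e9 : b*(9*b/2+2*β) = 9*b^2/2+2*(b*β) := by ring
      rw [e9, hib] at this; exact lA this
    have e3 : (1+b*x)*(s^2-4/9)-b*x*(s-2/3)+(4/9-2/9*(b*x)+b^2) = 0 := lA e1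
    have hbx : 0 < b*x := mul_pos hb hx0
    have e5 : 0 ≤ (1+b*x)*(s+2/3-1) := mul_nonneg hk.le lA hV1
    have e6 : 0 ≤ (1+b*x)*(s+2/3)-b*x := lA e5
    have e4 : 0 ≤ (s-2/3)*((1+b*x)*(s+2/3)-b*x) := mul_nonneg lA hcon e6
    have e7 : (s-2/3)*((1+b*x)*(s+2/3)-b*x) = (1+b*x)*(s^2-4/9)-b*x*(s-2/3) := by ring
    exact lC e1 e2 e4
  have h1s : 0 < 1-b*V₂ := lB hV1 hV2
  have hxV : x*(V₂*(1-b*V₂)) = 1+V₂^2 := by linear_combination -hpoly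
  have hU : U₂*V₂*(1-b*V₂) = m := by
    rw [hU₂]
    have e0 : V₂/(1-b*V₂)*(1-b*V₂) = V₂ := div_mul_cancel₀ _ h1s.ne'
    have : m*(x-V₂/(1-b*V₂))*V₂*(1-b*V₂) = m*(x*(V₂*(1-b*V₂))-V₂^2) := by
      calc _ = m*(x*(V₂*(1-b*V₂))-V₂*(V₂/(1-b*V₂)*(1-b*V₂))) := by ring
        _ = _ := by rw [e0]; ring
    rw [this, hxV]; ring
  have hA : U₂*(1+V₂^2) = a := by
    rw [← hxV, hax]; calc _ = U₂*V₂*(1-b*V₂)*x := by ring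
      _ = _ := by rw [hU]
  have hbU : U₂*((b*V₂)*(1-b*V₂)) = m*b := by rw [← hU]; ring
  set s := b*V₂ with hs
  have hmb : 0 < m*b := pv
  have hss : 0 < s*(1-s) := by apply mul_pos <;> linarith
  have hU0 : 0 < U₂ := by
    by_contra hcon; push Not at hcon
    have := mul_nonpos_of_nonpos_of_nonneg hcon hss.le
    exact lC hbU hmb this
  refine ⟨ha, hm, hb, hV1, hV2, hU, hA, ?_, ?_, ?_, hcond⟩
  · have h1 : 0 < (s-1/2)^2 := pow_pos lA hV1 2
    have h2 : s*(1-s) < 1/4 := lA h1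
    have := mul_lt_mul_of_pos_left h2 hU0
    exact lB hbU this
  · have h1 : 0 < (s-1/3)*(2/3-s) := mul_pos lB hV1 hV2 lA hV2
    have h2 : 2/9 < s*(1-s) := lA h1
    have := mul_lt_mul_of_pos_left h2 hU0
    exact lB hbU this
  · rw [hax]; have := mul_lt_mul_of_pos_left hp1 hm; exact lA this

lemma Qf_cont (m b : ℝ) : Continuous (Qf m b) := by unfold Qf; fun_prop

lemma Vp_facts (hm : 0 < m) (hb : 0 < b) (hx : 4*m*b < x) :
    x*Vp m b x*(1-b*Vp m b x) = m ∧ 1/2 < b*Vp m b x ∧ b*Vp m b x < 1 ∧ Qf m b x = x*(Vp m b x)^2 := by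
  have hmb : 0 < 4*m*b := pv
  have hx0 : 0 < x := ll
  have hy : 0 < 1-4*m*b/x := by rw [sub_pos, div_lt_one hx0]; exact hx
  have hS := Real.sq_sqrt hy.le
  have hS0 := Real.sqrt_pos.2 hy
  have hQ : Real.sqrt (x^2-4*x*m*b) = x*Real.sqrt (1-4*m*b/x) := by
    rw [show x^2-4*x*m*b = x^2*(1-4*m*b/x) by field_simp, Real.sqrt_mul (sq_nonneg x), Real.sqrt_sq hx0.le]
  have hS1 : Real.sqrt (1-4*m*b/x) < 1 := by
    have : 0 < 4*m*b/x := pv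
    nlinarith
  have e : b*Vp m b x = (1+Real.sqrt (1-4*m*b/x))/2 := by unfold Vp; field_simp
  have hxS : x*(Real.sqrt (1-4*m*b/x))^2 = x-4*m*b := by rw [hS]; field_simp
  unfold Qf
  rw [hQ]
  set S := Real.sqrt (1-4*m*b/x)
  refine ⟨?_, ll, ll, ?_⟩
  · have : b*(x*Vp m b x*(1-b*Vp m b x)) = b*m := by
      calc _ = x*(b*Vp m b x)*(1-b*Vp m b x) := by ring
        _ = _ := by rw [e]; nlinarith
    exact mul_left_cancel₀ hb.ne' this
  · have : Vp m b x = (1+S)/2/b := by rw [← e]; field_simp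
    rw [this]; field_simp; nlinarith

lemma Vp_unique {v : ℝ} (hm : 0 < m) (hb : 0 < b) (hx : 4*m*b < x) (h : x*v*(1-b*v) = m) (hv : 1/2 < b*v) : v = Vp m b x := by
  obtain ⟨h1, h2, h3, -⟩ := Vp_facts hm hb hx
  have hx0 : 0 < x := by have : 0 < 4*m*b := pv; linarith
  have e : x*((v-Vp m b x)*(1-b*v-b*Vp m b x)) = 0 := lB h h1
  rcases mul_eq_zero.1 e with h4 | h4
  · linarith
  · rcases mul_eq_zero.1 h4 with h5 | h5 <;> linarith

lemma Vp_mono (hm : 0 < m) (hb : 0 < b) (hx : 4*m*b < x) (hxy : x ≤ y) : Vp m b x ≤ Vp m b y := by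
  unfold Vp
  have hmb : 0 < 4*m*b := pv
  gcongr
  linarith

lemma Vp_lip {x0 : ℝ} (hm : 0 < m) (hb : 0 < b) (hx0 : 4*m*b < x0) :
    ∃ l > 0, ∀ x y, x0 ≤ x → x0 ≤ y → |Vp m b x-Vp m b y| ≤ l * |x-y| := by
  have hmb : 0 < 4*m*b := pv
  have hx00 : 0 < x0 := ll
  set S0 := Real.sqrt (1-4*m*b/x0) with hS0
  have hy : 0 < 1-4*m*b/x0 := by rw [sub_pos, div_lt_one hx00]; exact hx0
  have hS0p : 0 < S0 := Real.sqrt_pos.2 hy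
  have key : ∀ x y, x0 ≤ x → x ≤ y → Vp m b y-Vp m b x ≤ (4*m*b/(x0*x0)/S0)/(2*b)*(y-x) := by
    intro x y hx hxy
    have hxp : 0 < x := hx00.trans_le hx
    have hyp : 0 < y := hxp.trans_le hxy
    have a1 : 0 ≤ 1-4*m*b/x := by rw [sub_nonneg, div_le_one hxp]; linarith
    have a2 : 0 ≤ 1-4*m*b/y := by rw [sub_nonneg, div_le_one hyp]; linarith
    have b1 := Real.sq_sqrt a1
    have b2 := Real.sq_sqrt a2
    have c1 : S0 ≤ Real.sqrt (1-4*m*b/x) := Real.sqrt_le_sqrt (by gcongr)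
    have c2 : Real.sqrt (1-4*m*b/x) ≤ Real.sqrt (1-4*m*b/y) := Real.sqrt_le_sqrt (by gcongr)
    unfold Vp
    set S := Real.sqrt (1-4*m*b/x)
    set T := Real.sqrt (1-4*m*b/y)
    have d1 : (T-S)*S0 ≤ 4*m*b/(x0*x0)*(y-x) := by
      have d2 : (T-S)*(T+S) = 4*m*b/(x*y)*(y-x) := by
        calc _ = T^2-S^2 := by ring
          _ = _ := by rw [b1, b2]; field_simp; ring
      have d3 : 4*m*b/(x*y)*(y-x) ≤ 4*m*b/(x0*x0)*(y-x) := by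
        apply mR _ lA hxy
        gcongr; exact lB hx hxy
      have d4 : (T-S)*S0 ≤ (T-S)*(T+S) := by
        apply mL _ lA c2; exact lC hS0p c1 c2
      exact lC d2 d3 d4
    have e1 : T-S ≤ 4*m*b/(x0*x0)/S0*(y-x) := by
      rw [div_mul_eq_mul_div, le_div_iff₀ hS0p]; exact d1
    calc _ = (T-S)/(2*b) := by ring
      _ ≤ (4*m*b/(x0*x0)/S0*(y-x))/(2*b) := by gcongr
      _ = _ := by ring
  refine ⟨(4*m*b/(x0*x0)/S0)/(2*b), pv, fun x y hx hy => ?_⟩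
  rcases le_total x y with h | h
  · rw [abs_sub_comm, abs_of_nonneg (sub_nonneg.2 (Vp_mono hm hb ll h)), abs_sub_comm x, abs_of_nonneg (sub_nonneg.2 h)]
    exact key x y hx h
  · rw [abs_of_nonneg (sub_nonneg.2 (Vp_mono hm hb ll h)), abs_of_nonneg (sub_nonneg.2 h)]
    exact key y x hy h

lemma Qf_mono (hm : 0 < m) (hb : 0 < b) (hx : 4*m*b < x) (hxy : x ≤ y) : Qf m b x ≤ Qf m b y := by
  obtain ⟨-, h2, -, h4⟩ := Vp_facts hm hb hx
  obtain ⟨-, h2', -, h4'⟩ := Vp_facts hm hb (hx.trans_le hxy)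
  rw [h4, h4']
  have h := Vp_mono hm hb hx hxy
  have : 0 < 4*m*b := pv
  have h0 : 0 < Vp m b x := by
    by_contra hcon; push Not at hcon; nlinarith
  have : 0 < x := ll
  gcongr
  linarith

lemma PH.VpU (H : PH_) : Vp m b U = V := (Vp_unique H.hm H.hb H.h4 H.hUV H.h1).symm

lemma PH.QU (H : PH_) : U+Qf m b U-a = 0 := by
  rw [(Vp_facts H.hm H.hb H.h4).2.2.2, H.VpU, ← H.hA]; ring

lemma PH.Vpf (H : PH_) : Vp m b b9 = 2/(3*b) := by
  have hb := H.hb; have hm := H.hm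
  refine (Vp_unique hm hb mB H.h4 H.h5 ?_ ?_).symm <;> field_simp <;> norm_num

lemma mono_right (hxy : x ≤ y) (hc : ContinuousOn f (Icc x y))
    (h : ∀ r ∈ Ioo x y, HasDerivWithinAt f (f' r) (Ici r) r) (h0 : ∀ r ∈ Ioo x y, 0 ≤ f' r) : f x ≤ f y := by
  rcases hxy.eq_or_lt with rfl | hxy
  · exact le_rfl
  have key : ∀ s ∈ Ioo x y, f s ≤ f y := by
    intro s hs
    have hI : Icc s y ⊆ Icc x y := Icc_subset_Icc hs.1.le le_rfl
    have := image_le_of_deriv_right_le_deriv_boundary (f := λr - f r) (f' := λr - f' r) (a := s) (b := y)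
      (B := λ_ - f s) (B' := λ_ 0) (hc.mono hI).neg (λh (h r ⟨hs.1.trans_le hr.1, hr.2⟩).neg) le_rfl
      continuousOn_const (λR hasDerivWithinAt_const r _ _) (λh by linarith [h0 r ⟨hs.1.trans_le hr.1, hr.2⟩])
      (right_mem_Icc.2 hs.2.le)
    linarith
  have hx : ContinuousWithinAt f (Ioi x) x :=
    ((hc x ⟨le_rfl, hxy.le⟩).mono_of_mem_nhdsWithin (Icc_mem_nhdsGE hxy)).mono Ioi_subset_Ici_self
  refine le_of_tendsto hx ?_
  filter_upwards [Ioo_mem_nhdsGT hxy] with s hs using key s hs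

lemma flux (hx : 0 ≤ x) (hxy : x ≤ y) (h : RL x y w w1 f) (hc : ContinuousOn w1 (Icc x y))
    (hk : ∀ r ∈ Ioo x y, k ≤ f r) : x*w1 x+k*(y^2-x^2)/2 ≤ y*w1 y := by
  have := mono_right (f := λr r*w1 r-k*r^2/2) (f' := λr r*(f r-k)) hxy
    ((continuousOn_id.mul hc).sub (by fun_prop)) ?_ ?_
  · linarith
  · intro r hr
    have hr0 : r ≠ 0 := (hx.trans_lt hr.1).ne'
    have h2 := (h r hr).2
    have h3 : HasDerivWithinAt (fun r : ℝ => k*r^2/2) (k*r) (Ici r) r :=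
      ((((hasDerivAt_pow 2 r).const_mul k).div_const 2).congr_deriv (by norm_num; ring)).hasDerivWithinAt
    refine (((hasDerivWithinAt_id r _).mul h2).sub h3).congr_deriv ?_
    simp only [id]; field_simp; ring
  · intro r hr
    exact mul_nonneg (hx.trans hr.1.le) (by linarith [hk r hr])

lemma lip_of_d {K : ℝ} (hc : ContinuousOn w (Icc p q)) (h : Λp HasDerivAt w (w1 r) r)
    (hK : Λp |w1 r| ≤ K) (hx : x ∈ Icc p q) (hy : y ∈ Icc p q) : |w x-w y| ≤ K * |x-y| := by
  have key : ∀ x ∈ Icc p q, ∀ y ∈ Icc p q, x < y → |w y-w x| ≤ K * |y-x| := by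
    intro x hx y hy hxy
    obtain ⟨c, hc1, hs⟩ := exists_hasDerivAt_eq_slope w w1 hxy (hc.mono (Icc_subset_Icc hx.1 hy.2))
      (λh h r ⟨hx.1.trans_lt hr.1, hr.2.trans_le hy.2⟩)
    have h1 := hK c ⟨hx.1.trans_lt hc1.1, hc1.2.trans_le hy.2⟩
    have h2 : w y-w x = w1 c*(y-x) := by rw [hs, div_mul_cancel₀ _ (sub_pos.2 hxy).ne']
    rw [h2, abs_mul]
    gcongr
  rcases lt_trichotomy x y with h | h | h
  · rw [abs_sub_comm, abs_sub_comm x]; exact key x hx y hy h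
  · rw [h]; simp
  · exact key y hy x hx h

lemma lim_R {F1 F2 G1 G2 : ℝ → ℝ → ℝ → ℝ → ℝ} (cF1 : C4 F1) (cF2 : C4 F2) (cG1 : C4 G1) (cG2 : C4 G2)
    (bF1 : ∀ p t x y, |F1 p t x y| ≤ B) (bF2 : ∀ p t x y, |F2 p t x y| ≤ B)
    (bG1 : ∀ p t x y, |G1 p t x y| ≤ B) (bG2 : ∀ p t x y, |G2 p t x y| ≤ B)
    {K : ℝ} (hl : 0 < rl) {R : ℕ → ℝ} (hR : Tendsto R atTop atTop) (hRh : ∀ n, rh < R n)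
    {u v : ℕ → ℝ → ℝ} {ρ : ℕ → ℝ} (hρ : ∀ n, ρ n ∈ Icc rl rh) (hu : ∀ n, Continuous (u n)) (hv : ∀ n, Continuous (v n))
    (hθ : ∀ n, v n (ρ n) = θ)
    (eu : ∀ n, ∀ r ∈ Icc 0 (R n), u n r = u n 0+rJ (λt sel F1 F2 (ρ n) t (u n t) (v n t)) r)
    (ev : ∀ n, ∀ r ∈ Icc 0 (R n), v n r = v n 0+rJ (λt sel G1 G2 (ρ n) t (u n t) (v n t)) r)
    (hMu : ∀ n, ∀ r ∈ Icc 0 (R n), |u n r| ≤ M) (hMv : ∀ n, ∀ r ∈ Icc 0 (R n), |v n r| ≤ M)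
    (hKu : ∀ n, ∀ r ∈ Icc 0 (R n), ∀ s ∈ Icc 0 (R n), |u n r-u n s| ≤ K * |r-s|)
    (hKv : ∀ n, ∀ r ∈ Icc 0 (R n), ∀ s ∈ Icc 0 (R n), |v n r-v n s| ≤ K * |r-s|) :
    ∃ φ : ℕ → ℕ, StrictMono φ ∧ ∃ u' v' : ℝ → ℝ, ∃ ρ' ∈ Icc rl rh, Continuous u' ∧ Continuous v' ∧ v' ρ' = θ ∧
      Tendsto (λn ρ (φ n)) atTop (nhds ρ') ∧
      (∀ r, 0 ≤ r → Tendsto (λn u (φ n) r) atTop (nhds (u' r)) ∧ Tendsto (λn v (φ n) r) atTop (nhds (v' r))) ∧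
      (∀ r, 0 ≤ r → u' r = u' 0+rJ (λt sel F1 F2 ρ' t (u' t) (v' t)) r ∧
        v' r = v' 0+rJ (λt sel G1 G2 ρ' t (u' t) (v' t)) r) := by
  have hR0 : ∀ n, 0 ≤ R n := λn by have := hρ n; linarith [this.1, this.2, hRh n]
  have hK0 : 0 ≤ K := by
    have h1 : 0 < R 0 := by have := hρ 0; linarith [this.1, this.2, hRh 0]
    have := (abs_nonneg _).trans (hKu 0 0 ⟨le_rfl, h1.le⟩ (R 0) ⟨h1.le, le_rfl⟩)
    have h2 : 0 < |0-R 0| := by rw [abs_pos]; linarith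
    by_contra hc
    push Not at hc
    nlinarith
  have ext : ∀ (w : ℕ → ℝ → ℝ), (∀ n, ∀ r ∈ Icc 0 (R n), |w n r| ≤ M) →
      (∀ n, ∀ r ∈ Icc 0 (R n), ∀ s ∈ Icc 0 (R n), |w n r-w n s| ≤ K * |r-s|) →
      (∀ n x, |w n (cl 0 (R n) x)| ≤ M) ∧ (∀ n x y, |w n (cl 0 (R n) x)-w n (cl 0 (R n) y)| ≤ K * |x-y|) := by
    intro w h1 h2
    exact ⟨fun n x => h1 n _ (cl_mem (hR0 n) x), fun n x y => (h2 n _ (cl_mem (hR0 n) x) _ (cl_mem (hR0 n) y)).trans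
      (mL (cl_lip _ _ _ _) hK0)⟩
  obtain ⟨a1, a2⟩ := ext u hMu hKu
  obtain ⟨b1, b2⟩ := ext v hMv hKv
  obtain ⟨φ1, hφ1, u', hu'⟩ := sub_lip _ M K a1 a2
  obtain ⟨φ2, hφ2, v', hv'⟩ := sub_lip (fun n x => v (φ1 n) (cl 0 (R (φ1 n)) x)) M K (fun n x => b1 _ x) (fun n x y => b2 _ x y)
  obtain ⟨ρ', hρ', φ3, hφ3, hρl⟩ := isCompact_Icc.tendsto_subseq (x := λn ρ (φ1 (φ2 n))) (λn hρ _)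
  let φ := λn φ1 (φ2 (φ3 n))
  have hφ : StrictMono φ := hφ1.comp (hφ2.comp hφ3)
  have cu : ∀ r, 0 ≤ r → Tendsto (λn u (φ n) r) atTop (nhds (u' r)) := by
    intro r hr
    refine ((hu' r).comp (hφ2.comp hφ3).tendsto_atTop).congr' ?_
    filter_upwards [(hR.comp hφ.tendsto_atTop).eventually_ge_atTop r] with n hn
    exact congrArg (u (φ n)) (cl_id ⟨hr, hn⟩)
  have cv : ∀ r, 0 ≤ r → Tendsto (λn v (φ n) r) atTop (nhds (v' r)) := by
    intro r hr
    refine ((hv' r).comp hφ3.tendsto_atTop).congr' ?_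
    filter_upwards [(hR.comp hφ.tendsto_atTop).eventually_ge_atTop r] with n hn
    exact congrArg (v (φ n)) (cl_id ⟨hr, hn⟩)
  have lu : Continuous u' := lip_cont (L := K) fun x y => le_of_tendsto (((hu' x).sub (hu' y)).abs) (Eventually.of_forall λn a2 _ x y)
  have lv : Continuous v' := lip_cont (L := K) fun x y => le_of_tendsto (((hv' x).sub (hv' y)).abs) (Eventually.of_forall λn b2 _ x y)
  have hρ0 : 0 ≤ ρ' := hl.le.trans hρ'.1
  have aene : ∀ r, ∀ᵐ t : ℝ, t ∈ Ioc 0 r → t ≠ ρ' ∧ 0 ≤ t := by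
    intro r
    filter_upwards [compl_mem_ae_iff.2 (Real.volume_singleton (a := ρ'))] with t ht h2
    exact ⟨ht, h2.1.le⟩
  refine ⟨φ, hφ, u', v', ρ', hρ', lu, lv, ?_, hρl, λh ⟨cu r hr, cv r hr⟩, λh ⟨?_, ?_⟩⟩
  · have h1 : Tendsto (λn v (φ n) ρ'-v (φ n) (ρ (φ n))) atTop (nhds 0) := by
      have h2 : Tendsto (λn K * |ρ'-ρ (φ n)|) atTop (nhds 0) := by
        have := ((tendsto_const_nhds (x := ρ')).sub hρl).abs.const_mul K
        simpa using this
      refine squeeze_zero_norm (λn ?_) h2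
      have h3 := hρ (φ n)
      have h4 := hRh (φ n)
      exact hKv _ _ ⟨hρ0, hρ'.2.trans h4.le⟩ _ ⟨mA h3.1, mA h3.2⟩
    have h2 := (cv ρ' hρ0).sub h1
    simp only [sub_sub_cancel, hθ, sub_zero] at h2
    exact (tendsto_nhds_unique h2 tendsto_const_nhds)
  · have h1 : Tendsto (λn rJ (λt sel F1 F2 (ρ (φ n)) t (u (φ n) t) (v (φ n) t)) r) atTop (nhds (rJ (λt sel F1 F2 ρ' t (u' t) (v' t)) r)) := by
      refine rJ_tendsto (B := B) (λn sel_meas cF1 cF2 _ (hu _).measurable (hv _).measurable) (fun n t => sel_bd bF1 bF2 _ _ _ _) hr ?_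
      filter_upwards [aene r] with t ht h2
      exact sel_tendsto cF1 cF2 (ht h2).1 hρl (cu t (ht h2).2) (cv t (ht h2).2)
    refine tendsto_nhds_unique (cu r hr) (((cu 0 le_rfl).add h1).congr' ?_)
    filter_upwards [(hR.comp hφ.tendsto_atTop).eventually_ge_atTop r] with n hn
    exact (eu _ r ⟨hr, hn⟩).symm
  · have h1 : Tendsto (λn rJ (λt sel G1 G2 (ρ (φ n)) t (u (φ n) t) (v (φ n) t)) r) atTop (nhds (rJ (λt sel G1 G2 ρ' t (u' t) (v' t)) r)) := by
      refine rJ_tendsto (B := B) (λn sel_meas cG1 cG2 _ (hu _).measurable (hv _).measurable) (fun n t => sel_bd bG1 bG2 _ _ _ _) hr ?_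
      filter_upwards [aene r] with t ht h2
      exact sel_tendsto cG1 cG2 (ht h2).1 hρl (cu t (ht h2).2) (cv t (ht h2).2)
    refine tendsto_nhds_unique (cv r hr) (((cv 0 le_rfl).add h1).congr' ?_)
    filter_upwards [(hR.comp hφ.tendsto_atTop).eventually_ge_atTop r] with n hn
    exact (ev _ r ⟨hr, hn⟩).symm

noncomputable def Wf (a m b x : ℝ) : ℝ := x+Qf m b x-a
noncomputable def RG1 (a m b : ℝ) (_ _ _ y : ℝ) : ℝ := cl b9 (a+1) y-a
noncomputable def RG2 (a m b U : ℝ) (_ _ _ y : ℝ) : ℝ := Wf a m b (cl U b9 y)+cl (-1) 1 (y-cl U b9 y)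

lemma cl_cont (lo hi : ℝ) : Continuous (cl lo hi) := by unfold cl; fun_prop

lemma cl_le (h : lo ≤ hi) (hx : x ≤ lo) : cl lo hi x = lo := by
  unfold cl; rw [min_eq_right (hx.trans h), max_eq_left hx]
lemma cl_ge (h : lo ≤ hi) (hx : hi ≤ x) : cl lo hi x = hi := by
  unfold cl; rw [min_eq_left hx, max_eq_right h]

lemma cl_one_pos (hx : 0 < x) : 0 < cl (-1) 1 x := by
  unfold cl; exact lt_max_of_lt_right (lt_min one_pos hx)
lemma cl_one_neg (hx : x < 0) : cl (-1) 1 x < 0 := by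
  unfold cl; exact max_lt (by norm_num) ((min_le_right _ _).trans_lt hx)

lemma Wf_cont (a m b : ℝ) : Continuous (Wf a m b) := by
  unfold Wf; have := Qf_cont m b; fun_prop

lemma PH.W_ge (H : PH_) (hx : U ≤ x) (hxy : x ≤ y) : y-x ≤ Wf a m b y-Wf a m b x := by
  unfold Wf
  linarith [Qf_mono H.hm H.hb (H.h4.trans_le hx) hxy]

lemma PH.WU (H : PH_) : Wf a m b U = 0 := H.QU

lemma C4_RG1 (a m b : ℝ) : C4 (RG1 a m b) := by
  unfold C4 RG1; have := cl_cont b9 (a+1); fun_prop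
lemma C4_RG2 (a m b U : ℝ) : C4 (RG2 a m b U) := by
  unfold C4 RG2
  have h1 := cl_cont U b9; have h2 := cl_cont (-1) 1; have h3 := Wf_cont a m b; fun_prop

noncomputable def RB (a m b : ℝ) : ℝ := a+1+Wf a m b b9

lemma PH.Wuf (H : PH_) : 0 < Wf a m b b9 := by
  have := H.W_ge le_rfl H.h5.le; rw [H.WU] at this; linarith [H.h5]

lemma PH.bG1 (H : PH_) (p t x y : ℝ) : |RG1 a m b p t x y| ≤ RB a m b := by
  have h6 := H.h6
  have h0 := H.Wuf
  have := cl_mem (lo := b9) (hi := a+1) ll y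
  have : 0 < b9 := by have := H.hb; have := H.hm; positivity
  unfold RG1 RB; rw [abs_le]; constructor <;> linarith [this, (cl_mem (lo := b9) (hi := a+1) ll y).1, (cl_mem (lo := b9) (hi := a+1) ll y).2]

lemma PH.bG2 (H : PH_) (p t x y : ℝ) : |RG2 a m b U p t x y| ≤ RB a m b := by
  have ha := H.ha
  have h1 := cl_mem H.h5.le y
  have h2 := cl_mem (show (-1:ℝ) ≤ 1 by norm_num) (y-cl U b9 y)
  have h3 := H.W_ge le_rfl h1.1
  have h4 := H.W_ge h1.1 h1.2
  have h5 := H.WU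
  unfold RG2 RB; rw [abs_le]; constructor <;> linarith [h1.1, h1.2, h2.1, h2.2]

structure RedR (a m b U R : ℝ) (w : ℝ → ℝ) (ρ c A : ℝ) : Prop where
  cw : Continuous w
  wρ : w ρ = b9
  wR : w R = U
  ein : ∀ r ∈ Icc 0 ρ, w r = w 0+rJ (λt sel (RG1 a m b) (RG2 a m b U) ρ t 0 (w t)) r
  eout : ∀ r ∈ Icc ρ R, w r = A+rJ (λt sel (RG1 a m b) (RG2 a m b U) ρ t 0 (w t)) r+c*log r
  bin : ∀ r ∈ Icc 0 ρ, b9 ≤ w r ∧ w r ≤ a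
  bout : ∀ r ∈ Icc ρ R, U ≤ w r ∧ w r ≤ b9

lemma red_fp (H : PH_) (hl : 0 < rl) (hlh : rl < rh) (hR : rh < R) :
    ∃ w : ℝ → ℝ, ∃ ρ ∈ Icc rl rh, ∃ c A : ℝ, (c = 0 ∨ (ρ = rl ∧ 0 < c) ∨ (ρ = rh ∧ c < 0)) ∧ RedR a m b U R w ρ c A := by
  have hB0 : 0 ≤ RB a m b := (abs_nonneg _).trans (H.bG1 0 0 0 0)
  have c0 : C4 (fun _ _ _ _ => 0) := by unfold C4; fun_prop
  obtain ⟨u, w, ρ, hρ, c, -, cw, htri, -, hwρ, hwR, heq⟩ := fp_lem (B := RB a m b) c0 c0 (C4_RG1 a m b) (C4_RG2 a m b U)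
    (fun _ _ _ _ => by simpa using hB0) (fun _ _ _ _ => by simpa using hB0) H.bG1 H.bG2 hl hlh hR 0 b9 U
  have hρ0 : 0 < ρ := hl.trans_le hρ.1
  have hρR : ρ < R := hρ.2.trans_lt hR
  set g : ℝ → ℝ := λt sel (RG1 a m b) (RG2 a m b U) ρ t 0 (w t) with hg
  have mg : Measurable g := sel_meas (C4_RG1 a m b) (C4_RG2 a m b U) ρ measurable_const cw.measurable
  have bg : ∀ t, |g t| ≤ RB a m b := λt sel_bd H.bG1 H.bG2 _ _ _ _
  have rg : ∀ t, ContinuousWithinAt g (Ici t) t := λt sel_rc (C4_RG1 a m b) (C4_RG2 a m b U) ρ (u := λ_ 0) continuous_const cw t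
  have he : ΛR w r = b9+rJ g r-rJ g ρ+c*rlp ρ r := λh (heq r hr).2
  have e0 : w 0 = b9-rJ g ρ := by
    rw [he 0 ⟨le_rfl, (hρ0.trans hρR).le⟩, rJ_zero]; unfold rlp; rw [max_eq_right hρ0.le]; ring
  have ein : ∀ r ∈ Icc 0 ρ, w r = w 0+rJ g r := by
    intro r hr
    rw [he r ⟨hr.1, hr.2.trans hρR.le⟩, e0]; unfold rlp; rw [max_eq_right hr.2]; ring
  have eout : ∀ r ∈ Icc ρ R, w r = (b9-rJ g ρ-c*log ρ)+rJ g r+c*log r := by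
    intro r hr
    rw [he r ⟨hρ0.le.trans hr.1, hr.2⟩]; unfold rlp; rw [max_eq_left hr.1]; ring
  have Rin : RL 0 ρ w (λr rH g r+0/r) g := sol_RL mg bg le_rfl rg (A := w 0) (λh by rw [ein r hI_]; ring)
  have Rout : RL ρ R w (λr rH g r+c/r) g := sol_RL mg bg hρ0.le rg (λh eout r hI_)
  have Z := sol_zero mg bg hρ0 ein
  have gin : ∀ r ∈ Ioo 0 ρ, g r = cl b9 (a+1) (w r)-a := λh by
    rw [hg]; simp only [sel, if_pos hr.2, RG1]
  have gout : ∀ r ∈ Ioo ρ R, g r = Wf a m b (cl U b9 (w r))+cl (-1) 1 (w r-cl U b9 (w r)) := λh by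
    rw [hg]; simp only [sel, if_neg (not_lt.2 hr.1.le), RG2]
  have h5 := H.h5
  have h6 := H.h6
  refine ⟨w, ρ, hρ, c, _, htri, cw, hwρ, hwR, ein, eout, ?_, ?_⟩
  · have i1 := cmpr le_rfl hρ0 (w := λr b9-w r) (w1 := λr - (rH g r+0/r)) (f := λr - g r) (by fun_prop)
      (λh ⟨(Rin r hr).1.const_sub _, (Rin.neg r hr).2⟩) (Or.inr ⟨-0, by simp, Z.const_sub _⟩) (by rw [hwρ]; linarith)
      (fun r hr h => by rw [gin r hr, cl_le ll ll]; linarith)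
    have i2 := cmpr le_rfl hρ0 (w := λr w r-a) (w1 := λr (rH g r+0/r)) (f := g) (by fun_prop)
      (λh ⟨(Rin r hr).1.sub_const _, (Rin r hr).2⟩) (Or.inr ⟨0, le_rfl, Z.sub_const _⟩) (by rw [hwρ]; linarith)
      (fun r hr h => by
        rw [gin r hr]
        have : a < cl b9 (a+1) (w r) := by unfold cl; exact lt_max_of_lt_right (lt_min ll ll)
        linarith)
    intro r hr
    constructor
    · linarith only [i1 r hr]
    · linarith [i2 r hr]
  · have i1 := cmpr hρ0.le hρR (w := λr U-w r) (w1 := λr - (rH g r+c/r)) (f := λr - g r) (by fun_prop)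
      (λh ⟨(Rout r hr).1.const_sub _, (Rout.neg r hr).2⟩) (Or.inl (by rw [hwρ]; linarith)) (by rw [hwR]; linarith)
      (fun r hr h => by
        rw [gout r hr, cl_le ll ll, H.WU]
        have := cl_one_neg (x := w r-U) ll
        linarith)
    have i2 := cmpr hρ0.le hρR (w := λr w r-b9) (w1 := λr (rH g r+c/r)) (f := g) (by fun_prop)
      (λh ⟨(Rout r hr).1.sub_const _, (Rout r hr).2⟩) (Or.inl (by rw [hwρ]; linarith)) (by rw [hwR]; linarith)
      (fun r hr h => by
        rw [gout r hr, cl_ge lA h5 lA h]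
        have := cl_one_pos (x := w r-b9) lA h
        linarith only [H.Wuf, this])
    intro r hr
    constructor
    · linarith [i1 r hr]
    · linarith only [i2 r hr]

lemma RL.congr {w1' : ℝ → ℝ} (h : RL p q w w1 f) (h1 : Λp w1 r = w1' r) (h2 : Λp f r = f' r) :
    RL p q w w1' f' := by
  intro r hr
  obtain ⟨a1, a2⟩ := h r hr
  rw [h1 r hr, h2 r hr] at *
  refine ⟨a1, (a2.congr_of_eventuallyEq ?_ (h1 r hr).symm)⟩
  filter_upwards [mem_nhdsWithin_of_mem_nhds (isOpen_Ioo.mem_nhds hr)] with s hs using (h1 s hs).symm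

lemma RedR.facts (H : PH_) (h : RedR a m b U R w ρ c A) (hρ0 : 0 < ρ) (hρR : ρ < R) :
    ∃ g : ℝ → ℝ, (g = λt sel (RG1 a m b) (RG2 a m b U) ρ t 0 (w t)) ∧ Measurable g ∧ (∀ t, |g t| ≤ RB a m b) ∧
    RL 0 ρ w (rH g) (λr w r-a) ∧ RL ρ R w (λr rH g r+c/r) (λr Wf a m b (w r)) ∧
    HasDerivWithinAt w 0 (Ici 0) 0 ∧ (∀ r ∈ Ioo ρ R, rH g r+c/r ≤ 0) ∧ (∀ r ∈ Ioo ρ R, ρ*rH g ρ+c ≤ r*(rH g r+c/r)) ∧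
    (c = 0 → RL 0 R w (rH g) g) := by
  obtain ⟨cw, wρ, wR, ein, eout, bin, bout⟩ := h
  refine ⟨_, rfl, ?_⟩
  set g : ℝ → ℝ := λt sel (RG1 a m b) (RG2 a m b U) ρ t 0 (w t) with hg
  have mg : Measurable g := sel_meas (C4_RG1 a m b) (C4_RG2 a m b U) ρ measurable_const cw.measurable
  have bg : ∀ t, |g t| ≤ RB a m b := λt sel_bd H.bG1 H.bG2 _ _ _ _
  have rg : ∀ t, ContinuousWithinAt g (Ici t) t := λt sel_rc (C4_RG1 a m b) (C4_RG2 a m b U) ρ (u := λ_ 0) continuous_const cw t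
  have Rin : RL 0 ρ w (rH g) (λr w r-a) := by
    refine (sol_RL mg bg le_rfl rg (A := w 0) (c := 0) (w := w) (q := ρ) (λh by rw [ein r hI_]; ring)).congr (λR by simp) (λh ?_)
    have := bin r hI_
    rw [hg]; simp only [sel, if_pos hr.2, RG1]; rw [cl_id ⟨this.1, mA this.2⟩]
  have Rout : RL ρ R w (λr rH g r+c/r) (λr Wf a m b (w r)) := by
    refine (sol_RL mg bg hρ0.le rg (λh eout r hI_)).congr (λR rfl) (λh ?_)
    have := bout r hI_
    rw [hg]; simp only [sel, if_neg (not_lt.2 hr.1.le), RG2]; rw [cl_id this, sub_self, cl_id (by norm_num), add_zero]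
  have Z := sol_zero mg bg hρ0 ein
  have cw1 : ContinuousOn (λr rH g r+c/r) (Ici ρ) := by
    intro r hr
    have hr0 : 0 < r := hρ0.trans_le hr
    exact ((rH_cont mg bg hr0).add (continuousAt_const.div continuousAt_id hr0.ne')).continuousWithinAt
  have hW : ∀ r ∈ Ioo ρ R, 0 ≤ Wf a m b (w r) := λh by
    have := bout r hI_
    have h2 := H.W_ge le_rfl this.1
    rw [H.WU] at h2; linarith
  have hfl : ∀ x y, ρ ≤ x → x ≤ y → y < R → x*(rH g x+c/x) ≤ y*(rH g y+c/y) := by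
    intro x y h1 h2 h3
    have := flux (k := 0) (hρ0.le.trans h1) h2 (Rout.mono h1 h3.le) (cw1.mono (λh h1.trans hr.1)) (λh hW r ⟨h1.trans_lt hr.1, hr.2.trans h3⟩)
    simpa using this
  refine ⟨mg, bg, Rin, Rout, Z, ?_, ?_, ?_⟩
  · intro r hr
    by_contra hcon
    push Not at hcon
    have hr0 : 0 < r := hρ0.trans hr.1
    obtain ⟨ξ, hξ, hs⟩ := exists_hasDerivAt_eq_slope w (λr rH g r+c/r) hr.2 cw.continuousOn
      (fun s hs => (Rout s ⟨hr.1.trans hs.1, hs.2⟩).1)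
    have h1 := hfl r ξ hr.1.le hξ.1.le hξ.2
    have h2 : 0 < r*(rH g r+c/r) := mul_pos hr0 hcon
    have h3 : 0 < rH g ξ+c/ξ := by
      by_contra h4
      push Not at h4
      linarith [mul_nonpos_of_nonneg_of_nonpos (hr0.trans hξ.1).le h4]
    rw [hs, wR] at h3
    linarith [(div_pos_iff_of_pos_right (sub_pos.2 hr.2)).1 h3, (bout r hI_).1]
  · intro r hr
    have := hfl ρ r le_rfl hr.1.le hr.2
    have e : ρ*(rH g ρ+c/ρ) = ρ*rH g ρ+c := by field_simp
    rw [e] at this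
    exact this
  · intro hc
    have e : A = w 0 := by
      have h1 := ein ρ ⟨hρ0.le, le_rfl⟩
      have h2 := eout ρ ⟨le_rfl, hρR.le⟩
      rw [hc] at h2; linarith
    refine (sol_RL mg bg le_rfl rg (A := w 0) (c := 0) (w := w) (q := R) (λh ?_)).congr (λR by simp) (fun _ _ => rfl)
    rcases le_total r ρ with h1 | h1
    · rw [ein r ⟨hr.1.le, h1⟩]; ring
    · rw [eout r ⟨h1, hr.2.le⟩, hc, e]

lemma red_lo (H : PH_) : ∃ ε > 0, ε ≤ 1/2 ∧ ∀ R w c A, 2 ≤ R → RedR a m b U R w ε c A → 0 < c → False := by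
  set k := (b9-U)/2 with hk
  have hk0 : 0 < k := by have := H.h5; rw [hk]; exact lA this
  have hB : 0 < RB a m b := by have := H.Wuf; have := H.ha; unfold RB; linarith
  set ε := min (1/2) (k/(2*RB a m b)) with hε
  have hε0 : 0 < ε := by rw [hε]; apply lt_min (by norm_num); positivity
  have hε1 : ε ≤ 1/2 := min_le_left _ _
  have hε2 : RB a m b*ε ≤ k/2 := by
    have : ε ≤ k/(2*RB a m b) := min_le_right _ _
    calc _ ≤ RB a m b*(k/(2*RB a m b)) := by gcongr
      _ = k/2 := by field_simp
  refine ⟨ε, hε0, hε1, fun R w c A hR h hc => ?_⟩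
  have hεR : ε < R := lC hε0 hε1 hR
  obtain ⟨g, -, mg, bg, -, Rout, -, hneg, hlow, -⟩ := h.facts H hε0 hεR
  have hgε : -(RB a m b*ε) ≤ rH g ε := (abs_le.1 (rH_bd bg hε0.le)).1
  have hs : -(RB a m b*ε*ε) < ε*rH g ε+c := by nlinarith
  have hBε : 0 ≤ RB a m b*ε := pv
  have hw1 : ∀ r ∈ Ioo ε R, |rH g r+c/r| ≤ RB a m b*ε := by
    intro r hr
    have hr0 : 0 < r := hε0.trans hr.1
    rw [abs_le]
    refine ⟨?_, (hneg r hr).trans hBε⟩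
    have h1 := hlow r hr
    by_contra hcon
    push Not at hcon
    have h2 := mul_lt_mul_of_pos_left hcon hr0
    have h3 := mL hr.1.le hBε
    exact lD hs h1 h2 h3
  have hlip : ∀ r ∈ Icc ε 1, b9-k/2 ≤ w r := by
    intro r hr
    have h1 := lip_of_d (p := ε) (q := R) h.cw.continuousOn (λh (Rout r hr).1) hw1 (x := r) (y := ε) ⟨hr.1, lD hr.2 hε0 hε1 hR⟩ ⟨le_rfl, hεR.le⟩
    rw [h.wρ, abs_of_nonneg (sub_nonneg.2 hr.1)] at h1
    have h2 := (abs_le.1 h1).1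
    have h3 : RB a m b*ε*(r-ε) ≤ RB a m b*ε*1 := mL lB hr.2 hε0 hBε
    exact lC hε2 h2 h3
  have hf := flux (k := k) (x := ε) (y := 1) hε0.le lB hε0 hε1 (Rout.mono le_rfl lC hε0 hε1 hR) ?_ ?_
  · have h1 := hneg 1 ⟨lB hε0 hε1, lC hε0 hε1 hR⟩
    have e : ε*(rH g ε+c/ε) = ε*rH g ε+c := by field_simp
    rw [e] at hf
    have h2 : RB a m b*ε*ε ≤ k/2*(1/2) := mul_le_mul hε2 hε1 hε0.le lA hk0
    have h3 : ε^2 ≤ 1/4 := by nlinarith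
    have h4 : k*(1/4) ≤ k*((1^2-ε^2)/2) := mL lC hε0 hε1 h3 hk0.le
    exact lE hs hf h1 h2 h4
  · intro r hr
    have hr0 : 0 < r := hε0.trans_le hr.1
    exact ((rH_cont mg bg hr0).add (continuousAt_const.div continuousAt_id hr0.ne')).continuousWithinAt
  · intro r hr
    have h1 := hlip r hI_
    have h2 := H.W_ge le_rfl (h.bout r ⟨hr.1.le, lD hr.2 hε0 hε1 hR⟩).1
    rw [H.WU] at h2
    exact lD hk hk0 h1 h2

noncomputable def Gm (a m b U x : ℝ) : ℝ := ∫ s in U..x, Wf a m b s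

lemma Gm_deriv (a m b U x : ℝ) : HasDerivAt (Gm a m b U) (Wf a m b x) x :=
  intervalIntegral.integral_hasDerivAt_right ((Wf_cont a m b).intervalIntegrable _ _)
    (Wf_cont a m b).stronglyMeasurable.stronglyMeasurableAtFilter (Wf_cont a m b).continuousAt

lemma PH.Gm_nonneg (H : PH_) (hx : U ≤ x) : 0 ≤ Gm a m b U x := by
  refine intervalIntegral.integral_nonneg hx fun s hs => ?_
  have := H.W_ge le_rfl hs.1
  rw [H.WU] at this; linarith [hs.1]

lemma PH.Gm_lt (H : PH_) : Gm a m b U b9 < (a-b9)^2/2 := by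
  have e : Gm a m b U b9 = (∫ s in U..(b9), (s-a)) + ∫ s in U..(b9), Qf m b s := by
    unfold Gm
    rw [← intervalIntegral.integral_add ((by fun_prop : Continuous fun s : ℝ => s-a).intervalIntegrable _ _) ((Qf_cont m b).intervalIntegrable _ _)]
    congr 1; ext s; unfold Wf; ring
  have e2 : (∫ s in U..(b9), (s-a)) = (b9-a)^2/2-(U-a)^2/2 := by
    rw [intervalIntegral.integral_comp_sub_right (λs s) a, integral_id]; ring
  rw [e, e2]
  have := H.hc
  nlinarith

set_option maxHeartbeats 1000000 in
lemma red_hi (H : PH_) : ∃ L0 ≥ 2, ∀ L ≥ L0, ∀ R w c A, 2*L ≤ R → RedR a m b U R w L c A → c < 0 → False := by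
  set uf := b9 with huf
  have h6 := H.h6
  have ha := H.ha
  have huf0 : 0 < uf := by rw [huf]; have := H.hb; have := H.hm; positivity
  have hU0 : 0 < U := by have := H.h4; have := H.hb; have := H.hm; have : 0 < 4*m*b := pv; linarith
  set d0 := a-uf with hd0
  have hd : 0 < d0 := lB huf h6
  set κ := d0^2/2-Gm a m b U uf with hκ
  have hκ0 : 0 < κ := by have := H.Gm_lt; rw [hκ, hd0, huf]; exact lA this
  set X := 2*d0^2+d0*a+a^2 with hX
  have hX0 : 0 < X := pv
  refine ⟨max (4+2*a/d0) (X/κ+1), le_max_of_le_left (by have : 0 ≤ 2*a/d0 := pv; linarith only [this]), fun L hL R w c A hR h hc => ?_⟩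
  have hL1 : 4+2*a/d0 ≤ L := (le_max_left _ _).trans hL
  have hL2 : X/κ < L := by linarith only [(le_max_right (4+2*a/d0) (X/κ+1)).trans hL, hL]
  have hL4 : 4 ≤ L := by have : 0 ≤ 2*a/d0 := pv; exact lB hL1 this
  have hL0 : 0 < L := lA hL4
  have hLR : L < R := lB hR hL4
  have hXL : X/L < κ := by rw [div_lt_iff₀ hL0]; rw [div_lt_iff₀ hκ0] at hL2; exact lA hL2
  obtain ⟨g, hgd, mg, bg, Rin, Rout, Z, hneg, hlow, -⟩ := h.facts H hL0 hLR
  have hdL : HasDerivAt (rJ g) (rH g L) L := rJ_deriv mg bg hL0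
  set s := 1-2/L with hs
  have hsL : 2/L ≤ 1/2 := by rw [div_le_iff₀ hL0]; exact lA hL4
  have hs0 : 1/2 ≤ s := lA hsL
  have hs1 : s ≤ 1 := by have : 0 ≤ 2/L := pv; exact lA this
  let z : ℝ → ℝ := λr d0*exp (s*(r^2-L^2)/(2*L))
  let z1 : ℝ → ℝ := λr z r*(s*r/L)
  have hz : ∀ r, HasDerivAt z (z1 r) r := by
    intro r
    have : HasDerivAt (fun r : ℝ => s*(r^2-L^2)/(2*L)) (s*r/L) r :=
      (((((hasDerivAt_pow 2 r).sub_const (L^2)).const_mul s).div_const (2*L))).congr_deriv (by norm_num; field_simp)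
    exact (this.exp.const_mul d0).congr_deriv (by simp only [z1, z]; ring)
  have hz1 : ∀ r, HasDerivAt z1 (z1 r*(s*r/L)+z r*(s/L)) r := λr
    ((hz r).mul (((hasDerivAt_id r).const_mul s).div_const L)).congr_deriv (by simp)
  have hzc : Continuous z := continuous_iff_continuousAt.2 λr (hz r).continuousAt
  have hzp : ∀ r, 0 < z r := λr by simp only [z]; positivity
  have hzL : z L = d0 := by simp [z]
  have hcw := h.cw
  have hin := cmpr le_rfl hL0 (w := λr (a-w r)-z r) (w1 := λr - rH g r-z1 r)
    (f := λr -(w r-a)-(z1 r*(s*r/L)+z r*(s/L)+z1 r/r)) (by fun_prop)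
    (RL.sub (w := λr a-w r) (w1 := λr - rH g r) (f := λr -(w r-a)) (λh ⟨(Rin r hr).1.const_sub a, (Rin.neg r hr).2⟩) (RL_of (λR hz r) (λR hz1 r) (fun _ _ => rfl)))
    (Or.inr ⟨-0-z1 0, by simp [z1], (Z.const_sub a).sub (hz 0).hasDerivWithinAt⟩)
    (by simp only [h.wρ, hzL]; linarith only [huf])
    (fun r hr hr2 => by
      have hr0 := hr.1
      have e : z1 r*(s*r/L)+z r*(s/L)+z1 r/r = z r*(s^2*(r/L)^2+2*s/L) := by
        simp only [z1]; field_simp; ring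
      have h1 : (r/L)^2 ≤ 1 := by
        rw [div_pow, div_le_one pv]; exact pow_le_pow_left₀ hr0.le hr.2.le 2
      have h2 : s^2*(r/L)^2+2*s/L ≤ 1 := by
        have h3 : s^2*(r/L)^2 ≤ s^2*1 := mL h1 (sq_nonneg s)
        have h4 : 2*s/L = s*(1-s) := by rw [hs]; ring
        rw [h4]; exact lB hs1 h3
      have h5 := mL h2 (hzp r).le
      rw [e]; linarith only [hr2, h5])
  have hSin : s*d0 ≤ - rH g L := by
    have hφ : HasDerivAt (λr a-(w 0+rJ g r)-z r) (- rH g L-z1 L) L := (((hdL.const_add (w 0)).const_sub a).sub (hz L))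
    have := left_slope hφ hL0 (λh by
      have h1 := hin r hI_
      have h2 := h.ein r hI_
      have h3 := h.ein L ⟨hL0.le, le_rfl⟩
      have h4 := h.wρ
      simp only [← hgd] at h2 h3
      rw [← h2, ← h3, hzL, h4]; linarith only [huf, h1])
    have e : z1 L = d0*s := by simp only [z1]; rw [hzL]; field_simp
    rw [e] at this; exact lA this
  set S := -(rH g L+c/L) with hS
  have hSS : s*d0 < S := by
    have : c/L < 0 := div_neg_of_neg_of_pos hc hL0
    exact lB hSin this
  have hS0 : 0 < S := lt_trans pv hSS
  let w1 : ℝ → ℝ := λr rH g r+c/r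
  have hlow' : ∀ r ∈ Ioo L R, -(L*S) ≤ r*w1 r := by
    intro r hr
    have := hlow r hr
    have e : -(L*S) = L*rH g L+c := by rw [hS]; field_simp
    rw [e]; exact this
  have hnS : ∀ r ∈ Ioo L R, - w1 r/r ≤ S/L := by
    intro r hr
    have hr0 : 0 < r := hL0.trans hr.1
    have h1 := hlow' r hr
    rw [div_le_div_iff₀ hr0 hL0]
    have h2 := hneg r hr
    have h3 : - w1 r*r ≤ S*L := lA h1
    have h4 : - w1 r*L ≤ - w1 r*r := mL hr.1.le (by simp only [w1]; linarith only [h2])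
    have h5 : S*L ≤ S*r := mL hr.1.le hS0.le
    exact lC h1 h4 h5
  obtain ⟨r1, hr1, hsl⟩ := exists_hasDerivAt_eq_slope w w1 hLR hcw.continuousOn (λh (Rout r hr).1)
  have hE := mono_right (f := λr (w1 r)^2/2-Gm a m b U (w r)-S/L*w r)
    (f' := λr w1 r*(Wf a m b (w r)-w1 r/r)-Wf a m b (w r)*w1 r-S/L*w1 r) hr1.1.le ?_ ?_ ?_
  · have e1 : w1 L = - S := by rw [hS]; simp only [w1]; ring
    simp only [e1, h.wρ] at hE
    have b1 := h.bout r1 ⟨hr1.1.le, hr1.2.le⟩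
    have h1 := H.Gm_nonneg b1.1
    have h2 : 0 ≤ S/L*w r1 := by have : 0 ≤ w r1 := lB b1.1 hU0; positivity
    have h3 : (w1 r1)^2 ≤ (a/L)^2 := by
      rw [hsl, h.wρ, h.wR]
      rw [← sq_abs, abs_div]
      gcongr
      · rw [abs_le]; constructor <;> linarith [H.h5]
      · rw [abs_of_pos lB hR hL4]; exact lA hR
    have h4 : S^2/2-S*a/L ≤ Gm a m b U uf+(a/L)^2/2 := by
      have : S/L*uf ≤ S/L*a := mL h6.le pv
      have e : S/L*a = S*a/L := by ring
      rw [neg_sq, ← huf] at hE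
      linarith only [hE, h1, h2, h3, this, e]
    have h5 : a/L ≤ d0/2 := by
      rw [div_le_iff₀ hL0]
      have : 2*a/d0 ≤ L := lA hL1
      rw [div_le_iff₀ hd] at this; exact lA this
    have h6' : d0/2 ≤ s*d0 := by
      have := mR hs0 hd.le
      exact lA this
    have h7 : 0 ≤ (S-s*d0)*((S+s*d0)/2-a/L) := mul_nonneg lA hSS lC hSS h5 h6'
    have h8 : (s*d0)^2/2-s*d0*(a/L) ≤ S^2/2-S*a/L := by
      have : (S-s*d0)*((S+s*d0)/2-a/L) = S^2/2-S*a/L-((s*d0)^2/2-s*d0*(a/L)) := by ring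
      exact lB h7 this
    have h9 : 1-4/L ≤ s^2 := by
      have : s^2 = 1-4/L+(2/L)^2 := by rw [hs]; ring
      rw [this]; linarith only [sq_nonneg (2/L)]
    have h10 : (1-4/L)*d0^2 ≤ s^2*d0^2 := mR h9 (sq_nonneg d0)
    have h11 : s*(d0*(a/L)) ≤ 1*(d0*(a/L)) := mR hs1 pv
    have h12 : (a/L)^2/2 ≤ a^2/L := by
      have : (a/L)^2/2 = a^2/L*(1/(2*L)) := by field_simp
      rw [this]
      have h13 : 1/(2*L) ≤ 1 := by rw [div_le_one lA hL4]; exact lA hL4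
      exact (mL h13 pv).trans (by rw [mul_one])
    have h14 : X/L = 4/L*d0^2/2+d0*(a/L)+a^2/L := by rw [hX]; ring
    have h15 : (s*d0)^2 = s^2*d0^2 := by ring
    have h16 : s*d0*(a/L) = s*(d0*(a/L)) := by ring
    linarith
  · have hw1c : ContinuousOn w1 (Icc L r1) := by
      intro r hr
      have hr0 : 0 < r := hL0.trans_le hr.1
      exact ((rH_cont mg bg hr0).add (continuousAt_const.div continuousAt_id hr0.ne')).continuousWithinAt
    have hGc : Continuous (Gm a m b U) := continuous_iff_continuousAt.2 λx (Gm_deriv a m b U x).continuousAt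
    fun_prop
  · intro r hr
    obtain ⟨a1, a2⟩ := Rout r ⟨hr.1, hr.2.trans hr1.2⟩
    have a3 := ((Gm_deriv a m b U (w r)).comp r a1).hasDerivWithinAt (s := Ici r)
    refine ((((a2.pow 2).div_const 2).sub a3).sub (a1.hasDerivWithinAt.const_mul (S/L))).congr_deriv ?_
    simp only [w1]; ring
  · intro r hr
    have hr' : r ∈ Ioo L R := ⟨hr.1, hr.2.trans hr1.2⟩
    have h1 := hnS r hr'
    have h2 : w1 r ≤ 0 := hneg r hr'
    have e : w1 r*(Wf a m b (w r)-w1 r/r)-Wf a m b (w r)*w1 r-S/L*w1 r = (- w1 r)*(S/L-(- w1 r/r)) := by ring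
    rw [e]
    exact mul_nonneg lA h2 lA h1

lemma rH_le (mg : Measurable g) (bg : ∀ t, |g t| ≤ B) (hr : 0 < r) (hk : ∀ t ∈ Ioo 0 r, g t ≤ -k) :
    rH g r ≤ -(k*r/2) := by
  unfold rH
  rw [div_le_iff₀ hr]
  have h1 : (∫ t in (0:ℝ)..r, t*g t) ≤ ∫ t in (0:ℝ)..r, t*(-k) := by
    refine intervalIntegral.integral_mono_on_of_le_Ioo hr.le (rI_int mg bg 0 r) ((by fun_prop : Continuous fun t : ℝ => t*(-k)).intervalIntegrable _ _) fun t ht => ?_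
    exact mL (hk t ht) ht.1.le
  rw [intervalIntegral.integral_mul_const, integral_id] at h1
  linarith

structure Red (a m b U rI L0 d1 : ℝ) (w w1 : ℝ → ℝ) : Prop where
  rI0 : 0 < rI
  d10 : 0 < d1
  cw : Continuous w
  cw1 : ContinuousOn w1 (Ioi 0)
  rl : ∀ R, RL 0 R w w1 (λr if r < rI then w r-a else Wf a m b (w r))
  z : HasDerivWithinAt w 0 (Ici 0) 0
  wI : w rI = b9
  anti : ∀ x y, 0 ≤ x → x ≤ y → w y ≤ w x
  neg : ∀ r > 0, w1 r ≤ 0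
  bin : ∀ r ∈ Icc 0 rI, b9 ≤ w r ∧ w r ≤ a-d1
  bout : ∀ r, rI ≤ r → U ≤ w r ∧ w r ≤ b9 ∧ w r ≤ U+a*exp (-(r-rI))
  lip : ∀ r > 0, |w1 r| ≤ L0
  slope : ∀ r ∈ Ioc 0 rI, w1 r ≤ -(d1*r/2)

lemma RedR.more {L : ℝ} (H : PH_) (h : RedR a m b U R w ρ 0 A) (hρ0 : 0 < ρ) (hρR : ρ < R) (hL : ρ ≤ L) :
    (ΛR w r = w 0+rJ (λt sel (RG1 a m b) (RG2 a m b U) ρ t 0 (w t)) r) ∧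
    (ΛR |w r| ≤ a) ∧ (∀ x ∈ Icc 0 R, ∀ y ∈ Icc 0 R, |w x-w y| ≤ RB a m b*L * |x-y|) ∧
    (∀ x ∈ Icc 0 R, ∀ y ∈ Icc 0 R, x ≤ y → w y ≤ w x) ∧ (∀ r ∈ Icc ρ R, w r ≤ U+a*exp (-(r-ρ))) := by
  have ha := H.ha
  have hU0 : 0 < U := by have := H.h4; have := H.hb; have := H.hm; have : 0 < 4*m*b := pv; linarith
  have h5 := H.h5
  have h6 := H.h6
  have hB : 0 < RB a m b := by have := H.Wuf; have := H.ha; unfold RB; linarith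
  obtain ⟨g, hg, mg, bg, Rin, Rout, Z, hneg, hlow, hc0⟩ := h.facts H hρ0 hρR
  have hRL := hc0 rfl
  have hw : ΛR U ≤ w r ∧ w r ≤ a := by
    intro r hr
    rcases le_total r ρ with h1 | h1
    · have := h.bin r ⟨hr.1, h1⟩; exact ⟨ll, this.2⟩
    · have := h.bout r ⟨h1, hr.2⟩; exact ⟨this.1, ll⟩
  have gneg : ∀ r ∈ Ioo 0 ρ, g r ≤ -0 := by
    intro r hr
    have := h.bin r hI_
    rw [hg]; simp only [sel, if_pos hr.2, RG1]; rw [cl_id ⟨this.1, mA this.2⟩]; linarith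
  have hn : ∀ r ∈ Ioo 0 R, rH g r ≤ 0 := by
    intro r hr
    rcases le_or_gt r ρ with h1 | h1
    · have := rH_le mg bg hr.1 (k := 0) (fun t ht => gneg t ⟨ht.1, ht.2.trans_le h1⟩)
      simpa using this
    · have := hneg r ⟨h1, hr.2⟩
      simpa using this
  have hb : ∀ r ∈ Ioo 0 R, |rH g r| ≤ RB a m b*L := by
    intro r hr
    rcases le_or_gt r ρ with h1 | h1
    · exact (rH_bd bg hr.1.le).trans (mL (h1.trans hL) hB.le)
    · have h2 := hlow r ⟨h1, hr.2⟩
      simp only [zero_div, add_zero] at h2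
      have h3 := (abs_le.1 (rH_bd bg hρ0.le)).1
      rw [abs_of_nonpos (hn r hr)]
      have h4 : -(RB a m b*ρ) ≤ rH g r := by
        by_contra hcon
        push Not at hcon
        have h5 := mul_lt_mul_of_pos_left hcon hr.1
        have h6 := mL h3 hρ0.le
        have h7 : ρ*(RB a m b*ρ) ≤ r*(RB a m b*ρ) := mR h1.le pv
        linarith
      linarith [mL hL hB.le]
  have hRL' : ∀ r ∈ Ioo 0 R, HasDerivAt w (rH g r) r := λh (hRL r hr).1
  refine ⟨?_, λh by rw [abs_le]; constructor <;> linarith [hw r hr], fun x hx y hy => lip_of_d h.cw.continuousOn hRL' hb hx hy, ?_, ?_⟩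
  · have e : A = w 0 := by
      linarith [h.ein ρ ⟨hρ0.le, le_rfl⟩, h.eout ρ ⟨le_rfl, hρR.le⟩]
    intro r hr
    rcases le_total r ρ with h1 | h1
    · exact h.ein r ⟨hr.1, h1⟩
    · rw [h.eout r ⟨h1, hr.2⟩, e]; ring
  · intro x hx y hy hxy
    have := mono_right (f := λr - w r) (f' := λr - rH g r) hxy h.cw.neg.continuousOn
      (λh (hRL' r ⟨hx.1.trans_lt hr.1, hr.2.trans_le hy.2⟩).neg.hasDerivWithinAt) (λh by linarith [hn r ⟨hx.1.trans_lt hr.1, hr.2.trans_le hy.2⟩])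
    simp only [neg_le_neg_iff] at this; exact this
  · let z : ℝ → ℝ := λr a*exp (-(r-ρ))
    have hz : ∀ r, HasDerivAt z (- z r) r := λr
      (((((hasDerivAt_id r).sub_const ρ).neg).exp).const_mul a).congr_deriv (by simp only [z, id, Pi.neg_apply]; ring)
    have hzc : Continuous z := by simp only [z]; fun_prop
    have hcw := h.cw
    have := cmpr hρ0.le hρR (w := λr (w r-U)-z r) (w1 := λr (rH g r+0/r)-(- z r)) (f := λr Wf a m b (w r)-(z r+(- z r)/r)) (by fun_prop)
      (RL.sub (w := λr w r-U) (λh ⟨(Rout r hr).1.sub_const U, (Rout r hr).2⟩) (RL_of (λR hz r) (λR (hz r).neg.congr_deriv (neg_neg _)) (λR rfl)))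
      (Or.inl (by simp only [h.wρ, z, sub_self, neg_zero, exp_zero]; linarith)) (by simp only [h.wR, z, sub_self]; have := exp_pos (-(R-ρ)); have : 0 < a*exp (-(R-ρ)) := pv; linarith)
      (fun r hr h1 => by
        have h2 := H.W_ge le_rfl (h.bout r hI_).1
        rw [H.WU] at h2
        have hr0 := hρ0.trans hr.1
        have h3 : 0 ≤ z r/r := by simp only [z]; positivity
        have : -z r/r = - (z r/r) := by ring
        rw [this]; linarith)
    intro r hr
    have := this r hr
    simp only [z] at this; linarith

lemma PH.U0 (H : PH_) : 0 < U := by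
  have := H.h4; have := H.hb; have := H.hm; have : 0 < 4*m*b := pv
  linarith

lemma red_exists (H : PH_) : ∃ rI L0 d1 : ℝ, ∃ w w1 : ℝ → ℝ, Red a m b U rI L0 d1 w w1 := by
  have ha := H.ha
  have hU0 := H.U0
  have h5 := H.h5
  have h6 := H.h6
  have hB : 0 < RB a m b := by have := H.Wuf; have := H.ha; unfold RB; linarith
  obtain ⟨ε, hε, hε2, hlo⟩ := red_lo H
  obtain ⟨L, hL, hhi⟩ := red_hi H
  let R : ℕ → ℝ := λn 2*L+n
  have hRn : ∀ n, 2*L ≤ R n := by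
    intro n
    have h1 : (0:ℝ) ≤ (n:ℝ) := Nat.cast_nonneg n
    simp only [R]; linarith
  have hRh : ∀ n, L < R n := λn by linarith [hRn n]
  have key : ∀ n, ∃ w : ℝ → ℝ, ∃ ρ ∈ Icc ε L, ∃ A, RedR a m b U (R n) w ρ 0 A := by
    intro n
    obtain ⟨w, ρ, hρ, c, A, htri, h⟩ := red_fp H hε ll (hRh n)
    rcases htri with rfl | ⟨rfl, hc⟩ | ⟨rfl, hc⟩
    · exact ⟨w, ρ, hρ, A, h⟩
    · exact (hlo _ _ _ _ (by linarith [hRn n]) h hc).elim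
    · exact (hhi _ le_rfl _ _ _ _ (hRn n) h hc).elim
  choose w ρ hρ A hw using key
  have hρ0 : ∀ n, 0 < ρ n := λn hε.trans_le (hρ n).1
  have hρR : ∀ n, ρ n < R n := λn (hρ n).2.trans_lt (hRh n)
  have hm := λn (hw n).more H (hρ0 n) (hρR n) (hρ n).2
  have hRt : Tendsto R atTop atTop := tendsto_atTop_add_const_left _ _ tendsto_natCast_atTop_atTop
  have c0 : C4 (fun _ _ _ _ => 0) := by unfold C4; fun_prop
  obtain ⟨φ, hφ, u', v, rI, hrI, -, cv, hvI, hρl, hlim, heq⟩ := lim_R (B := RB a m b) (M := a) (K := RB a m b*L) c0 c0 (C4_RG1 a m b) (C4_RG2 a m b U)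
    (fun _ _ _ _ => by simpa using hB.le) (fun _ _ _ _ => by simpa using hB.le) H.bG1 H.bG2 hε hRt hRh (u := fun _ _ => 0) (v := w) hρ (λ_ continuous_const) (λn (hw n).cw)
    (λn (hw n).wρ) (λN by simp [sel, rJ, rH]) (λn (hm n).1) (λN by simpa using ha.le) (λn (hm n).2.1)
    (fun n r hr s hs => by simp only [sub_self, abs_zero]; exact mul_nonneg (mul_nonneg hB.le ll) (abs_nonneg _)) (λn (hm n).2.2.1)
  have hrI0 : 0 < rI := hε.trans_le hrI.1
  have hvl : ∀ r, 0 ≤ r → Tendsto (λn w (φ n) r) atTop (nhds (v r)) := λh (hlim r hr).2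
  have evR : ∀ r, ∀ᶠ n in atTop, r ≤ R (φ n) := λr (hRt.comp hφ.tendsto_atTop).eventually_ge_atTop r
  have hin : ∀ r ∈ Icc 0 rI, b9 ≤ v r ∧ v r ≤ a := by
    intro r hr
    rcases hr.2.eq_or_lt with rfl | h1
    · rw [hvI]; exact ⟨le_rfl, h6.le⟩
    · have ev : ∀ᶠ n in atTop, r < ρ (φ n) := hρl.eventually (lt_mem_nhds h1)
      exact ⟨ge_of_tendsto (hvl r hr.1) (by filter_upwards [ev] with n hn using ((hw _).bin r ⟨hr.1, hn.le⟩).1),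
        le_of_tendsto (hvl r hr.1) (by filter_upwards [ev] with n hn using ((hw _).bin r ⟨hr.1, hn.le⟩).2)⟩
  have hout : ∀ r, rI ≤ r → U ≤ v r ∧ v r ≤ b9 ∧ v r ≤ U+a*exp (-(r-rI)) := by
    intro r hr
    rcases hr.eq_or_lt with rfl | h1
    · rw [hvI]; simp; constructor <;> linarith
    · have ev : ∀ᶠ n in atTop, ρ (φ n) < r := hρl.eventually (gt_mem_nhds h1)
      have hr0 := hrI0.le.trans hr
      refine ⟨ge_of_tendsto (hvl r hr0) (by filter_upwards [ev, evR r] with n hn hn2 using ((hw _).bout r ⟨hn.le, hn2⟩).1),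
        le_of_tendsto (hvl r hr0) (by filter_upwards [ev, evR r] with n hn hn2 using ((hw _).bout r ⟨hn.le, hn2⟩).2), ?_⟩
      have hl2 : Tendsto (λn U+a*exp (-(r-ρ (φ n)))) atTop (nhds (U+a*exp (-(r-rI)))) := by
        have : Continuous (fun x : ℝ => U+a*exp (-(r-x))) := by fun_prop
        exact (this.tendsto rI).comp hρl
      exact le_of_tendsto_of_tendsto (hvl r hr0) hl2 (by filter_upwards [ev, evR r] with n hn hn2 using (hm _).2.2.2.2 r ⟨hn.le, hn2⟩)
  have hanti : ∀ x y, 0 ≤ x → x ≤ y → v y ≤ v x := by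
    intro x y hx hxy
    refine le_of_tendsto_of_tendsto (hvl y (hx.trans hxy)) (hvl x hx) ?_
    filter_upwards [evR y] with n hn using (hm _).2.2.2.1 x ⟨hx, hxy.trans hn⟩ y ⟨hx.trans hxy, hn⟩ hxy
  have hlip : ∀ x y, 0 ≤ x → 0 ≤ y → |v x-v y| ≤ RB a m b*L * |x-y| := by
    intro x y hx hy
    refine le_of_tendsto ((hvl x hx).sub (hvl y hy)).abs ?_
    filter_upwards [evR x, evR y] with n hn hn2 using (hm _).2.2.1 x ⟨hx, hn⟩ y ⟨hy, hn2⟩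
  set g : ℝ → ℝ := λt sel (RG1 a m b) (RG2 a m b U) rI t 0 (v t) with hg
  have mg : Measurable g := sel_meas (C4_RG1 a m b) (C4_RG2 a m b U) rI measurable_const cv.measurable
  have bg : ∀ t, |g t| ≤ RB a m b := λt sel_bd H.bG1 H.bG2 _ _ _ _
  have rg : ∀ t, ContinuousWithinAt g (Ici t) t := λt sel_rc (C4_RG1 a m b) (C4_RG2 a m b U) rI (u := λ_ 0) continuous_const cv t
  have he : ∀ r, 0 ≤ r → v r = v 0+rJ g r := λh (heq r hr).2
  have hge : ∀ r, 0 ≤ r → g r = if r < rI then v r-a else Wf a m b (v r) := by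
    intro r hr
    rw [hg]; simp only [sel, RG1, RG2]
    split_ifs with h1
    · have := hin r ⟨hr, h1.le⟩
      rw [cl_id ⟨this.1, mA this.2⟩]
    · have := hout r (not_lt.1 h1)
      rw [cl_id ⟨this.1, this.2.1⟩, sub_self, cl_id (by norm_num), add_zero]
  have hRL : ∀ R, RL 0 R v (rH g) (λr if r < rI then v r-a else Wf a m b (v r)) := fun R =>
    (sol_RL mg bg le_rfl rg (A := v 0) (c := 0) (w := v) (q := R) (λh by rw [he r hr.1.le]; ring)).congr (λR by simp) (λh hge r hr.1.le)
  have Z := sol_zero mg bg hrI0 (λh he r hr.1)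
  have hdv : ∀ r > 0, HasDerivAt v (rH g r) r := λh (hRL (r+1) r ⟨hr, ll⟩).1
  set d0 := a-b9 with hd0
  have hd : 0 < d0 := ll
  let z : ℝ → ℝ := λr d0*exp ((r^2-rI^2)/4)
  let z1 : ℝ → ℝ := λr z r*(r/2)
  have hz : ∀ r, HasDerivAt z (z1 r) r := λr by
    have : HasDerivAt (fun r : ℝ => (r^2-rI^2)/4) (r/2) r :=
      (((hasDerivAt_pow 2 r).sub_const (rI^2)).div_const 4).congr_deriv (by norm_num; ring)
    exact (this.exp.const_mul d0).congr_deriv (by simp only [z1, z]; ring)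
  have hz1 : ∀ r, HasDerivAt z1 (z1 r*(r/2)+z r*(1/2)) r := λr
    ((hz r).mul ((hasDerivAt_id r).div_const 2)).congr_deriv (by simp)
  have hzc : Continuous z := continuous_iff_continuousAt.2 λr (hz r).continuousAt
  have hzp : ∀ r, 0 < z r := λr by simp only [z]; positivity
  have hcmp := cmpr le_rfl hrI0 (w := λr z r-(a-v r)) (w1 := λr z1 r-(- rH g r))
    (f := λr (z1 r*(r/2)+z r*(1/2)+z1 r/r)-(-(if r < rI then v r-a else Wf a m b (v r)))) (by fun_prop)
    (RL.sub (RL_of (λR hz r) (λR hz1 r) (fun _ _ => rfl))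
      (z := λr a-v r) (λh ⟨(hdv r hr.1).const_sub a, ((hRL rI).neg r hr).2⟩))
    (Or.inr ⟨z1 0 - -0, by simp [z1], (hz 0).hasDerivWithinAt.sub (Z.const_sub a)⟩)
    (by simp only [hvI, z, sub_self, zero_div, exp_zero]; linarith only [hd0])
    (fun r hr h1 => by
      rw [if_pos hr.2]
      have hr0 := hr.1
      have e : z1 r*(r/2)+z r*(1/2)+z1 r/r = z r+z r*(r^2/4) := by simp only [z1]; field_simp; ring
      have : 0 < z r*(r^2/4) := mul_pos (hzp r) pv
      rw [e]; linarith only [h1, this])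
  set d1 := d0*exp (-(rI^2/4)) with hd1
  have hd10 : 0 < d1 := pv
  have hin2 : ∀ r ∈ Icc 0 rI, v r ≤ a-d1 := by
    intro r hr
    have h1 := hcmp r hr
    have h2 : d1 ≤ z r := by
      simp only [z, hd1]; gcongr; nlinarith [sq_nonneg r]
    exact lB h1 h2
  refine ⟨rI, RB a m b*L, d1, v, rH g, hrI0, hd10, cv, λh (rH_cont mg bg hr).continuousWithinAt, hRL, Z, hvI, hanti, ?_,
    λh ⟨(hin r hr).1, hin2 r hr⟩, hout, ?_, ?_⟩
  · intro r hr
    have := right_slope (hdv r hr).neg (e := r+1) ll (fun s hs => by simp only [Pi.neg_apply]; linarith only [hanti r s hr.le hs.1.le, hr])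
    linarith
  · intro r hr
    have hh : 0 ≤ RB a m b*L := mul_nonneg hB.le ll
    rw [abs_le]; constructor
    · have := right_slope ((hdv r hr).add ((hasDerivAt_id r).const_mul (RB a m b*L))) (e := r+1) ll (fun s hs => by
        have h1 := (abs_le.1 (hlip s r (hr.le.trans hs.1.le) hr.le)).1
        rw [abs_of_pos (sub_pos.2 hs.1)] at h1
        simp only [Pi.add_apply, id]; linarith)
      linarith
    · have := right_slope (((hasDerivAt_id r).const_mul (RB a m b*L)).sub (hdv r hr)) (e := r+1) ll (fun s hs => by
        have h1 := (abs_le.1 (hlip s r (hr.le.trans hs.1.le) hr.le)).2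
        rw [abs_of_pos (sub_pos.2 hs.1)] at h1
        simp only [Pi.sub_apply, id]; linarith)
      linarith
  · intro r hr
    refine rH_le mg bg hr.1 (fun t ht => ?_)
    rw [hge t ht.1.le, if_pos (ht.2.trans_le hr.2)]
    linarith [hin2 t ⟨ht.1.le, (ht.2.trans_le hr.2).le⟩]

noncomputable def hf (m b u v : ℝ) : ℝ := m*v-u*v^2*(1-b*v)

lemma bar_in {E1 E2 u : ℝ} (hb : 0 < b) (hm : 4*k^2 = m) (hs : 0 < s) (hs3 : s ≤ 1/3) (hτ : τ ≤ 1)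
    (hu : u ≤ b9+e) (h1 : s*e ≤ E1) (hE1 : 0 ≤ E1) (h2 : s*(1-τ) ≤ E2) (hq : 0 ≤ q)
    (hS : E1/b+2*q+4*k^2*E2 ≤ m/36) :
    k^2*(s*(1-2*s)*(1-4*s))*τ+2*(s*(1-2*s))*q ≤ s*(m-u/b*(s*(1-s))) := by
  have hk : 0 ≤ k^2 := sq_nonneg k
  have a1 : k^2*((1-2*s)*(1-4*s))*τ ≤ k^2*((1-2*s)*(1-4*s))+4*k^2*E2 := by
    have h3 : (1-2*s)*(4*s-1) ≤ 4*s := by nlinarith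
    have h4 : (1-2*s)*(4*s-1)*(1-τ) ≤ 4*s*(1-τ) := mR h3 ll
    have h5 : k^2*((1-2*s)*(4*s-1)*(1-τ)) ≤ k^2*(4*E2) := mL ll hk
    linarith
  have a2 : 2*(1-2*s)*q ≤ 2*q := by nlinarith
  have a3 : u/b*(s*(1-s)) ≤ 9*m/2*(s*(1-s))+E1/b := by
    have h3 : u/b ≤ (b9+e)/b := by gcongr
    have h4 : (b9+e)/b = 9*m/2+e/b := by field_simp
    have h5 : 0 ≤ s*(1-s) := mul_nonneg hs.le lB hs hs3
    have h6 : u/b*(s*(1-s)) ≤ (9*m/2+e/b)*(s*(1-s)) := mR lB h3 h4 h5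
    have h7 : (s*e)/b*(1-s) ≤ E1/b*(1-s) := mR (by gcongr) lB hs hs3
    have h8 : E1/b*(1-s) ≤ E1/b*1 := mL lA hs pv
    have h9 : e/b*(s*(1-s)) = (s*e)/b*(1-s) := by ring
    exact lD h6 h7 h8 h9
  have a4 : k^2*((1-2*s)*(1-4*s))+9*m/2*(s*(1-s))+m/36 ≤ m := by
    have h3 : 0 ≤ (1/3-s)*(13/6-5/2*s) := mul_nonneg lA hs3 lB hs hs3
    have h4 : 0 ≤ m*((1/3-s)*(13/6-5/2*s)) := mul_nonneg lB hm hk h3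
    have h5 : k^2 = m/4 := lA hm
    rw [h5]; exact lA h4
  have a5 : 0 ≤ s*(m-u/b*(s*(1-s))-(k^2*((1-2*s)*(1-4*s))*τ+2*(1-2*s)*q)) :=
    mul_nonneg hs.le lE hS a1 a2 a3 a4
  exact lA a5

lemma bar_aux (hσ : 1/12 ≤ σ) (hσ4 : σ ≤ 1/4) :
    (1/4+σ)*(20*(-(3*(σ-1/12))*(5/8-3/2*σ))+1/400) ≤ σ*(1-4*σ)*(1-8*σ) := by
  have hd : 0 ≤ σ-1/12 := ll
  rcases le_total σ (1/10) with h | h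
  · have c1 : 0 ≤ (σ-1/12)*(5/8-3/2*σ) := mul_nonneg hd ll
    have c2 : (1/4+σ)*(20*(-(3*(σ-1/12))*(5/8-3/2*σ))+1/400) ≤ 1/800 := by
      have c0 := mul_nonneg (show 0 ≤ 1/4+σ from lA hσ) c1
      have e3 : (1/4+σ)*(20*(-(3*(σ-1/12))*(5/8-3/2*σ))+1/400) = -60*((1/4+σ)*((σ-1/12)*(5/8-3/2*σ)))+(1/4+σ)/400 := by ring
      exact lB hσ4 c0
    have c3 : 1/20 ≤ σ*(1-4*σ) := by
      have := mul_nonneg hd (show 0 ≤ 1/10-σ from lA h)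
      exact lC h c1 this
    have c4 : 1/20*(1/5) ≤ σ*(1-4*σ)*(1-8*σ) := mul_le_mul c3 lA h (by norm_num) lC hσ4 h c1
    exact lC hσ c1 c2
  · have c1 : (1/60)*(1/4) ≤ (σ-1/12)*(5/8-3/2*σ) := mul_le_mul ll ll (by norm_num) hd
    rcases le_total σ (1/8) with h8 | h8
    · have c2 : (1/4+σ)*(20*(-(3*(σ-1/12))*(5/8-3/2*σ))+1/400) ≤ 0 :=
        mul_nonpos_of_nonneg_of_nonpos lA h lA c1
      have c3 : 0 ≤ σ*(1-4*σ)*(1-8*σ) := mul_nonneg (mul_nonneg lA h lA hσ4) lA h8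
      exact lC h c1 c2
    · have d1 : (1/24)*(1/4) ≤ (σ-1/12)*(5/8-3/2*σ) := mul_le_mul lA h8 lA hσ4 (by norm_num) hd
      have c2 : (3/8)*(5/8-1/400) ≤ (1/4+σ)*(60*((σ-1/12)*(5/8-3/2*σ))-1/400) :=
        mul_le_mul lA h8 lA d1 (by norm_num) lA h8
      have c3 : σ*(1-4*σ) ≤ 1/16 := by nlinarith [sq_nonneg (σ-1/8)]
      have c4 : σ*(1-4*σ)*(8*σ-1) ≤ 1/16*1 := mul_le_mul c3 lA hσ4 lA h8 (by norm_num)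
      exact lC h8 d1 c2

lemma bar_out1 {u : ℝ} (hb : 0 < b) (hm : 20*k^2 = m) (hσ : 1/12 ≤ σ) (hσ4 : σ ≤ 1/4)
    (hu : b9-e ≤ u) (he : 0 ≤ e) (he2 : e/b ≤ k^2/100) :
    (1/4+σ)*(m-u/b*((1/4+σ)*(3/4-σ))) ≤ k^2*(σ*(1-4*σ)*(1-8*σ)) := by
  have hk : 0 ≤ k^2 := sq_nonneg k
  set p := (1/4+σ)*(3/4-σ) with hp
  have hp0 : 0 ≤ p := mul_nonneg lA hσ lA hσ4
  have hp1 : p ≤ 1/4 := by rw [hp]; nlinarith [sq_nonneg (1/4-σ)]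
  have a1 : (9*m/2-e/b)*p ≤ u/b*p := by
    apply mR _ hp0
    rw [le_div_iff₀ hb]
    have : (9*m/2-e/b)*b = b9-e := by field_simp
    exact lB hu this
  have a2 : e/b*p ≤ e/b*(1/4) := mL hp1 pv
  have a3 : m-u/b*p ≤ 20*k^2*(1-9/2*p)+k^2/400 := by rw [hm]; exact lC he2 a1 a2
  have a4 : (1/4+σ)*(m-u/b*p) ≤ (1/4+σ)*(k^2*(20*(1-9/2*p)+1/400)) := mL lA a3 lA hσ
  refine a4.trans ?_
  have e1 : (1/4+σ)*(k^2*(20*(1-9/2*p)+1/400)) = k^2*((1/4+σ)*(20*(1-9/2*p)+1/400)) := by ring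
  rw [e1]
  refine mL ?_ hk
  have e2 : 1-9/2*p = -(3*(σ-1/12))*(5/8-3/2*σ) := by rw [hp]; ring
  rw [e2]
  exact bar_aux hσ hσ4

lemma bar_out2 {u : ℝ} (hσ : 1/12 ≤ σ) (hσ4 : σ ≤ 1/4) (hb : 0 < b)
    (hu : x ≤ u) (hx0 : 0 ≤ x) (hx : x/(4*b)-m = κ) (hκ : 0 ≤ κ) (hy : x/b ≤ y)
    (ht : y*(1-4*σ)+k^2*(1-4*σ) ≤ κ/3) :
    (1/4+σ)*(m-u/b*((1/4+σ)*(3/4-σ))) ≤ k^2*(σ*(1-4*σ)*(1-8*σ)) := by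
  have hk : 0 ≤ k^2 := sq_nonneg k
  set p := (1/4+σ)*(3/4-σ) with hp
  have hp0 : 0 ≤ p := mul_nonneg lA hσ lA hσ4
  have e : p = 1/4-(1-4*σ)^2/16 := by rw [hp]; ring
  set τ := 1-4*σ with hτ
  have hτ0 : 0 ≤ τ := lA hσ4
  have hτ1 : τ ≤ 1 := lA hσ
  have a1 : x/b*p ≤ u/b*p := mR (by gcongr) hp0
  have a2 : x/b*p = κ+m-x/b*τ^2/16 := by rw [e, ← hx]; field_simp; ring
  have hxb : 0 ≤ x/b := pv
  have hy0 : 0 ≤ y := lB hy hxb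
  have a3 : x/b*τ^2 ≤ y*τ := by
    have : τ^2 ≤ τ := by nlinarith
    exact mul_le_mul hy this (sq_nonneg τ) hy0
  have hyt : 0 ≤ y*τ := pv
  have hkt : 0 ≤ k^2*τ := pv
  have a4 : m-u/b*p ≤ - κ+y*τ/16 := lC a1 a2 a3
  have a5 : (1/4+σ)*(m-u/b*p) ≤ (1/4+σ)*(-κ+y*τ/16) := mL a4 lA hσ
  have a6 : (1/4+σ)*κ ≥ 1/3*κ := mR lA hσ hκ
  have a7 : (1/4+σ)*(y*τ/16) ≤ 1*(y*τ/16) := mR lA hσ4 pv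
  have a8 : -(k^2*τ) ≤ k^2*(σ*τ*(1-8*σ)) := by
    have h1 : -1 ≤ σ*(1-8*σ) := by nlinarith
    have := mL h1 hkt
    exact lA this
  linarith

noncomputable def sB (k P δ ρ t : ℝ) : ℝ := 1/(2+exp (-(k*(t^2-ρ^2)/(2*P*δ))))
noncomputable def sA (k δ ρ t : ℝ) : ℝ := 1/(4+8*exp (-(k*(t-ρ)/δ)))

lemma sB_deriv (hP : 0 < P) (hδ : 0 < δ) (t : ℝ) :
    HasDerivAt (sB k P δ ρ) (k*(sB k P δ ρ t*(1-2*sB k P δ ρ t))*(t/(P*δ))) t := by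
  have h1 : HasDerivAt (fun t : ℝ => -(k*(t^2-ρ^2)/(2*P*δ))) (-(k*(2*t)/(2*P*δ))) t := by
    have := ((((hasDerivAt_id t).pow 2).sub_const (ρ^2)).const_mul k).div_const (2*P*δ)
    exact this.neg.congr_deriv (by simp)
  have h2 := (h1.exp.const_add 2)
  have hp : 0 < 2+exp (-(k*(t^2-ρ^2)/(2*P*δ))) := pv
  have h3 := (hasDerivAt_const t (1:ℝ)).div h2 hp.ne'
  refine h3.congr_deriv ?_
  unfold sB
  field_simp
  ring

lemma sA_deriv (hδ : 0 < δ) (t : ℝ) :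
    HasDerivAt (sA k δ ρ) (k*(sA k δ ρ t*(1-4*sA k δ ρ t))/δ) t := by
  have h1 : HasDerivAt (fun t : ℝ => -(k*(t-ρ)/δ)) (-(k/δ)) t := by
    have := (((hasDerivAt_id t).sub_const ρ).const_mul k).div_const δ
    exact this.neg.congr_deriv (by simp)
  have h2 := ((h1.exp.const_mul 8).const_add 4)
  have hp : 0 < 4+8*exp (-(k*(t-ρ)/δ)) := pv
  have h3 := (hasDerivAt_const t (1:ℝ)).div h2 hp.ne'
  refine h3.congr_deriv ?_
  unfold sA
  field_simp
  ring

lemma sB_RL (hP : 0 < P) (hδ : 0 < δ) (hp : 0 ≤ p) :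
    RL p q (sB k P δ ρ) (λt k*(sB k P δ ρ t*(1-2*sB k P δ ρ t))*(t/(P*δ)))
     (λt (k^2*(sB k P δ ρ t*(1-2*sB k P δ ρ t)*(1-4*sB k P δ ρ t))*(t/P)^2
        + 2*(sB k P δ ρ t*(1-2*sB k P δ ρ t))*(k*δ/P))/δ^2) := by
  refine RL_of (fun t _ => sB_deriv hP hδ t) (fun t _ => ?_) (w2 := λt (k^2*(sB k P δ ρ t*(1-2*sB k P δ ρ t)*(1-4*sB k P δ ρ t))*(t/P)^2
        + (sB k P δ ρ t*(1-2*sB k P δ ρ t))*(k*δ/P))/δ^2) (fun t ht => ?_)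
  · have h := sB_deriv (k := k) (ρ := ρ) hP hδ t
    have h2 := ((h.mul ((h.const_mul 2).const_sub 1)).const_mul k).mul ((hasDerivAt_id t).div_const (P*δ))
    refine h2.congr_deriv ?_
    simp only [id, Pi.mul_apply]
    field_simp
    ring
  · have : t ≠ 0 := mA ht.1
    field_simp
    ring

lemma sA_RL (hδ : 0 < δ) :
    RL p q (sA k δ ρ) (λt k*(sA k δ ρ t*(1-4*sA k δ ρ t))/δ)
     (λt k^2*(sA k δ ρ t*(1-4*sA k δ ρ t)*(1-8*sA k δ ρ t))/δ^2+(k*(sA k δ ρ t*(1-4*sA k δ ρ t))/δ)/t) := by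
  refine RL_of (fun t _ => sA_deriv hδ t) (fun t _ => ?_) (w2 := λt k^2*(sA k δ ρ t*(1-4*sA k δ ρ t)*(1-8*sA k δ ρ t))/δ^2) (fun t ht => rfl)
  have h := sA_deriv (k := k) (ρ := ρ) hδ t
  have h2 := ((h.mul ((h.const_mul 4).const_sub 1)).const_mul k).div_const δ
  refine h2.congr_deriv ?_
  field_simp
  ring

lemma sB_cont : Continuous (fun p : ℝ × ℝ => sB k P δ p.1 p.2) := by
  unfold sB
  refine continuous_const.div (by fun_prop) (fun p => pv)

lemma sA_cont : Continuous (fun p : ℝ × ℝ => sA k δ p.1 p.2) := by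
  unfold sA
  refine continuous_const.div (by fun_prop) (fun p => pv)

lemma sB_pos : 0 < sB k P δ ρ t := by unfold sB; positivity
lemma sB_lt : sB k P δ ρ t ≤ 1 := by
  unfold sB
  rw [div_le_one pv]
  linarith [exp_pos (-(k*(t^2-ρ^2)/(2*P*δ)))]
lemma sA_pos : 0 < sA k δ ρ t := by unfold sA; positivity
lemma sA_lt : sA k δ ρ t ≤ 1/4 := by
  unfold sA
  apply one_div_le_one_div_of_le (by norm_num)
  linarith [exp_pos (-(k*(t-ρ)/δ))]
lemma sB_ρ : sB k P δ ρ ρ = 1/3 := by unfold sB; norm_num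
lemma sA_ρ : sA k δ ρ ρ = 1/12 := by unfold sA; norm_num

lemma sB_in (hk : 0 < k) (hP : 0 < P) (hδ : 0 < δ) (h0 : 0 ≤ t) (ht : t ≤ ρ) (hρ : P/2 ≤ ρ) :
    sB k P δ ρ t ≤ 1/3 ∧ sB k P δ ρ t ≤ exp (-(k/4*(ρ-t)/δ)) := by
  have h1 : k*(ρ-t)/(4*δ) ≤ -(k*(t^2-ρ^2)/(2*P*δ)) := by
    rw [← neg_div, div_le_div_iff₀ pv pv]
    have e1 : (ρ-t)*P ≤ (ρ-t)*(2*(ρ+t)) := mL ll ll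
    linarith [mL e1 (show 0 ≤ 2*k*δ from pv)]
  have h2 : 0 ≤ k*(ρ-t)/(4*δ) := by have : 0 ≤ ρ-t := ll; positivity
  constructor
  · unfold sB
    apply one_div_le_one_div_of_le (by norm_num)
    linarith [one_le_exp (h2.trans h1)]
  · have e : k/4*(ρ-t)/δ = k*(ρ-t)/(4*δ) := by field_simp
    rw [e, exp_neg, ← one_div]
    unfold sB
    apply one_div_le_one_div_of_le (exp_pos _)
    linarith [exp_le_exp.2 h1]

lemma sA_out (hk : 0 < k) (hδ : 0 < δ) (ht : ρ ≤ t) :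
    1/12 ≤ sA k δ ρ t ∧ 1-4*sA k δ ρ t ≤ 2*exp (-(k*(t-ρ)/δ)) := by
  have h2 : 0 ≤ k*(t-ρ)/δ := by have : 0 ≤ t-ρ := ll; positivity
  have h3 : exp (-(k*(t-ρ)/δ)) ≤ 1 := exp_le_one_iff.2 ll
  have h4 := exp_pos (-(k*(t-ρ)/δ))
  constructor
  · unfold sA
    apply one_div_le_one_div_of_le pv
    linarith
  · unfold sA
    have e : 1-4*(1/(4+8*exp (-(k*(t-ρ)/δ)))) = 2*exp (-(k*(t-ρ)/δ))*(4/(4+8*exp (-(k*(t-ρ)/δ)))) := by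
      field_simp; ring
    rw [e]
    apply mul_le_of_le_one_right pv
    rw [div_le_one pv]
    linarith

lemma xexp (hc : 0 < c) : x*exp (-(c*x)) ≤ 1/c := by
  have h1 := add_one_le_exp (c*x)
  have h2 : c*x*exp (-(c*x)) ≤ exp (c*x)*exp (-(c*x)) := mR ll (exp_pos _).le
  rw [← exp_add, add_neg_cancel, exp_zero] at h2
  rw [le_div_iff₀ hc]; linarith

noncomputable def FFc (a b x y : ℝ) : ℝ := cl 0 (2*a) x*(1+(cl 0 (1/b) y)^2)-a
noncomputable def GGc (a m b δ x y : ℝ) : ℝ := hf m b (cl 0 (2*a) x) (cl 0 (1/b) y)/δ^2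

noncomputable def FG1 (m b η δ k P : ℝ) (w : ℝ → ℝ) (p t x y : ℝ) : ℝ :=
  (hf m b (cl (w |t| - η) (w |t| + η) x) (cl 0 (sB k P δ p t/b) y)+cl (-1) 1 (y-cl 0 (sB k P δ p t/b) y))/δ^2
noncomputable def FG2 (m b η δ k : ℝ) (w : ℝ → ℝ) (p t x y : ℝ) : ℝ :=
  (hf m b (cl (w |t| - η) (w |t| + η) x) (cl ((1/4+sA k δ p t)/b) (1/b) y)+cl (-1) 1 (y-cl ((1/4+sA k δ p t)/b) (1/b) y))/δ^2

lemma rJ_congr (hr : 0 ≤ r) (h : ∀ t ∈ Icc 0 r, f t = g t) : rJ f r = rJ g r := by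
  unfold rJ
  apply intervalIntegral.integral_congr
  intro s hs
  rw [uIcc_of_le hr] at hs
  unfold rH
  congr 1
  apply intervalIntegral.integral_congr
  intro t ht
  rw [uIcc_of_le hs.1] at ht
  simp only
  rw [h t ⟨ht.1, ht.2.trans hs.2⟩]

lemma cl_cont4 {lo hi x : ℝ × ℝ × ℝ × ℝ → ℝ} (h1 : Continuous lo) (h2 : Continuous hi) (h3 : Continuous x) :
    Continuous (fun p => cl (lo p) (hi p) (x p)) := by
  unfold cl; exact h1.max (h2.min h3)

lemma hf_cont4 {x y : ℝ × ℝ × ℝ × ℝ → ℝ} (h1 : Continuous x) (h2 : Continuous y) : Continuous (fun p => hf m b (x p) (y p)) := by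
  unfold hf; fun_prop

lemma FF_C4 (a b : ℝ) : C4 (fun _ _ x y => FFc a b x y) := by
  unfold C4 FFc
  have h1 := cl_cont4 (lo := λ_ 0) (hi := λ_ 2*a) (x := fun p => p.2.2.1) continuous_const continuous_const (by fun_prop)
  have h2 := cl_cont4 (lo := λ_ 0) (hi := λ_ 1/b) (x := fun p => p.2.2.2) continuous_const continuous_const (by fun_prop)
  fun_prop

lemma GG_C4 (a m b δ : ℝ) : C4 (fun _ _ x y => GGc a m b δ x y) := by
  unfold C4 GGc
  have h1 := cl_cont4 (lo := λ_ 0) (hi := λ_ 2*a) (x := fun p => p.2.2.1) continuous_const continuous_const (by fun_prop)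
  have h2 := cl_cont4 (lo := λ_ 0) (hi := λ_ 1/b) (x := fun p => p.2.2.2) continuous_const continuous_const (by fun_prop)
  exact (hf_cont4 h1 h2).div_const _

lemma FG1_C4 (cw : Continuous w) : C4 (FG1 m b η δ k P w) := by
  unfold C4 FG1
  have hs : Continuous (fun p : ℝ × ℝ × ℝ × ℝ => sB k P δ p.1 p.2.1/b) := (sB_cont.comp (show Continuous (fun p : ℝ × ℝ × ℝ × ℝ => (p.1, p.2.1)) by fun_prop)).div_const b
  have h1 := cl_cont4 (lo := fun p => w |p.2.1| - η) (hi := fun p => w |p.2.1| + η) (x := fun p => p.2.2.1) (by fun_prop) (by fun_prop) (by fun_prop)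
  have h2 := cl_cont4 (lo := λ_ 0) (hi := fun p => sB k P δ p.1 p.2.1/b) (x := fun p => p.2.2.2) continuous_const hs (by fun_prop)
  have h3 := cl_cont4 (lo := λ_ -1) (hi := λ_ 1) (x := fun p => p.2.2.2-cl 0 (sB k P δ p.1 p.2.1/b) p.2.2.2) continuous_const continuous_const (by fun_prop)
  exact ((hf_cont4 h1 h2).add h3).div_const _

lemma FG2_C4 (cw : Continuous w) : C4 (FG2 m b η δ k w) := by
  unfold C4 FG2
  have hs : Continuous (fun p : ℝ × ℝ × ℝ × ℝ => (1/4+sA k δ p.1 p.2.1)/b) := ((sA_cont.comp (show Continuous (fun p : ℝ × ℝ × ℝ × ℝ => (p.1, p.2.1)) by fun_prop)).const_add _).div_const b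
  have h1 := cl_cont4 (lo := fun p => w |p.2.1| - η) (hi := fun p => w |p.2.1| + η) (x := fun p => p.2.2.1) (by fun_prop) (by fun_prop) (by fun_prop)
  have h2 := cl_cont4 (lo := fun p => (1/4+sA k δ p.1 p.2.1)/b) (hi := λ_ 1/b) (x := fun p => p.2.2.2) hs continuous_const (by fun_prop)
  have h3 := cl_cont4 (lo := λ_ -1) (hi := λ_ 1) (x := fun p => p.2.2.2-cl ((1/4+sA k δ p.1 p.2.1)/b) (1/b) p.2.2.2) continuous_const continuous_const (by fun_prop)
  exact ((hf_cont4 h1 h2).add h3).div_const _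

lemma hf_bd (hm : 0 < m) (hb : 0 < b) (hx : x ∈ Icc 0 (2*a)) (hy : y ∈ Icc 0 (1/b)) :
    |hf m b x y| ≤ m/b+2*a/b^2 := by
  obtain ⟨hx0, hx1⟩ := hx
  obtain ⟨hy0, hy1⟩ := hy
  have h1 : b*y ≤ 1 := by rw [le_div_iff₀ hb] at hy1; linarith
  have h2 : x*y^2*(1-b*y) ≤ 2*a/b^2 := by
    have e1 : y^2 ≤ (1/b)^2 := by gcongr
    have ha : 0 ≤ 2*a := hx0.trans hx1
    have e2 : x*y^2 ≤ 2*a*(1/b)^2 := by gcongr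
    have e3 : x*y^2*(1-b*y) ≤ x*y^2*1 := mL (by nlinarith) pv
    have e4 : 2*a*(1/b)^2 = 2*a/b^2 := by field_simp
    linarith
  have h3 : 0 ≤ x*y^2*(1-b*y) := mul_nonneg pv ll
  have h4 : m*y ≤ m/b := by
    have := mL hy1 hm.le
    rwa [mul_one_div] at this
  have h5 : 0 ≤ m*y := pv
  unfold hf
  rw [abs_le]; constructor <;> linarith

lemma FF_bd (ha : 0 < a) (hb : 0 < b) (x y : ℝ) : |FFc a b x y| ≤ 2*a*(1+(1/b)^2)+a := by
  have h1 := cl_mem (show (0:ℝ) ≤ 2*a from pv) x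
  have h2 := cl_mem (show (0:ℝ) ≤ 1/b from pv) y
  have h3 : (cl 0 (1/b) y)^2 ≤ (1/b)^2 := pow_le_pow_left₀ h2.1 h2.2 2
  have h4 : cl 0 (2*a) x*(1+(cl 0 (1/b) y)^2) ≤ 2*a*(1+(1/b)^2) :=
    mul_le_mul h1.2 ll pv pv
  have h5 : 0 ≤ cl 0 (2*a) x*(1+(cl 0 (1/b) y)^2) := mul_nonneg h1.1 pv
  unfold FFc
  rw [abs_le]; constructor <;> linarith

lemma GG_bd (ha : 0 < a) (hm : 0 < m) (hb : 0 < b) (hδ : 0 < δ) (x y : ℝ) : |GGc a m b δ x y| ≤ (m/b+2*a/b^2)/δ^2 := by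
  unfold GGc
  rw [abs_div, abs_of_pos (show 0 < δ^2 from pv)]
  gcongr
  exact hf_bd hm hb (cl_mem pv x) (cl_mem pv y)

lemma FG_bd {z v : ℝ} (hm : 0 < m) (hb : 0 < b) (hδ : 0 < δ) (hx : 0 ≤ lo) (hx2 : hi ≤ 2*a) (hlo : lo ≤ hi)
    (hy : y ∈ Icc 0 (1/b)) : |(hf m b (cl lo hi x) y+cl (-1) 1 (z-v))/δ^2| ≤ (m/b+2*a/b^2+1)/δ^2 := by
  rw [abs_div, abs_of_pos (show 0 < δ^2 from pv)]
  gcongr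
  have h1 := cl_mem hlo x
  have h2 := hf_bd hm hb (a := a) (x := cl lo hi x) ⟨hx.trans h1.1, h1.2.trans hx2⟩ hy
  have h3 : |cl (-1) 1 (z-v)| ≤ 1 := abs_le.2 (cl_mem (by norm_num) _)
  exact (abs_add_le _ _).trans (add_le_add h2 h3)

lemma Red.bd (H : PH_) (Hr : Red a m b U rI L0 d1 w w1) (ht : 0 ≤ t) : U ≤ w t ∧ w t ≤ a := by
  have h5 := H.h5
  have h6 := H.h6
  have := Hr.d10
  rcases le_total t rI with h | h
  · have := Hr.bin t ⟨ht, h⟩; constructor <;> linarith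
  · have := Hr.bout t h; constructor <;> linarith

lemma Red.lp (Hr : Red a m b U rI L0 d1 w w1) (hx : 0 ≤ x) (hxy : x ≤ y) : w x-w y ≤ L0*(y-x) := by
  have hd : ∀ r ∈ Ioo x y, HasDerivAt w (w1 r) r := λh (Hr.rl (y+1) r ⟨hx.trans_lt hr.1, mA hr.2⟩).1
  rcases eq_or_lt_of_le hxy with h | h
  · subst h; simp
  · obtain ⟨ξ, hξ, hs⟩ := exists_hasDerivAt_eq_slope w w1 h Hr.cw.continuousOn hd
    have h1 := Hr.lip ξ (hx.trans_lt hξ.1)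
    rw [hs, abs_le, le_div_iff₀ ll] at h1
    linarith [h1.1]

lemma Red.barI (H : PH_) (Hr : Red a m b U rI L0 d1 w w1)
    (hk : 0 < k) (hkm : 4*k^2 = m) (hη : 0 ≤ η) (hη2 : η ≤ b*m/72) (hδ : 0 < δ) (hN : 0 ≤ N) (h3 : 3*(N*δ) ≤ rI)
    (hρ : ρ ∈ Icc (rI-N*δ) (rI+N*δ)) (hL : 0 ≤ L0)
    (hsm : ((L0*N+4*L0/k)/b+2*k/rI+4*k^2*(2/rI*(2*N+4/k)))*δ ≤ m/72) {u : ℝ} (ht0 : 0 < t) (ht : t ≤ ρ) (hu : u ≤ w t+η) :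
    (k^2*(sB k (rI+N*δ) δ ρ t*(1-2*sB k (rI+N*δ) δ ρ t)*(1-4*sB k (rI+N*δ) δ ρ t))*(t/(rI+N*δ))^2
        + 2*(sB k (rI+N*δ) δ ρ t*(1-2*sB k (rI+N*δ) δ ρ t))*(k*δ/(rI+N*δ))) ≤ b*hf m b u (sB k (rI+N*δ) δ ρ t/b) := by
  have hb := H.hb
  have hrI := Hr.rI0
  have hNδ : 0 ≤ N*δ := pv
  set P := rI+N*δ with hP
  have hP0 : 0 < P := pv
  have hPr : rI ≤ P := ll
  set s := sB k P δ ρ t with hs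
  have hs0 : 0 < s := sB_pos
  obtain ⟨hs3, hse⟩ := sB_in hk hP0 hδ ht0.le ht mA hρ.1
  rw [← hs] at hs3 hse
  have hsx : s*(ρ-t) ≤ 4*δ/k := by
    have e1 := xexp (c := k/4/δ) (x := ρ-t) pv
    have e2 : k/4/δ*(ρ-t) = k/4*(ρ-t)/δ := by ring
    rw [e2] at e1
    have e3 : s*(ρ-t) ≤ exp (-(k/4*(ρ-t)/δ))*(ρ-t) := mR hse lA ht
    have e4 : 1/(k/4/δ) = 4*δ/k := by field_simp
    exact lC e1 e3 e4
  have hwt : w t ≤ b9+L0*(ρ-t+N*δ) := by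
    rcases le_total t rI with h | h
    · have e1 := Hr.lp ht0.le h
      rw [Hr.wI] at e1
      have e2 : L0*(rI-t) ≤ L0*(ρ-t+N*δ) := mL lA hρ.1 hL
      exact lB e1 e2
    · have e1 := (Hr.bout t h).2.1
      have e2 : 0 ≤ L0*(ρ-t+N*δ) := mul_nonneg hL ll
      exact lB e1 e2
  have hbar := bar_in (m := m) (b := b) (k := k) (s := s) (τ := (t/P)^2) (e := η+L0*(ρ-t+N*δ)) (E1 := η+L0*(N*δ)+L0*(4*δ/k))
    (E2 := 2/rI*(2*(N*δ)+4*δ/k)) (q := k*δ/P) (u := u) hb hkm hs0 hs3 (by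
      have : t/P ≤ 1 := by rw [div_le_one hP0]; exact lB hρ.2 ht
      exact pow_le_one₀ pv this) lB hu hwt (by
      have e1 : s*η ≤ 1*η := mR lB hs0 hs3 hη
      have e2 : s*(L0*(N*δ)) ≤ 1*(L0*(N*δ)) := mR lB hs0 hs3 pv
      have e3 := mL hsx hL
      linarith only [e1, e2, e3]) pv (by
      have e0 : 0 < t/P := pv
      have e1 : t/P ≤ 1 := by rw [div_le_one hP0]; exact lB hρ.2 ht
      have e2 : 1-(t/P)^2 ≤ 2*(1-t/P) := by nlinarith [sq_nonneg (1-t/P)]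
      have e3 : 1-t/P = (P-t)/P := by field_simp
      have e4 : s*(P-t) ≤ 2*(N*δ)+4*δ/k := by
        have e5 : s*(P-ρ) ≤ 1*(P-ρ) := mR lB hs0 hs3 lA hρ.2
        have e6 : P-ρ ≤ 2*(N*δ) := lA hρ.1
        exact lC hsx e5 e6
      calc s*(1-(t/P)^2) ≤ s*(2*(1-t/P)) := mL e2 hs0.le
        _ = 2/P*(s*(P-t)) := by rw [e3]; ring
        _ ≤ 2/P*(2*(N*δ)+4*δ/k) := mL e4 pv
        _ ≤ 2/rI*(2*(N*δ)+4*δ/k) := mR (by gcongr) pv) pv (by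
      have e1 : k*δ/P ≤ k*δ/rI := by gcongr
      have e2 : η/b ≤ m/72 := by rw [div_le_iff₀ hb]; exact lA hη2
      have e3 : (η+L0*(N*δ)+L0*(4*δ/k))/b+2*(k*δ/rI)+4*k^2*(2/rI*(2*(N*δ)+4*δ/k)) = η/b+((L0*N+4*L0/k)/b+2*k/rI+4*k^2*(2/rI*(2*N+4/k)))*δ := by
        field_simp; ring
      linarith only [hsm, e1, e2, e3])
  refine hbar.trans (le_of_eq ?_)
  unfold hf
  field_simp

lemma Red.barO (H : PH_) (Hr : Red a m b U rI L0 d1 w w1)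
    (hk : 0 < k) (hkm : 20*k^2 = m) (hη : 0 ≤ η) (hη2 : η ≤ b*m/4000) (hδ : 0 < δ) (hN : 0 ≤ N)
    (hρ : ρ ∈ Icc (rI-N*δ) (rI+N*δ)) (hρ0 : 0 < ρ) (hL : 0 ≤ L0) (hκ : (U-η)/(4*b)-m = κ) (hκ0 : 0 < κ)
    (hsm : L0*(|log (2/(κ/(3*(U/b+k^2))))|/k+N)/b*δ ≤ m/4000) {u : ℝ} (ht : ρ ≤ t) (hu : w t-η ≤ u) :
    b*hf m b u ((1/4+sA k δ ρ t)/b) ≤ k^2*(sA k δ ρ t*(1-4*sA k δ ρ t)*(1-8*sA k δ ρ t)) := by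
  have hb := H.hb
  have hm := H.hm
  have hU := H.U0
  have hrI := Hr.rI0
  have ht0 : 0 < t := hρ0.trans_le ht
  obtain ⟨h1, h2⟩ := sA_out hk hδ ht
  have h3 : sA k δ ρ t ≤ 1/4 := sA_lt
  set σ := sA k δ ρ t with hσ
  have e0 : b*hf m b u ((1/4+σ)/b) = (1/4+σ)*(m-u/b*((1/4+σ)*(3/4-σ))) := by
    unfold hf; field_simp; ring
  rw [e0]
  set τ0 := κ/(3*(U/b+k^2)) with hτ0
  have hτp : 0 < τ0 := pv
  rcases le_total (1-4*σ) τ0 with h | h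
  · refine bar_out2 (x := U-η) (y := U/b) (κ := κ) h1 h3 hb ?_ ?_ hκ hκ0.le (by gcongr; linarith only [hη]) ?_
    · linarith only [(Hr.bd H ht0.le).1, hu, ht0]
    · have : 0 < (U-η)/(4*b) := lC hκ hκ0 hm
      rw [div_pos_iff_of_pos_right pv] at this
      exact this.le
    · have : (U/b+k^2)*(1-4*σ) ≤ (U/b+k^2)*τ0 := mL h pv
      have e : (U/b+k^2)*τ0 = κ/3 := by rw [hτ0]; field_simp
      exact lB this e
  · set X := |log (2/τ0)|/k with hX
    have hX0 : 0 ≤ X := pv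
    have htX : t-ρ ≤ X*δ := by
      have e1 : τ0/2 ≤ exp (-(k*(t-ρ)/δ)) := lB h2 h
      have e2 := log_le_log pv e1
      rw [log_exp] at e2
      have e3 : log (2/τ0) = - log (τ0/2) := by rw [← log_inv, inv_div]
      have e4 : k*(t-ρ)/δ ≤ |log (2/τ0)| := by linarith only [le_abs_self (log (2/τ0)), e2, e3]
      rw [div_le_iff₀ hδ] at e4
      rw [hX, div_mul_eq_mul_div, le_div_iff₀ hk]; exact lA e4
    have hwt : b9-L0*((X+N)*δ) ≤ w t := by
      rcases le_total t rI with h5 | h5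
      · have e1 := (Hr.bin t ⟨ht0.le, h5⟩).1
        have e2 : 0 ≤ L0*((X+N)*δ) := pv
        exact lB e1 e2
      · have e1 := Hr.lp hrI.le h5
        rw [Hr.wI] at e1
        have e2 : L0*(t-rI) ≤ L0*((X+N)*δ) := mL lB hρ.2 htX hL
        exact lB e1 e2
    refine bar_out1 (e := η+L0*((X+N)*δ)) hb hkm h1 h3 lB hu hwt pv ?_
    have e1 : (η+L0*((X+N)*δ))/b = η/b+L0*(X+N)/b*δ := by field_simp
    have e2 : η/b ≤ m/4000 := by rw [div_le_iff₀ hb]; exact lA hη2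
    rw [e1]
    exact lC hkm hsm e2

structure FS (a m b U V η κ1 κ2 B0 δ R : ℝ) (w u u1 v v1 : ℝ → ℝ) (ρ c : ℝ) : Prop where
  cu : Continuous u
  cv : Continuous v
  cu1 : ContinuousOn u1 (Ioi 0)
  cv1 : ContinuousOn v1 (Ioi 0)
  uR : u R = U
  vR : v R = V
  vρ : v ρ = 1/(3*b)
  ub : ΛR 0 ≤ u r ∧ u r ≤ a
  vin : ∀ r ∈ Icc 0 ρ, 0 ≤ v r ∧ v r ≤ 1/(3*b) ∧ v r ≤ 1/b*exp (-(κ1*(ρ-r)/δ))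
  vout : ∀ r ∈ Icc ρ R, 1/(3*b) ≤ v r ∧ v r ≤ 1/b ∧ 1/2-exp (-(κ2*(r-ρ)/δ)) ≤ b*v r
  Ru : RL 0 R u u1 (λr u r*(1+(v r)^2)-a)
  Zu : HasDerivWithinAt u 0 (Ici 0) 0
  u1b : ∀ r > 0, |u1 r| ≤ B0*r
  u1n : ∀ r ∈ Ioo 0 R, (∀ t ∈ Ioo 0 r, u t*(1+(v t)^2) ≤ a) → u1 r ≤ 0
  Rin : RL 0 ρ v v1 (λr hf m b cη (v r)/δ^2)
  Rout : RL ρ R v (λr v1 r+c/r) (λr hf m b cη (v r)/δ^2)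
  s1 : 0 ≤ v1 ρ
  s2 : 0 ≤ v1 ρ+c/ρ
  v1b : ∃ B, ∀ r > 0, |v1 r| ≤ B*r
  eu : ΛR u r = u 0+rJ (λt FFc a b (u t) (v t)) r
  ev : c = 0 → (ΛR |u r-w r| ≤ η) → ΛR v r = v 0+rJ (λt GGc a m b δ (u t) (v t)) r

set_option maxHeartbeats 1600000 in
lemma FS_fix (H : PH_) (Hr : Red a m b U rI L0 d1 w w1)
    {k' : ℝ} (hk : 0 < k) (hkm : 4*k^2 = m) (hk' : 0 < k') (hkm' : 20*k'^2 = m) (hη : 0 < η) (hη2 : η ≤ b*m/4000)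
    (hδ : 0 < δ) (hN : 0 < N) (h3 : 3*(N*δ) ≤ rI) (hL : 0 ≤ L0)
    (hsm : ((L0*N+4*L0/k)/b+2*k/rI+4*k^2*(2/rI*(2*N+4/k)))*δ ≤ m/72) (hκ : (U-η)/(4*b)-m = κ) (hκ0 : 0 < κ)
    (hsm' : L0*(|log (2/(κ/(3*(U/b+k'^2))))|/k'+N)/b*δ ≤ m/4000) (hR : rI+N*δ < R) :
    ∃ u u1 v v1 : ℝ → ℝ, ∃ ρ ∈ Icc (rI-N*δ) (rI+N*δ), ∃ c, (c = 0 ∨ (ρ = rI-N*δ ∧ 0 < c) ∨ (ρ = rI+N*δ ∧ c < 0)) ∧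
      FS a m b U V η (k/4) k' (2*a*(1+(1/b)^2)+a) δ R w u u1 v v1 ρ c := by
  have ha := H.ha
  have hm := H.hm
  have hb := H.hb
  have hU := H.U0
  have hrI := Hr.rI0
  have h5 := H.h5
  have h6 := H.h6
  have hVb : V ≤ 1/b := by rw [le_div_iff₀ hb]; exact lA H.h2
  have hUη : 0 < U-η := by
    have : 0 < (U-η)/(4*b) := lC hκ hκ0 hm
    rwa [div_pos_iff_of_pos_right pv] at this
  set P := rI+N*δ with hP
  have hNδ : 0 < N*δ := pv
  have hP0 : 0 < P := pv
  have hl : 0 < rI-N*δ := lB h3 hNδ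
  have hwb : ∀ t : ℝ, U ≤ w |t| ∧ w |t| ≤ a := λt Hr.bd H (abs_nonneg t)
  have hsb : ∀ p t, 0 ≤ sB k P δ p t/b ∧ sB k P δ p t/b ≤ 1/b := fun p t => ⟨(div_pos sB_pos hb).le, by gcongr; exact sB_lt⟩
  have hsa : ∀ p t, 0 ≤ (1/4+sA k' δ p t)/b ∧ (1/4+sA k' δ p t)/b ≤ 1/(2*b) ∧ (1/4+sA k' δ p t)/b ≤ 1/b := fun p t => by
    have e1 : 0 < sA k' δ p t := sA_pos
    have e2 : sA k' δ p t ≤ 1/4 := sA_lt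
    refine ⟨pv, ?_, by gcongr; linarith only [e1, e2]⟩
    rw [div_le_div_iff₀ hb pv]
    have := mR e2 hb.le
    exact lA this
  set BG := (m/b+2*a/b^2+1)/δ^2 with hBG
  set BF := 2*a*(1+(1/b)^2)+a with hBF
  have bG1 : ∀ p t x y, |FG1 m b η δ k P w p t x y| ≤ BG := fun p t x y => by
    have h1 := cl_mem (hsb p t).1 y
    exact FG_bd hm hb hδ (by linarith only [(hwb t).1, hUη]) (by linarith only [(hwb t).2, hη, hη2, h6]) lA hη ⟨h1.1, h1.2.trans (hsb p t).2⟩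
  have bG2 : ∀ p t x y, |FG2 m b η δ k' w p t x y| ≤ BG := fun p t x y => by
    have h1 := cl_mem (hsa p t).2.2 y
    exact FG_bd hm hb hδ (by linarith only [(hwb t).1, hUη]) (by linarith only [(hwb t).2, hη, hη2, h6]) lA hη ⟨(hsa p t).1.trans h1.1, h1.2⟩
  have hBG0 : 0 < BG := pv
  have hBF0 : 0 < BF := pv
  obtain ⟨u, v, ρ, hρ, c, cu, cv, htri, huR, hvρ, hvR, heq⟩ := fp_lem (B := BF+BG) (FF_C4 a b) (FF_C4 a b) (FG1_C4 (m := m) (b := b) (η := η) (δ := δ) (k := k) (P := P) Hr.cw)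
    (FG2_C4 (m := m) (b := b) (η := η) (δ := δ) (k := k') Hr.cw) (fun _ _ x y => by linarith only [FF_bd ha hb x y, hBG0, ha, hb]) (fun _ _ x y => by linarith only [FF_bd ha hb x y, hBG0, ha, hb])
    (fun p t x y => by linarith only [bG1 p t x y, hBF0]) (fun p t x y => by linarith only [bG2 p t x y, hBF0]) hl (by linarith only [hNδ] : rI-N*δ < P) hR U (1/(3*b)) V
  have hρ0 : 0 < ρ := hl.trans_le hρ.1
  have hρR : ρ < R := hρ.2.trans_lt hR
  have hR0 : 0 < R := hρ0.trans hρR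
  simp only [show ∀ ρ t x y, sel (fun _ _ x y => FFc a b x y) (fun _ _ x y => FFc a b x y) ρ t x y = FFc a b x y from fun ρ t x y => by unfold sel; simp] at heq
  set f : ℝ → ℝ := λt FFc a b (u t) (v t) with hf0
  have cf : Continuous f := by
    have := (FF_C4 a b)
    unfold C4 at this
    exact this.comp (show Continuous (λt ((0:ℝ), (0:ℝ), u t, v t)) by fun_prop)
  have bf : ∀ t, |f t| ≤ BF := λt FF_bd ha hb _ _
  set g : ℝ → ℝ := λt sel (FG1 m b η δ k P w) (FG2 m b η δ k' w) ρ t (u t) (v t) with hg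
  have mg : Measurable g := sel_meas (FG1_C4 Hr.cw) (FG2_C4 Hr.cw) ρ cu.measurable cv.measurable
  have bg : ∀ t, |g t| ≤ BG := λt sel_bd bG1 bG2 _ _ _ _
  have rg : ∀ t, ContinuousWithinAt g (Ici t) t := λt sel_rc (FG1_C4 Hr.cw) (FG2_C4 Hr.cw) ρ cu cv t
  have eu : ΛR u r = u 0+rJ f r := by
    intro r hr
    rw [(heq r hr).1, (heq 0 ⟨le_rfl, hR0.le⟩).1, rJ_zero]; ring
  have he : ΛR v r = 1/(3*b)+rJ g r-rJ g ρ+c*rlp ρ r := λh (heq r hr).2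
  have e0 : v 0 = 1/(3*b)-rJ g ρ := by
    rw [he 0 ⟨le_rfl, hR0.le⟩, rJ_zero]; unfold rlp; rw [max_eq_right hρ0.le]; ring
  have ein : ∀ r ∈ Icc 0 ρ, v r = v 0+rJ g r := by
    intro r hr
    rw [he r ⟨hr.1, hr.2.trans hρR.le⟩, e0]; unfold rlp; rw [max_eq_right hr.2]; ring
  have eout : ∀ r ∈ Icc ρ R, v r = (1/(3*b)-rJ g ρ-c*log ρ)+rJ g r+c*log r := by
    intro r hr
    rw [he r ⟨hρ0.le.trans hr.1, hr.2⟩]; unfold rlp; rw [max_eq_left hr.1]; ring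
  have Ru0 : RL 0 R u (rH f) f := (sol_RL cf.measurable bf le_rfl (λt cf.continuousWithinAt) (A := u 0) (c := 0)
    (λh by rw [eu r hI_]; ring)).congr (λR by simp) (fun _ _ => rfl)
  have Zu := sol_zero cf.measurable bf hR0 eu
  have Rin0 : RL 0 ρ v (rH g) g := (sol_RL mg bg le_rfl rg (A := v 0) (c := 0) (λh by rw [ein r hI_]; ring)).congr (λR by simp) (fun _ _ => rfl)
  have Rout0 : RL ρ R v (λr rH g r+c/r) g := sol_RL mg bg hρ0.le rg (λh eout r hI_)
  have Zv := sol_zero mg bg hρ0 ein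
  have hub : ΛR 0 ≤ u r ∧ u r ≤ a := by
    have i1 := cmpr le_rfl hR0 (w := λr - u r) (w1 := λr - rH f r) (f := λr - f r) cu.neg.continuousOn Ru0.neg
      (Or.inr ⟨-0, by simp, Zu.neg⟩) (by rw [huR]; linarith only [hη, hUη]) (fun r hr h => by
        rw [hf0]; simp only [FFc]; rw [cl_le pv lA h]; linarith only [hη, hη2, h6])
    have i2 := cmpr le_rfl hR0 (w := λr u r-a) (w1 := rH f) (f := f) (cu.sub continuous_const).continuousOn
      (λh ⟨(Ru0 r hr).1.sub_const _, (Ru0 r hr).2⟩) (Or.inr ⟨0, le_rfl, Zu.sub_const _⟩) (by rw [huR]; linarith only [h5, h6]) (fun r hr h => by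
        rw [hf0]; simp only [FFc]
        have e1 : a < cl 0 (2*a) (u r) := by unfold cl; exact lt_max_of_lt_right (lt_min lC hη hη2 h6 lA h)
        have e2 : 0 ≤ cl 0 (2*a) (u r)*(cl 0 (1/b) (v r))^2 := mul_nonneg lD hη hη2 h6 e1 (sq_nonneg _)
        linarith only [e1, e2])
    intro r hr
    exact ⟨by linarith only [i1 r hr], by linarith only [i2 r hr]⟩
  have gin : ∀ r, 0 ≤ r → r < ρ → g r = (hf m b cη (cl 0 (sB k P δ ρ r/b) (v r))+cl (-1) 1 (v r-cl 0 (sB k P δ ρ r/b) (v r)))/δ^2 := fun r h0 hr => by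
    rw [hg]; simp only [sel, if_pos hr, FG1]; rw [abs_of_nonneg h0]
  have gout : ∀ r, ρ ≤ r → g r = (hf m b cη (cl ((1/4+sA k' δ ρ r)/b) (1/b) (v r))+cl (-1) 1 (v r-cl ((1/4+sA k' δ ρ r)/b) (1/b) (v r)))/δ^2 := λh by
    rw [hg]; simp only [sel, if_neg (not_lt.2 hr), FG2]; rw [abs_of_nonneg (hρ0.le.trans hr)]
  have hδ2 : 0 < δ^2 := pv
  have hin : ∀ r ∈ Icc 0 ρ, 0 ≤ v r ∧ v r ≤ sB k P δ ρ r/b := by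
    have i1 := cmpr le_rfl hρ0 (w := λr - v r) (w1 := λr - rH g r) (f := λr - g r) cv.neg.continuousOn Rin0.neg
      (Or.inr ⟨-0, by simp, Zv.neg⟩) (by rw [hvρ]; have : 0 < 1/(3*b) := pv; linarith only [this]) (fun r hr h => by
        rw [gin r hr.1.le hr.2, cl_le (hsb _ _).1 lA h, ← neg_div]
        refine div_pos ?_ hδ2
        have := cl_one_neg (x := v r-0) lA h
        unfold hf
        linarith only [this])
    have csB : Continuous (λr sB k P δ ρ r) := by
      have := (sB_cont (k := k) (P := P) (δ := δ)).comp (show Continuous (fun r : ℝ => (ρ, r)) by fun_prop)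
      exact this
    have RB := sB_RL (k := k) (ρ := ρ) (p := 0) (q := ρ) hP0 hδ le_rfl
    have RBb := λh (⟨(RB r hr).1.div_const b, ((RB r hr).2.div_const b)⟩ : _ ∧ _)
    have i2 := cmpr le_rfl hρ0 (w := λr v r-sB k P δ ρ r/b) (w1 := λr rH g r-k*(sB k P δ ρ r*(1-2*sB k P δ ρ r))*(r/(P*δ))/b)
      (f := λr g r-(k^2*(sB k P δ ρ r*(1-2*sB k P δ ρ r)*(1-4*sB k P δ ρ r))*(r/P)^2
        + 2*(sB k P δ ρ r*(1-2*sB k P δ ρ r))*(k*δ/P))/δ^2/b) (cv.sub (csB.div_const b)).continuousOn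
      (λh ⟨(Rin0 r hr).1.sub (RBb r hr).1, ((Rin0 r hr).2.sub (RBb r hr).2).congr_deriv (by ring)⟩)
      (Or.inr ⟨0, le_rfl, (Zv.sub ((sB_deriv (k := k) (ρ := ρ) hP0 hδ 0).hasDerivWithinAt.div_const b)).congr_deriv (by simp)⟩)
      (by rw [hvρ, sB_ρ]; apply le_of_eq; field_simp; ring) (fun r hr h => by
        have h' : sB k P δ ρ r/b < v r := lA h
        rw [gin r hr.1.le hr.2, cl_ge (hsb _ _).1 h'.le]
        have e1 := cl_one_pos (x := v r-sB k P δ ρ r/b) lA h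
        have e2 := Hr.barI H (u := cl (w r-η) (w r+η) (u r)) hk hkm hη.le (by linarith only [mul_pos hb hm, hη, hη2]) hδ hN.le h3 hρ hL hsm hr.1 hr.2.le (cl_mem lA hη _).2
        rw [← hP] at e2
        rw [div_right_comm, ← sub_div]
        refine div_pos ?_ hδ2
        rw [← div_le_iff₀' hb] at e2
        linarith only [e1, e2])
    intro r hr
    exact ⟨by linarith only [i1 r hr], by linarith only [i2 r hr]⟩
  have hout : ∀ r ∈ Icc ρ R, (1/4+sA k' δ ρ r)/b ≤ v r ∧ v r ≤ 1/b := by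
    have i1 := cmpr hρ0.le hρR (w := λr v r-1/b) (w1 := λr rH g r+c/r) (f := g) (cv.sub continuous_const).continuousOn
      (λh ⟨(Rout0 r hr).1.sub_const _, (Rout0 r hr).2⟩) (Or.inl (by rw [hvρ]; have : 1/(3*b) ≤ 1/b := (by gcongr; linarith only [hb]); linarith only [this])) (by rw [hvR]; linarith only [hVb]) (fun r hr h => by
        rw [gout r hr.1.le, cl_ge (hsa _ _).2.2 lA h]
        refine div_pos ?_ hδ2
        have := cl_one_pos (x := v r-1/b) lA h
        have e : hf m b cη (1/b) = m/b := by unfold hf; field_simp; ring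
        rw [e]; positivity)
    have csA : Continuous (λr sA k' δ ρ r) := by
      have := (sA_cont (k := k') (δ := δ)).comp (show Continuous (fun r : ℝ => (ρ, r)) by fun_prop)
      exact this
    have RB := sA_RL (k := k') (ρ := ρ) (p := ρ) (q := R) hδ
    have RBb := λh (⟨((RB r hr).1.const_add (1/4)).div_const b, ((RB r hr).2.div_const b)⟩ : _ ∧ _)
    have i2 := cmpr hρ0.le hρR (w := λr (1/4+sA k' δ ρ r)/b-v r) (w1 := λr k'*(sA k' δ ρ r*(1-4*sA k' δ ρ r))/δ/b-(rH g r+c/r))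
      (f := λr (k'^2*(sA k' δ ρ r*(1-4*sA k' δ ρ r)*(1-8*sA k' δ ρ r))/δ^2+(k'*(sA k' δ ρ r*(1-4*sA k' δ ρ r))/δ)/r)/b-g r) (((continuous_const.add csA).div_const b).sub cv).continuousOn
      (λh ⟨(RBb r hr).1.sub (Rout0 r hr).1, ((RBb r hr).2.sub (Rout0 r hr).2).congr_deriv (by ring)⟩)
      (Or.inl (by rw [hvρ, sA_ρ]; apply le_of_eq; field_simp; ring)) (by
        rw [hvR]
        have e1 := (hsa ρ R).2.1
        have e2 : 1/(2*b) ≤ V := by rw [div_le_iff₀ pv]; exact lA H.h1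
        linarith only [e1, e2]) (fun r hr h => by
        have h' : v r < (1/4+sA k' δ ρ r)/b := lA h
        rw [gout r hr.1.le, cl_le (hsa _ _).2.2 h'.le]
        have e1 := cl_one_neg (x := v r-(1/4+sA k' δ ρ r)/b) lA h
        have e2 := Hr.barO H (u := cl (w r-η) (w r+η) (u r)) hk' hkm' hη.le hη2 hδ hN.le hρ hρ0 hL hκ hκ0 hsm' hr.1.le (cl_mem lA hη _).1
        have e3 : 0 ≤ (k'*(sA k' δ ρ r*(1-4*sA k' δ ρ r))/δ)/r/b := by
          have q1 : 0 < sA k' δ ρ r := sA_pos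
          have q2 : 0 ≤ 1-4*sA k' δ ρ r := by linarith only [show sA k' δ ρ r ≤ 1/4 from sA_lt]
          have q3 : 0 < r := hρ0.trans hr.1
          positivity
        rw [← le_div_iff₀' hb] at e2
        have e4 := div_le_div_of_nonneg_right e2 hδ2.le
        rw [add_div, add_div, div_right_comm (k'^2*_) (δ^2) b]
        have e5 : cl (-1) 1 (v r-(1/4+sA k' δ ρ r)/b)/δ^2 < 0 := div_neg_of_neg_of_pos e1 hδ2
        linarith only [e3, e4, e5])
    intro r hr
    exact ⟨by linarith only [i2 r hr], by linarith only [i1 r hr]⟩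
  have gin' : ∀ r, 0 ≤ r → r < ρ → g r = hf m b cη (v r)/δ^2 := fun r h0 hr => by
    rw [gin r h0 hr, cl_id (hin r ⟨h0, hr.le⟩), sub_self, cl_id (lo := -1) (hi := 1) (x := 0) (by norm_num), add_zero]
  have gout' : ∀ r, ρ ≤ r → r ≤ R → g r = hf m b cη (v r)/δ^2 := fun r h0 hr => by
    rw [gout r h0, cl_id (hout r ⟨h0, hr⟩), sub_self, cl_id (lo := -1) (hi := 1) (x := 0) (by norm_num), add_zero]
  have hin2 : ∀ r ∈ Icc 0 ρ, 0 ≤ v r ∧ v r ≤ 1/(3*b) ∧ v r ≤ 1/b*exp (-(k/4*(ρ-r)/δ)) := by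
    intro r hr
    obtain ⟨q1, q2⟩ := hin r hr
    obtain ⟨q3, q4⟩ := sB_in hk hP0 hδ hr.1 hr.2 (by linarith only [hρ.1, h3] : P/2 ≤ ρ)
    refine ⟨q1, q2.trans ?_, q2.trans ?_⟩
    · rw [div_le_div_iff₀ hb pv]
      have := mR q3 hb.le
      exact lA this
    · rw [one_div_mul_eq_div]; gcongr
  have hout2 : ∀ r ∈ Icc ρ R, 1/(3*b) ≤ v r ∧ v r ≤ 1/b ∧ 1/2-exp (-(k'*(r-ρ)/δ)) ≤ b*v r := by
    intro r hr
    obtain ⟨q1, q2⟩ := hout r hr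
    obtain ⟨q3, q4⟩ := sA_out hk' hδ hr.1
    have q5 := exp_pos (-(k'*(r-ρ)/δ))
    have q6 := q1
    rw [div_le_iff₀' hb] at q6
    refine ⟨?_, q2, lC q4 q5 q6⟩
    rw [div_le_iff₀ pv]
    exact lB q3 q6
  have hvb : ΛR 0 ≤ v r ∧ v r ≤ 1/b := λh by
    have : 1/(3*b) ≤ 1/b := by gcongr; exact lA hb
    have p3 : 0 < 1/(3*b) := pv
    rcases le_total r ρ with h | h
    · have := hin2 r ⟨hr.1, h⟩; constructor <;> linarith
    · have := hout2 r ⟨h, hr.2⟩; constructor <;> linarith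
  have ff : ΛR f r = u r*(1+(v r)^2)-a := λh by
    rw [hf0]; simp only [FFc]
    have := hub r hr
    rw [cl_id ⟨this.1, ll⟩, cl_id (hvb r hr)]
  have hder : HasDerivAt (λr v 0+rJ g r) (rH g ρ) ρ := (rJ_deriv mg bg hρ0).const_add _
  refine ⟨u, rH f, v, rH g, ρ, hρ, c, htri, ⟨cu, cv, fun s hs => (rH_cont cf.measurable bf hs).continuousWithinAt,
    fun s hs => (rH_cont mg bg hs).continuousWithinAt, huR, hvR, hvρ, hub, hin2, hout2, Ru0.congr (fun _ _ => rfl) (λh ff r hI_), Zu,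
    λh rH_bd bf hr.le, ?_, Rin0.congr (fun _ _ => rfl) (λh gin' r hr.1.le hr.2), Rout0.congr (fun _ _ => rfl) (λh gout' r hr.1.le hr.2.le),
    ?_, ?_, ⟨BG, λh rH_bd bg hr.le⟩, eu, ?_⟩⟩
  · intro r hr h
    have := rH_le (k := 0) cf.measurable bf hr.1 (fun t ht => by
      rw [ff t ⟨ht.1.le, (ht.2.trans hr.2).le⟩]; linarith only [h t ht])
    simpa using this
  · refine left_slope hder hρ0 (λh ?_)
    have q := (hin2 r hI_).2.1
    rw [← hvρ, ein r hI_, ein ρ ⟨hρ0.le, le_rfl⟩] at q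
    exact q
  · have hd2 : HasDerivAt (λr (1/(3*b)-rJ g ρ-c*log ρ)+rJ g r+c*log r) (rH g ρ+c/ρ) ρ := by
      have := ((rJ_deriv mg bg hρ0).const_add (1/(3*b)-rJ g ρ-c*log ρ)).add ((hasDerivAt_log hρ0.ne').const_mul c)
      exact this.congr_deriv (by ring)
    refine right_slope hd2 hρR (λh ?_)
    have q := (hout2 r hI_).1
    rw [← hvρ, eout r hI_, eout ρ ⟨le_rfl, hρR.le⟩] at q
    exact q
  · intro hc hw r hr
    have e1 : v r = v 0+rJ g r := by
      rw [he r hr, e0, hc]; ring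
    rw [e1]
    congr 1
    refine rJ_congr hr.1 (fun t ht => ?_)
    have ht' : t ∈ Icc 0 R := ⟨ht.1, ht.2.trans hr.2⟩
    have q1 := hub t ht'
    have q2 := abs_le.1 (hw t ht')
    have q3 : g t = hf m b (cl (w t-η) (w t+η) (u t)) (v t)/δ^2 := by
      rcases lt_or_ge t ρ with h | h
      · exact gin' t ht.1 h
      · exact gout' t h ht'.2
    rw [q3, cl_id ⟨ll, ll⟩]
    unfold GGc
    rw [cl_id ⟨q1.1, ll⟩, cl_id (hvb t ht')]

lemma FS_exists (H : PH_) (Hr : Red a m b U rI L0 d1 w w1) :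
    ∃ η > 0, 4*m*b < U-η ∧ ∃ κ1 > 0, ∃ κ2 > 0, ∃ B0 > 0, ∀ N > 0, ∃ δN > 0, ∀ δ ∈ Ioo 0 δN, ∀ R, rI+1 < R →
      3*(N*δ) ≤ rI ∧ N*δ ≤ 1/2 ∧ ∃ u u1 v v1 : ℝ → ℝ, ∃ ρ ∈ Icc (rI-N*δ) (rI+N*δ), ∃ c,
      (c = 0 ∨ (ρ = rI-N*δ ∧ 0 < c) ∨ (ρ = rI+N*δ ∧ c < 0)) ∧ FS a m b U V η κ1 κ2 B0 δ R w u u1 v v1 ρ c := by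
  have ha := H.ha
  have hm := H.hm
  have hb := H.hb
  have hU := H.U0
  have h4 := H.h4
  have hrI := Hr.rI0
  have hL : 0 ≤ L0 := (abs_nonneg _).trans (Hr.lip 1 one_pos)
  obtain ⟨η, hη, hη1, hη2⟩ : ∃ η > 0, η ≤ b*m/4000 ∧ η ≤ (U-4*m*b)/2 :=
    ⟨min (b*m/4000) ((U-4*m*b)/2), lt_min pv ll, min_le_left _ _, min_le_right _ _⟩
  set k := √m/2 with hk
  set k' := √(m/20) with hk'
  have hk0 : 0 < k := pv
  have hk0' : 0 < k' := pv
  have hkm : 4*k^2 = m := by rw [hk, div_pow, sq_sqrt hm.le]; ring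
  have hkm' : 20*k'^2 = m := by rw [hk', sq_sqrt pv]; ring
  refine ⟨η, hη, ll, k/4, pv, k', hk0', 2*a*(1+(1/b)^2)+a, pv, fun N hN => ?_⟩
  set κ := (U-η)/(4*b)-m with hκ
  have hκ0 : 0 < κ := by
    rw [hκ, sub_pos, lt_div_iff₀ pv]; linarith
  set C1 := ((L0*N+4*L0/k)/b+2*k/rI+4*k^2*(2/rI*(2*N+4/k))) with hC1
  set C2 := L0*(|log (2/(κ/(3*(U/b+k'^2))))|/k'+N)/b with hC2
  have hC1' : 0 < C1 := pv
  have hC2' : 0 ≤ C2 := pv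
  set S := 3*N/rI+2*N+C1/(m/72)+C2/(m/4000) with hS
  have hS0 : 0 < S := pv
  refine ⟨1/S, pv, fun δ hδ R hR => ?_⟩
  have hδ0 := hδ.1
  have h1 : δ*S < 1 := by have := hδ.2; rwa [lt_div_iff₀ hS0] at this
  have p1 : 0 ≤ δ*(3*N/rI) := pv
  have p2 : 0 ≤ δ*(2*N) := pv
  have p3 : 0 ≤ δ*(C1/(m/72)) := pv
  have p4 : 0 ≤ δ*(C2/(m/4000)) := pv
  have h2 : δ*S = δ*(3*N/rI)+δ*(2*N)+δ*(C1/(m/72))+δ*(C2/(m/4000)) := by rw [hS]; ring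
  have q1 : 3*(N*δ) ≤ rI := by
    have : δ*(3*N/rI) ≤ 1 := lE h1 p2 p3 p4 h2
    have e : δ*(3*N/rI) = 3*(N*δ)/rI := by ring
    rwa [e, div_le_one hrI] at this
  have q2 : N*δ ≤ 1/2 := lE h1 p1 p3 p4 h2
  have q3 : C1*δ ≤ m/72 := by
    have : δ*(C1/(m/72)) ≤ 1 := lE h1 p1 p2 p4 h2
    have e : δ*(C1/(m/72)) = C1*δ/(m/72) := by ring
    rwa [e, div_le_one pv] at this
  have q4 : C2*δ ≤ m/4000 := by
    have : δ*(C2/(m/4000)) ≤ 1 := lE h1 p1 p2 p3 h2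
    have e : δ*(C2/(m/4000)) = C2*δ/(m/4000) := by ring
    rwa [e, div_le_one pv] at this
  exact ⟨q1, q2, FS_fix H Hr hk0 hkm hk0' hkm' hη hη1 hδ0 hN q1 hL q3 rfl hκ0 q4 ll⟩

lemma hf_fac {v : ℝ} (hm : 0 < m) (hb : 0 < b) (hs : 4*m*b < s) :
    hf m b s v = s*(b*v)*(v-Vp m b s)*(v+Vp m b s-1/b) := by
  have h := (Vp_facts hm hb hs).1
  have e : b*(1/b) = 1 := by field_simp
  unfold hf
  linear_combination (-v)*h+s*v*(v-Vp m b s)*e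

lemma ZZ {x0 : ℝ} (hm : 0 < m) (hb : 0 < b) (hx0 : 4*m*b < x0) : ∃ γ > 0, ∃ μ > 0, ∃ K > 0,
    ∀ p R δ l A : ℝ, ∀ s v v1 : ℝ → ℝ, 0 < p → p < R → 0 < δ → δ ≤ μ*p → ContinuousOn v (Icc p R) →
    RL p R v v1 (λr hf m b (s r) (v r)/δ^2) → 0 ≤ l → (∀ x ∈ Icc p R, ∀ y ∈ Icc p R, |s x-s y| ≤ l * |x-y|) →
    (∀ x ∈ Icc p R, x0 ≤ s x) → (∀ x ∈ Icc p R, 1/2-γ ≤ b*v x) → |v p-Vp m b (s p)| ≤ A → v R = Vp m b (s R) →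
    ∀ r ∈ Icc p R, |v r-Vp m b (s r)| ≤ A*exp (-(μ*(r-p)/δ))+K*l*δ := by
  obtain ⟨l1, hl1, hV⟩ := Vp_lip hm hb hx0
  obtain ⟨-, f2, f3, -⟩ := Vp_facts hm hb hx0
  have h00 : 0 < x0 := by have : 0 < 4*m*b := pv; linarith
  have eb : b*(1/b) = 1 := by field_simp
  set q0 := Vp m b x0
  have hg : 0 < 2*q0-1/b := by
    rw [sub_pos, div_lt_iff₀ hb]; linarith
  set g := 2*q0-1/b with hgd
  have hbg : b*g = 2*(b*q0)-1 := by rw [hgd]; linear_combination -eb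
  have hκ0 : 0 < x0*g/12 := pv
  have hμ0 : 0 < √(x0*g/12)/2 := pv
  refine ⟨b*g/8, pv, √(x0*g/12)/2, hμ0, 2*l1/(√(x0*g/12)/2), pv, ?_⟩
  intro p R δ l A s v v1 hp hpR hδ hδp hc h hl hs hsx hv hA hR r hr
  have hκ : 4*(√(x0*g/12)/2)^2 ≤ x0*g/12 := by rw [div_pow, Real.sq_sqrt hκ0.le]; linarith
  have key : ∀ x ∈ Icc p R, x0*g/12 ≤ s x*(b*v x)*(v x+Vp m b (s x)-1/b) := by
    intro x hx
    have h1 := hsx x hx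
    have h2 := hv x hx
    have h3 := Vp_mono hm hb hx0 h1
    have h4 : 1/3 ≤ b*v x := ll
    have h5 : g/4 ≤ v x+Vp m b (s x)-1/b := by
      have : b*(g/4) ≤ b*(v x+Vp m b (s x)-1/b) := by
        have := mL h3 hb.le
        have e : b*(v x+Vp m b (s x)-1/b) = b*v x+b*Vp m b (s x)-1 := by linear_combination -eb
        rw [e]; simp only [q0] at *; linarith
      exact le_of_mul_le_mul_left this hb
    calc x0*g/12 = x0*(1/3)*(g/4) := by ring
      _ ≤ _ := mul_le_mul (mul_le_mul h1 h4 (by norm_num) ll) h5 pv (mul_nonneg ll ll)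
  have hq : ∀ x ∈ Icc p R, ∀ y ∈ Icc p R, |Vp m b (s x)-Vp m b (s y)| ≤ (l1*l) * |x-y| := fun x hx y hy =>
    (hV _ _ (hsx x hx) (hsx y hy)).trans (by rw [mul_assoc]; exact mL (hs x hx y hy) hl1.le)
  have hA0 := (abs_nonneg _).trans hA
  have hd : δ^2 ≠ 0 := pv
  have z1 := zest (q := λx Vp m b (s x)) hp hpR hδ hμ0 hκ hδp hc h pv hq (fun x hx hxv => by
    have hx' := Ioo_subset_Icc_self hx
    rw [mul_div_cancel₀ _ hd, hf_fac hm hb (hx0.trans_le (hsx x hx'))]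
    have := mR (key x hx') (sub_nonneg.2 hxv.le)
    linarith) hA0 ((le_abs_self _).trans hA) hR.le r hr
  have z2 := zest (l := l1*l) (q := λx -Vp m b (s x)) hp hpR hδ hμ0 hκ hδp hc.neg h.neg pv
    (fun x hx y hy => by
      have := hq y hy x hx
      rw [abs_sub_comm y x] at this
      rwa [neg_sub_neg]) (fun x hx hxv => by
    have hx' := Ioo_subset_Icc_self hx
    have : δ^2 * -(hf m b (s x) (v x)/δ^2) = - hf m b (s x) (v x) := by field_simp
    simp only [Pi.neg_apply] at hxv ⊢
    rw [this, hf_fac hm hb (hx0.trans_le (hsx x hx'))]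
    have := mR (key x hx') (show 0 ≤ Vp m b (s x)-v x from ll)
    linarith) hA0 (by have := (neg_le_abs _).trans hA; simp only [Pi.neg_apply]; linarith) (by simp [hR]) r hr
  have e : 2*(l1*l)/(√(x0*g/12)/2)*δ = 2*l1/(√(x0*g/12)/2)*l*δ := by ring
  rw [e] at z1 z2
  simp only [Pi.neg_apply] at z2
  exact abs_le.2 ⟨ll, ll⟩

structure Bs (a m b U V rI L0 d1 η κ1 κ2 B0 : ℝ) (w w1 : ℝ → ℝ) : Prop where
  H : PH_
  Hr : Red a m b U rI L0 d1 w w1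
  η0 : 0 < η
  h4 : 4*m*b < U-η
  k1 : 0 < κ1
  k2 : 0 < κ2
  b0 : 0 < B0

structure Sm (a m b U V rI η κ1 κ2 B0 δ R : ℝ) (w u u1 v v1 : ℝ → ℝ) (ρ c : ℝ) : Prop where
  d0 : 0 < δ
  R1 : rI+1 < R
  ρ1 : 2*rI/3 ≤ ρ
  ρ2 : |ρ-rI| ≤ 1/2
  aR : a*exp (-(R-rI-1)) ≤ δ
  fs : FS a m b U V η κ1 κ2 B0 δ R w u u1 v v1 ρ c

lemma Bs.x0 (h : Bs_) : 0 < U-η := by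
  have := h.h4; have := h.H.hm; have := h.H.hb
  have : 0 < 4*m*b := pv
  linarith

lemma Bs.L (h : Bs_) : 0 ≤ L0 := (abs_nonneg _).trans (h.Hr.lip 1 one_pos)

lemma Sm.ρR (h : Sm_) : ρ+1/2 < R := by
  linarith [h.R1, (abs_le.1 h.ρ2).2]

lemma Sm.vb (H : PH_) (h : Sm_) : ΛR 0 ≤ v r ∧ v r ≤ 1/b := by
  intro r hr
  have hb := H.hb
  have e : 1/(3*b) ≤ 1/b := one_div_le_one_div_of_le hb ll
  have e2 : 0 < 1/(3*b) := pv
  rcases le_total r ρ with hl | hl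
  · have := h.fs.vin r ⟨hr.1, hl⟩; exact ⟨this.1, this.2.1.trans e⟩
  · have := h.fs.vout r ⟨hl, hr.2⟩; exact ⟨mA this.1, this.2.1⟩

lemma Sm.fb (H : PH_) (h : Sm_) : ΛR
    |u r*(1+(v r)^2)-a| ≤ a*(1+(1/b)^2)+a := by
  intro r hr
  have ha := H.ha
  obtain ⟨h1, h2⟩ := h.fs.ub r hr
  obtain ⟨h3, h4⟩ := h.vb H r hr
  have h5 : (v r)^2 ≤ (1/b)^2 := pow_le_pow_left₀ h3 h4 2
  have h6 : u r*(1+(v r)^2) ≤ a*(1+(1/b)^2) := mul_le_mul h2 ll pv ha.le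
  have h7 : 0 ≤ u r*(1+(v r)^2) := pv
  exact abs_le.2 ⟨by linarith only [mul_nonneg ha.le (show 0 ≤ 1+(1/b)^2 from pv), h6, h7], ll⟩

lemma Sm.K (hB : Bs_) (h : Sm_) : ∀ r ∈ Ioo 0 R,
    |u1 r| ≤ B0+2*a+(a*(1+(1/b)^2)+a) := by
  intro r hr
  have ha := hB.H.ha
  have hb0 := hB.b0
  have : 0 ≤ a*(1+(1/b)^2) := pv
  rcases le_total r 1 with h1 | h1
  · have := h.fs.u1b r hr.1
    have : B0*r ≤ B0 := mul_le_of_le_one_right hb0.le h1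
    linarith
  · have := dbd (A := a) (B := a*(1+(1/b)^2)+a) le_rfl h.fs.cu.continuousOn h.fs.Ru (h.fs.cu1.mono (fun x hx => hx.1))
      (λh by have := h.fs.ub r hr; rw [abs_of_nonneg this.1]; exact this.2)
      (λh h.fb hB.H r (Ioo_subset_Icc_self hr)) ll hr.2
    linarith

lemma Sm.lipu (hB : Bs_) (h : Sm_) :
    ∀ x ∈ Icc 0 R, ∀ y ∈ Icc 0 R, |u x-u y| ≤ (B0+2*a+(a*(1+(1/b)^2)+a)) * |x-y| := fun _ hx _ hy =>
  lip_of_d h.fs.cu.continuousOn (λh (h.fs.Ru r hr).1) (h.K hB) hx hy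

lemma Bs.lipw (hB : Bs_) (hx : 0 ≤ x) (hy : 0 ≤ y) : |w x-w y| ≤ L0 * |x-y| := by
  have key : ∀ x y : ℝ, 0 ≤ x → x ≤ y → |w x-w y| ≤ L0 * |x-y| := by
    intro x y hx hxy
    have h1 := hB.Hr.anti x y hx hxy
    rw [abs_of_nonneg ll, abs_of_nonpos ll]
    linarith [hB.Hr.lp hx hxy]
  rcases le_total x y with h | h
  · exact key x y hx h
  · rw [abs_sub_comm, abs_sub_comm x]; exact key y x hy h

lemma uh_eq (w u : ℝ → ℝ) (η r : ℝ) : cl (w r-η) (w r+η) (u r) = w r+cl (-η) η (u r-w r) := by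
  unfold cl
  rw [← max_add_add_left, ← min_add_add_left]; congr 1; ring_nf

lemma Sm.z (hB : Bs_) : ∃ Cz > 0, ∃ μ > 0, ∃ δ1 > 0, ∀ (δ R : ℝ) (u u1 v v1 : ℝ → ℝ) (ρ c : ℝ), δ < δ1 →
    Sm_ → ∀ r ∈ Icc ρ R,
      |v r-Vp m b cη| ≤ Cz*(exp (-(μ*(r-ρ)/δ))+δ) := by
  have hm := hB.H.hm; have hb := hB.H.hb; have hη := hB.η0; have hk2 := hB.k2; have hL := hB.L; have hrI := hB.Hr.rI0
  obtain ⟨γ, hγ, μ, hμ, K, hK, hz⟩ := ZZ hm hb hB.h4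
  obtain ⟨X, hX0, hX⟩ : ∃ X > 0, exp (-(κ2*X)) ≤ γ := by
    refine ⟨max 1 (-(log γ)/κ2), pv, ?_⟩
    rw [← le_log_iff_exp_le hγ]
    have := mL (le_max_right 1 (-(log γ)/κ2)) hk2.le
    rw [mul_div_cancel₀ _ hk2.ne'] at this; linarith
  set K0 := B0+2*a+(a*(1+(1/b)^2)+a) with hK0
  have hK00 : 0 ≤ K0 := by have := hB.b0; have := hB.H.ha; positivity
  refine ⟨1/b*exp (μ*X)+K*(2*L0+K0), pv, μ, hμ, min η (min (μ*rI/2) (1/(4*X))), pv, ?_⟩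
  intro δ R u u1 v v1 ρ c hδ1 h r hr
  have hδ := h.d0
  have hδη := hδ1.trans_le (min_le_left _ _)
  have hδμ := hδ1.trans_le ((min_le_right _ _).trans (min_le_left _ _))
  have hδX : X*δ < 1/4 := by
    have := hδ1.trans_le ((min_le_right _ _).trans (min_le_right _ _))
    rw [lt_div_iff₀ pv] at this; linarith
  have hXδ : 0 < X*δ := pv
  have hρ0 : 0 < ρ := mA h.ρ1
  have hρR := h.ρR
  have hx0 := hB.x0
  have hsb : ΛR U-η ≤ cl (w r-η) (w r+η) (u r) := λh by
    have := cl_mem (show w r-η ≤ w r+η from ll) (u r)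
    linarith [this.1, (hB.Hr.bd hB.H hr.1).1]
  have hvq : ∀ r ∈ Icc ρ R, |v r-Vp m b cη| ≤ 1/b := by
    intro r hr
    have hr0 : r ∈ Icc 0 R := ⟨hρ0.le.trans hr.1, hr.2⟩
    obtain ⟨v1, v2⟩ := h.vb hB.H r hr0
    obtain ⟨-, q1, q2, -⟩ := Vp_facts hm hb (hB.h4.trans_le (hsb r hr0))
    have q3 : Vp m b cη ≤ 1/b := by rw [le_div_iff₀ hb]; exact lA q2
    have q4 : 0 ≤ Vp m b cη := ((mul_pos_iff_of_pos_left hb).1 ll).le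
    exact abs_le.2 ⟨ll, ll⟩
  have hE0 := exp_pos (-(μ*(r-ρ)/δ))
  have hKK : 0 ≤ K*(2*L0+K0) := pv
  rcases le_total r (ρ+X*δ) with h1 | h1
  · refine (hvq r hr).trans ?_
    have : 1 ≤ exp (μ*X)*exp (-(μ*(r-ρ)/δ)) := by
      rw [← exp_add, one_le_exp_iff]
      have : μ*(r-ρ)/δ ≤ μ*X := by
        rw [div_le_iff₀ hδ]; linarith [mL (show r-ρ ≤ X*δ from ll) hμ.le]
      exact lA this
    have h3 := mL this (show 0 ≤ 1/b from pv)
    have h4 : 0 ≤ K*(2*L0+K0)*exp (-(μ*(r-ρ)/δ)) := pv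
    have h5 : 0 ≤ (1/b*exp (μ*X)+K*(2*L0+K0))*δ := pv
    exact lC h3 h4 h5
  · have hsub : Icc (ρ+X*δ) R ⊆ Icc 0 R := Icc_subset_Icc ll le_rfl
    have hsub' : Icc (ρ+X*δ) R ⊆ Icc ρ R := Icc_subset_Icc ll le_rfl
    have hwR := hB.Hr.bout R mA h.R1
    have e1 : a*exp (-(R-rI)) ≤ η := by
      have : exp (-(R-rI)) ≤ exp (-(R-rI-1)) := exp_le_exp.2 lB hδX hXδ
      have := mL this hB.H.ha.le
      exact lC h.aR hδη this
    have hR : v R = Vp m b (cl (w R-η) (w R+η) (u R)) := by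
      rw [h.fs.uR, cl_id ⟨lB hwR.2.2 e1, lC hwR.1 hδ hδη⟩, hB.H.VpU, h.fs.vR]
    have := hz (ρ+X*δ) R δ (2*L0+K0) (1/b) (λr cl (w r-η) (w r+η) (u r)) v (λr v1 r+c/r) lB hXδ hρ0 ll hδ
      (by have := mL (show rI/2 ≤ ρ+X*δ from lC h.ρ1 hXδ hρ0) hμ.le; linarith only [hδμ, this])
      h.fs.cv.continuousOn (h.fs.Rout.mono ll le_rfl) pv (fun x hx y hy => by
        rw [uh_eq, uh_eq]
        have i1 := hB.lipw (hsub hx).1 (hsub hy).1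
        have i2 := h.lipu hB x (hsub hx) y (hsub hy)
        have i3 := cl_lip (-η) η (u x-w x) (u y-w y)
        have i4 : |u x-w x-(u y-w y)| ≤ |u x-u y| + |w x-w y| := by
          have := abs_sub (u x-u y) (w x-w y); rwa [show u x-w x-(u y-w y) = u x-u y-(w x-w y) by ring]
        have i5 := abs_add_le (w x-w y) (cl (-η) η (u x-w x)-cl (-η) η (u y-w y))
        rw [show w x+cl (-η) η (u x-w x)-(w y+cl (-η) η (u y-w y)) = (w x-w y)+(cl (-η) η (u x-w x)-cl (-η) η (u y-w y)) by ring]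
        linarith only [i1, i2, i3, i4, i5]) (fun x hx => hsb x (hsub hx)) (fun x hx => by
        have := (h.fs.vout x (hsub' hx)).2.2
        have e2 : exp (-(κ2*(x-ρ)/δ)) ≤ exp (-(κ2*X)) := by
          apply exp_le_exp.2
          have : κ2*X ≤ κ2*(x-ρ)/δ := by rw [le_div_iff₀ hδ, mul_assoc]; exact mL lA hx.1 hk2.le
          exact lA this
        linarith only [hX, this, e2]) (hvq _ ⟨ll, ll⟩) hR r ⟨h1, hr.2⟩
    refine this.trans ?_
    have e3 : exp (-(μ*(r-(ρ+X*δ))/δ)) = exp (μ*X)*exp (-(μ*(r-ρ)/δ)) := by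
      rw [← exp_add]; congr 1; field_simp; ring
    rw [e3]
    have h4 : 0 ≤ K*(2*L0+K0)*exp (-(μ*(r-ρ)/δ)) := pv
    have h5 : 0 ≤ (1/b*exp (μ*X))*δ := pv
    exact lB h4 h5

lemma Bs.Ua (hB : Bs_) : U < a := by
  linarith [hB.H.h5, hB.H.h6]

lemma Bs.sb (hB : Bs_) (hr : 0 ≤ r) :
    U-η ≤ cl (w r-η) (w r+η) x ∧ cl (w r-η) (w r+η) x ≤ 2*a := by
  have hη := hB.η0
  have k := cl_mem (show w r-η ≤ w r+η from ll) x
  have h := hB.Hr.bd hB.H hr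
  have := hB.x0; have := hB.Ua
  exact ⟨mA k.1, mA k.2⟩

lemma Sm.pw (hB : Bs_) : ∃ C1 > 0, ∃ θ ≥ 1, ∃ δ1 > 0, ∀ (δ R : ℝ) (u u1 v v1 : ℝ → ℝ) (ρ c : ℝ), δ < δ1 →
    Sm_ → ΛR
      0 ≤ u r*(v r)^2 ∧ u r*(v r)^2 ≤ a/b^2 ∧
      (r ≤ ρ → v r ≤ C1*exp (-|r-ρ|/(θ*δ)) ∧ u r*(v r)^2 ≤ C1*(eθ+δ)) ∧
      (ρ ≤ r → |v r-Vp m b cη| ≤ C1*(eθ+δ) ∧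
        (w r < u r → Qf m b (w r)-C1*(eθ+δ) ≤ u r*(v r)^2) ∧
        (u r < w r → u r*(v r)^2 ≤ Qf m b (w r)+C1*(eθ+δ)) ∧
        (|u r-w r| ≤ η → |u r*(v r)^2-Qf m b (u r)| ≤ C1*(eθ+δ))) := by
  have ha := hB.H.ha; have hm := hB.H.hm; have hb := hB.H.hb; have hη := hB.η0; have hk1 := hB.k1
  obtain ⟨Cz, hCz, μ, hμ, δ1, hδ1, hz⟩ := Sm.z hB
  set θ := max 1 (max (1/μ) (1/κ1)) with hθ
  have t1 : 1 ≤ θ := le_max_left _ _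
  have t0 : 0 < θ := ll
  have t2 : 1/θ ≤ μ := by rw [div_le_comm₀ t0 hμ]; exact (le_max_left _ _).trans (le_max_right _ _)
  have t3 : 1/θ ≤ κ1 := by rw [div_le_comm₀ t0 hk1]; exact (le_max_right _ _).trans (le_max_right _ _)
  set C1 := a/b^2+1/b+Cz+4*a/b*Cz with hC1
  have q1 : 0 < a/b^2 := pv
  have q2 : 0 < 4*a/b*Cz := pv
  have q3 : 0 < 1/b := pv
  refine ⟨C1, pv, θ, t1, δ1, hδ1, ?_⟩
  intro δ R u u1 v v1 ρ c hδ h r hr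
  have hd := h.d0
  obtain ⟨u0, ua⟩ := h.fs.ub r hr
  obtain ⟨v0, vb⟩ := h.vb hB.H r hr
  have v2 : (v r)^2 ≤ (1/b)^2 := pow_le_pow_left₀ v0 vb 2
  have ea : a*(1/b)^2 = a/b^2 := by field_simp
  have uv : u r*(v r)^2 ≤ a/b^2 := by rw [← ea]; exact mul_le_mul ua v2 pv ha.le
  set E := eθ with hE
  have hE0 : 0 < E := exp_pos _
  have cmp : ∀ k, 1/θ ≤ k → ∀ x, 0 ≤ x → exp (-(k*x/δ)) ≤ exp (-x/(θ*δ)) := by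
    intro k hk x hx
    apply exp_le_exp.2
    have e : x/(θ*δ) = (1/θ)*x/δ := by field_simp
    have : (1/θ)*x/δ ≤ k*x/δ := by gcongr
    rw [neg_div, e]; exact lA this
  refine ⟨pv, uv, fun hl => ?_, fun hl => ?_⟩
  · have h1 := (h.fs.vin r ⟨hr.1, hl⟩).2.2
    have h2 := cmp κ1 t3 (ρ-r) lA hl
    rw [show ρ-r = |r-ρ| by rw [abs_of_nonpos ll]; ring] at h2 h1
    have h3 := mL h2 q3.le
    have h4 : v r ≤ 1/b*E := h1.trans h3
    refine ⟨h4.trans (mR lC hCz q1 q2 hE0.le), ?_⟩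
    have h5 : u r*(v r)^2 ≤ a/b^2*E := by
      calc u r*(v r)^2 ≤ a*((1/b)*(1/b*E)) := mul_le_mul ua (by rw [sq]; exact mul_le_mul vb h4 v0 q3.le) pv ha.le
        _ = _ := by field_simp
    have : a/b^2*E ≤ C1*(E+δ) := mul_le_mul lC hCz q2 q3 lA hd hE0.le lD hCz q1 q2 q3
    exact lB h5 this
  · have h1 := hz δ R u u1 v v1 ρ c hδ h r ⟨hl, hr.2⟩
    have h2 := cmp μ t2 (r-ρ) lA hl
    rw [show r-ρ = |r-ρ| by rw [abs_of_nonneg ll]] at h2 h1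
    obtain ⟨s1, s2⟩ := hB.sb (x := u r) hr.1
    obtain ⟨-, p1, p2, p3⟩ := Vp_facts hm hb (hB.h4.trans_le s1)
    set s := cl (w r-η) (w r+η) (u r) with hs
    set q := Vp m b s
    have hx0 := hB.x0
    have h3 : |v r-q| ≤ Cz*(E+δ) := h1.trans (mL lA h2 hCz.le)
    have q0 : 0 ≤ q := ((mul_pos_iff_of_pos_left hb).1 lB p1 p2).le
    have qb : q ≤ 1/b := by rw [le_div_iff₀ hb]; exact lA p2
    have h4 : |s*(v r)^2-Qf m b s| ≤ (4*a/b*Cz)*(E+δ) := by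
      rw [p3, show s*(v r)^2-s*q^2 = (s*(v r+q))*(v r-q) by ring, abs_mul, abs_of_nonneg (mul_nonneg lB s1 hx0 lB v0 q0)]
      calc s*(v r+q)*|v r-q| ≤ (2*a*(2*(1/b)))*(Cz*(E+δ)) := mul_le_mul (mul_le_mul s2 lB vb qb lB v0 q0 lA ha) h3 (abs_nonneg _) pv
        _ = _ := by ring
    have h5 : (4*a/b*Cz)*(E+δ) ≤ C1*(E+δ) := mR lC hCz q1 q3 lB hd hE0
    have hsq := sq_nonneg (v r)
    have wU := (hB.Hr.bd hB.H hr.1).1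
    refine ⟨h3.trans (mR lC q1 q2 q3 lB hd hE0), fun hw => ?_, fun hw => ?_, fun hw => ?_⟩
    · have i1 : s ≤ u r := by rw [hs]; exact max_le lB hη hw (min_le_right _ _)
      have i2 : w r ≤ s := by rw [hs]; exact le_max_of_le_right (le_min lA hη hw.le)
      have i3 := Qf_mono hm hb lC hB.h4 hη wU i2
      have i4 := mR i1 hsq
      linarith only [(abs_le.1 h4).1, h5, i3, i4, h4]
    · have i1 : u r ≤ s := by rw [hs]; exact le_max_of_le_right (le_min lB hη hw le_rfl)
      have i2 : s ≤ w r := by rw [hs]; exact max_le lA hη ((min_le_right _ _).trans hw.le)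
      have i3 := Qf_mono hm hb (hB.h4.trans_le s1) i2
      have i4 := mR i1 hsq
      linarith only [(abs_le.1 h4).2, h5, i3, i4, h4]
    · have := abs_le.1 hw
      rw [hs, cl_id ⟨ll, ll⟩] at h4
      exact h4.trans h5

lemma Sm.crude (hB : Bs_) (hN : 0 < N) : ∃ C > 0, ∃ δ1 > 0, ∀ (δ R : ℝ) (u u1 v v1 : ℝ → ℝ) (ρ c : ℝ), δ < δ1 →
    Sm_ → |ρ-rI| ≤ N*δ → ΛR |u r-w r| ≤ C*δ := by
  have ha := hB.H.ha; have hm := hB.H.hm; have hb := hB.H.hb; have hη := hB.η0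
  obtain ⟨C1, hC1, θ, hθ, δ1, hδ1, hp⟩ := Sm.pw hB
  set N' := max N θ
  have n1 : N ≤ N' := le_max_left _ _
  have n2 : θ ≤ N' := le_max_right _ _
  have n0 : 0 < N' := ll
  have hQ0 : 0 ≤ Qf m b a := by
    rw [(Vp_facts hm hb (hB.H.h4.trans hB.Ua)).2.2.2]; positivity
  set C0 := exp 1*(C1+Qf m b a+a/b^2+1) with hC0
  have he := add_one_le_exp (1:ℝ)
  have q1 : 0 < a/b^2 := pv
  have hC01 : 1 ≤ C0 := by
    rw [hC0]; exact one_le_mul_of_one_le_of_one_le ll ll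
  refine ⟨32*C0*N', pv, min δ1 (1/(2*N')), pv, ?_⟩
  intro δ R u u1 v v1 ρ c hδ h hρ
  have hd := h.d0
  have hε : 0 < N'*δ := pv
  have hε2 : N'*δ ≤ 1/2 := by
    have := hδ.trans_le (min_le_right _ _); rw [lt_div_iff₀ pv] at this; linarith
  have hR1 := h.R1; have hrI := hB.Hr.rI0
  have hδε : δ ≤ N'*δ := le_mul_of_one_le_left hd.le ll
  have hpw := hp δ R u u1 v v1 ρ c (hδ.trans_le (min_le_left _ _)) h
  have hwR := hB.Hr.bout R ll
  have hwR2 : a*exp (-(R-rI)) ≤ δ := by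
    have : exp (-(R-rI)) ≤ exp (-(R-rI-1)) := exp_le_exp.2 ll
    linarith [mL this ha.le, h.aR]
  have hend : δ ≤ 16*C0*(N'*δ) := hδε.trans (le_mul_of_one_le_left hε.le lC hC01 hε hε2)
  have B1 : ∀ r, C1*(eθ+δ) ≤ C0*(exp (-|r-rI|/(N'*δ))+N'*δ) := by
    intro r
    have t : |r-rI|/(N'*δ) ≤ |r-ρ|/(θ*δ)+1 := by
      have i : |r-rI| ≤ |r-ρ| + N'*δ := by
        linarith [abs_sub_le r ρ rI, mR n1 hd.le]
      calc |r-rI|/(N'*δ) ≤ (|r-ρ| + N'*δ)/(N'*δ) := by gcongr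
        _ = |r-ρ|/(N'*δ)+1 := by field_simp
        _ ≤ _ := by gcongr
    have t2 : eθ ≤ exp 1*exp (-|r-rI|/(N'*δ)) := by
      rw [← exp_add]; apply exp_le_exp.2; rw [neg_div, neg_div]; exact lA t
    calc C1*(eθ+δ) ≤ C1*(exp 1*(exp (-|r-rI|/(N'*δ))+N'*δ)) := by
          apply mL _ hC1.le; rw [mul_add]; exact add_le_add t2 (hδε.trans (le_mul_of_one_le_left hε.le lC he hε hε2))
      _ = (exp 1*C1)*(exp (-|r-rI|/(N'*δ))+N'*δ) := by ring
      _ ≤ _ := by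
        apply mR _ pv
        exact mL lD hQ0 q1 hε hε2 (exp_pos _).le
  have B2 : ∀ r, |r-rI| ≤ N*δ → Qf m b a+a/b^2 ≤ C0*(exp (-|r-rI|/(N'*δ))+N'*δ) := by
    intro r hr
    have t : |r-rI|/(N'*δ) ≤ 1 := by
      rw [div_le_one hε]; linarith [mR n1 hd.le]
    have t2 : 1 ≤ exp 1*exp (-|r-rI|/(N'*δ)) := by
      rw [← exp_add, one_le_exp_iff, neg_div]; exact lA t
    have t3 := mL t2 (show 0 ≤ C1+Qf m b a+a/b^2+1 from pv)
    have t4 : 0 ≤ C0*(N'*δ) := pv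
    rw [mul_add, hC0]; rw [hC0] at t4; linarith
  have Qw : ∀ r, 0 ≤ r → 0 ≤ Qf m b (w r) ∧ Qf m b (w r) ≤ Qf m b a := λh by
    obtain ⟨x1, x2⟩ := hB.Hr.bd hB.H hr
    have x3 := hB.H.h4.trans_le x1
    refine ⟨?_, Qf_mono hm hb x3 x2⟩
    have := hB.H.U0
    rw [(Vp_facts hm hb x3).2.2.2]; exact mul_nonneg ll (sq_nonneg _)
  have z0 := h.fs.Zu; have zw := hB.Hr.z
  have hρ' := abs_le.1 hρ
  have P1 := uc (D := λr u r-w r) (ρ := rI) (C0 := C0) le_rfl (show 0 < R from ll) hε hε2 ll (h.fs.cu.sub hB.Hr.cw).continuousOn (h.fs.Ru.sub (hB.Hr.rl R))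
    (Or.inr ⟨0-0, by norm_num, z0.sub zw⟩) mB h.fs.uR hwR.1 (fun r hr hD => by
      obtain ⟨p1, p2, p3, p4⟩ := hpw r (Ioo_subset_Icc_self hr)
      have e1 := B1 r
      have e0 : 0 ≤ C1*(eθ+δ) := pv
      have e2 := Qw r hr.1.le
      by_cases i1 : r < rI
      · simp only [i1, if_true]; exact lC p1 e1 e0
      · simp only [i1, if_false, Wf]; push Not at i1
        rcases le_total ρ r with i2 | i2
        · have := (p4 i2).2.1 lA hD; exact lB e1 this
        · have := B2 r (abs_le.2 ⟨by linarith [mul_pos hN hd], ll⟩); linarith)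
  have P2 := uc (D := λr w r-u r) (ρ := rI) (C0 := C0) le_rfl (show 0 < R from ll) hε hε2 ll (hB.Hr.cw.sub h.fs.cu).continuousOn ((hB.Hr.rl R).sub h.fs.Ru)
    (Or.inr ⟨0-0, by norm_num, zw.sub z0⟩) mB h.fs.uR hwR.2.2 (fun r hr hD => by
      obtain ⟨p1, p2, p3, p4⟩ := hpw r (Ioo_subset_Icc_self hr)
      have e1 := B1 r
      have e2 := Qw r hr.1.le
      rcases le_total r ρ with i2 | i2
      · have := (p3 i2).2
        split_ifs
        · exact lB e1 this
        · simp only [Wf]; linarith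
      · split_ifs with i1
        · have := B2 r (abs_le.2 ⟨by linarith [mul_pos hN hd], by linarith [mul_pos hN hd]⟩); linarith
        · have := (p4 i2).2.2.1 lA hD; simp only [Wf]; linarith only [e1, this])
  intro r hr
  have := P1 r hr; have := P2 r hr
  exact abs_le.2 ⟨ll, ll⟩

lemma gauss {w0 L r0 : ℝ} (hw : 0 < w0) (hL : 0 < L) (hr0 : 0 < r0) : ∃ K > 0, ∃ M > 0, ∀ ρ ≥ r0, ∃ φ φ1 G : ℝ → ℝ, (∀ r, φ r = exp (-(K*(r-ρ)^2))) ∧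
    (∀ r, HasDerivAt φ (φ1 r) r) ∧ (∀ r ≤ ρ, 0 ≤ φ1 r) ∧ (∀ p q, 0 ≤ p → RL p q φ φ1 G) ∧
    ∀ r > 0, (w0 ≤ |r-ρ| → L*φ r ≤ G r) ∧ (|r-ρ| < w0 → -M ≤ G r) := by
  obtain ⟨K, k1, k2, k3, k4⟩ : ∃ K ≥ (1:ℝ), 1 ≤ K*(w0*r0) ∧ 2 ≤ K*w0^2 ∧ L ≤ K*w0^2 := by
    refine ⟨max 1 (max (1/(w0*r0)) (max (2/w0^2) (L/w0^2))), le_max_left _ _, ?_, ?_, ?_⟩ <;> rw [← div_le_iff₀ pv]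
    · exact (le_max_left _ _).trans (le_max_right _ _)
    · exact ((le_max_left _ _).trans (le_max_right _ _)).trans (le_max_right _ _)
    · exact ((le_max_right _ _).trans (le_max_right _ _)).trans (le_max_right _ _)
  refine ⟨K, ll, 2*K+2*K*(w0/r0), pv, fun ρ hρ => ?_⟩
  let φ : ℝ → ℝ := λr exp (-(K*(r-ρ)^2))
  let φ1 : ℝ → ℝ := λr -(2*K*(r-ρ))*φ r
  have dφ : ∀ r, HasDerivAt φ (φ1 r) r := λr by
    have h1 : HasDerivAt (λr -(K*(r-ρ)^2)) (-(2*K*(r-ρ))) r :=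
      ((((hasDerivAt_id r).sub_const ρ).pow 2).const_mul K).neg.congr_deriv (by simp; ring)
    exact h1.exp.congr_deriv (by simp only [φ1, φ]; ring)
  have p0 : ∀ r, 0 < φ r := λr exp_pos _
  have p1 : ∀ r, φ r ≤ 1 := λr exp_le_one_iff.2 (by simp only [neg_nonpos]; positivity)
  refine ⟨φ, φ1, λr (4*K^2*(r-ρ)^2-2*K-2*K*((r-ρ)/r))*φ r, λ_ rfl, dφ, λh ?_, ?_, ?_⟩
  · exact mul_nonneg (by nlinarith) (p0 r).le
  · intro p q hp
    refine RL_of (w2 := λr (4*K^2*(r-ρ)^2-2*K)*φ r) (λR dφ r) (λR ?_) (λh by simp only [φ1]; ring)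
    have h1 : HasDerivAt (λr -(2*K*(r-ρ))) (-(2*K)) r :=
      (((hasDerivAt_id r).sub_const ρ).const_mul (2*K)).neg.congr_deriv (by simp)
    exact (h1.mul (dφ r)).congr_deriv (by simp only [φ1]; ring)
  · intro r hr
    have hdr : (r-ρ)/r ≤ |r-ρ|/r0 := by
      rcases le_total r ρ with h | h
      · exact (div_nonpos_of_nonpos_of_nonneg ll hr.le).trans pv
      · exact div_le_div₀ (abs_nonneg _) (le_abs_self _) hr0 ll
    beta_reduce
    rw [← sq_abs (r-ρ)]
    set s := |r-ρ| with hs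
    have s0 : 0 ≤ s := abs_nonneg _
    refine ⟨fun h => ?_, fun h => ?_⟩
    · apply mR _ (p0 r).le
      have e1 : s/r0 ≤ K*s^2 := by
        rw [div_le_iff₀ hr0]
        have : s*1 ≤ s*(K*(s*r0)) := mL (k2.trans (by gcongr)) s0
        linarith
      have e2 : w0^2 ≤ s^2 := by gcongr
      have e3 : K*w0^2 ≤ K*s^2 := by gcongr
      have e4 := mL hdr (show 0 ≤ 2*K from ll)
      have e5 := mL e1 (show 0 ≤ 2*K from ll)
      have e6 := mL (k3.trans e3) (show 0 ≤ K from ll)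
      have e7 := mL (k4.trans e3) (show 0 ≤ K from ll)
      have e8 : L ≤ K*L := le_mul_of_one_le_left hL.le k1
      exact lE e4 e5 e6 e7 e8
    · have e0 : (r-ρ)/r ≤ w0/r0 := hdr.trans (by gcongr)
      have e4 := mL e0 (show 0 ≤ 2*K from ll)
      have e5 : -(2*K+2*K*(w0/r0)) ≤ 4*K^2*s^2-2*K-2*K*((r-ρ)/r) := by linarith only [sq_nonneg (K*s), e4]
      have e6 := mR e5 (p0 r).le
      have e7 := mL (p1 r) (show 0 ≤ 2*K+2*K*(w0/r0) from pv)
      exact lB e6 e7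

lemma Qf_lip {x0 : ℝ} (hm : 0 < m) (hb : 0 < b) (hx0 : 4*m*b < x0) (X : ℝ) (hX : 0 < X) :
    ∃ l > 0, ∀ x y, x0 ≤ x → x0 ≤ y → y ≤ X → |Qf m b x-Qf m b y| ≤ l * |x-y| := by
  obtain ⟨l, hl, h⟩ := Vp_lip hm hb hx0
  refine ⟨(1/b)^2+X*(2*(1/b))*l, pv, fun x y hx hy hyX => ?_⟩
  have h00 : 0 < 4*m*b := pv
  obtain ⟨-, a1, a2, a3⟩ := Vp_facts hm hb (hx0.trans_le hx)
  obtain ⟨-, b1, b2, b3⟩ := Vp_facts hm hb (hx0.trans_le hy)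
  have a4 : Vp m b x ≤ 1/b := by rw [le_div_iff₀ hb]; linarith
  have b4 : Vp m b y ≤ 1/b := by rw [le_div_iff₀ hb]; linarith
  have a5 : 0 ≤ Vp m b x := ((mul_pos_iff_of_pos_left hb).1 ll).le
  have b5 : 0 ≤ Vp m b y := ((mul_pos_iff_of_pos_left hb).1 ll).le
  rw [a3, b3, show x*(Vp m b x)^2-y*(Vp m b y)^2 = (Vp m b x)^2*(x-y)+y*(Vp m b x+Vp m b y)*(Vp m b x-Vp m b y) by ring]
  refine (abs_add_le _ _).trans ?_
  rw [abs_mul, abs_mul _ (Vp m b x-Vp m b y), abs_of_nonneg (sq_nonneg _), abs_of_nonneg (show 0 ≤ y*(Vp m b x+Vp m b y) from mul_nonneg ll ll), add_mul]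
  refine add_le_add (mR (pow_le_pow_left₀ a5 a4 2) (abs_nonneg _)) ?_
  rw [mul_assoc (X*(2*(1/b)))]
  exact mul_le_mul (mul_le_mul hyX lB a4 b4 ll hX.le) (h x y hx hy) (abs_nonneg _) pv

lemma Sm.sh (hB : Bs_) {w0 g : ℝ} (hw0 : 0 < w0) (hg : 0 < g) : ∃ K > 0, ∃ k > 0, ∃ C > 0, ∃ δ1 > 0,
    ∀ (δ R : ℝ) (u u1 v v1 : ℝ → ℝ) (ρ c : ℝ), δ < δ1 → Sm_ → (ΛR |u r-w r| ≤ η) →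
    ∀ (N p σ : ℝ) (x x1 gn : ℝ → ℝ), 0 < N → 0 ≤ p → p < ρ → N*exp (-(K*(R-ρ)^2)) ≤ 1 → (σ = 1 ∨ σ = -1) → Continuous x →
    RL p R x x1 (λr (if r < ρ then x r-a else Wf a m b (x r))+σ*gn r) → (∀ r ∈ Ioo p R, 0 ≤ gn r ∧ (|r-ρ| < w0 → g*(N*δ) ≤ gn r)) →
    (∃ d ≥ 0, HasDerivWithinAt (λr σ*(x r-u r)) d (Ici p) p) → σ*(x R-u R) ≤ δ → (∀ r ∈ Icc p R, U ≤ x r ∧ x r ≤ a) →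
    σ*(x ρ-u ρ)+k*(N*δ) ≤ C*δ := by
  have ha := hB.H.ha; have hm := hB.H.hm; have hb := hB.H.hb; have hη := hB.η0
  obtain ⟨C1, hC1, θ, hθ, δ1, hδ1, hp⟩ := Sm.pw hB
  obtain ⟨l, hl, hQ⟩ := Qf_lip hm hb hB.h4 a ha
  obtain ⟨K, hK, M, hM, hG⟩ := gauss hw0 (show 0 < 1+l from ll) (show 0 < 2*rI/3 from mA hB.Hr.rI0)
  set k := g/(M+(1+l)) with hk
  have hk0 : 0 < k := pv
  have hθ0 : 0 < θ := ll
  refine ⟨K, hK, k, hk0, 32*(C1+1+k)*θ, pv, min δ1 (1/(2*θ)), pv, ?_⟩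
  intro δ R u u1 v v1 ρ c hδ h huw N p σ x x1 gn hN hp0 hpρ hNR hσ cx hx hgn hd hR hxb
  have hpw := hp δ R u u1 v v1 ρ c (hδ.trans_le (min_le_left _ _)) h
  obtain ⟨φ, φ1, G, e, dφ, s1, rl, hGG⟩ := hG ρ h.ρ1
  have hδ0 := h.d0
  have hρR := h.ρR
  have p0 : ∀ r, 0 < φ r := λr by rw [e]; exact exp_pos _
  have p1 : ∀ r, φ r ≤ 1 := λr by rw [e]; exact exp_le_one_iff.2 (by simp only [neg_nonpos]; positivity)
  have hθδ : 0 < θ*δ := pv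
  have hkt : 0 < k*(N*δ) := pv
  have hdθ : δ ≤ θ*δ := le_mul_of_one_le_left hδ0.le hθ
  obtain ⟨d, hd0, hd⟩ := hd
  have hRR : RL p R (λr σ*(x r-u r)+k*(N*δ)*φ r) (λr σ*(x1 r-u1 r)+k*(N*δ)*φ1 r)
      (λr σ*((if r < ρ then x r-a else Wf a m b (x r))+σ*gn r-(u r*(1+(v r)^2)-a))+k*(N*δ)*G r) := by
    intro r hr
    obtain ⟨a1, a2⟩ := hx r hr
    obtain ⟨b1, b2⟩ := h.fs.Ru r ⟨hp0.trans_lt hr.1, hr.2⟩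
    obtain ⟨c1, c2⟩ := rl p R hp0 r hr
    exact ⟨((a1.sub b1).const_mul σ).add (c1.const_mul _), (((a2.sub b2).const_mul σ).add (c2.const_mul _)).congr_deriv (by ring)⟩
  have hσ2 : σ*σ = 1 := by rcases hσ with h | h <;> rw [h] <;> norm_num
  have key := uc (D := λr σ*(x r-u r)+k*(N*δ)*φ r) (ρ := ρ) (C0 := C1+1+k) hp0 (show p < R from ll) hθδ (by
      have := hδ.trans_le (min_le_right _ _); rw [lt_div_iff₀ pv] at this; linarith) ll
    (((continuous_const.mul (cx.sub h.fs.cu)).add (continuous_const.mul (continuous_iff_continuousAt.2 λr (dφ r).continuousAt))).continuousOn) hRR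
    (Or.inr ⟨d+k*(N*δ)*φ1 p, add_nonneg hd0 (mul_nonneg hkt.le (s1 p hpρ.le)), hd.add ((dφ p).hasDerivWithinAt.const_mul _)⟩) (by
      have i1 : k*(N*δ)*φ R ≤ k*δ := by
        rw [e]; linarith [mL hNR (show 0 ≤ k*δ from pv)]
      have i2 : (1+k)*δ ≤ (1+k)*(θ*δ) := mL hdθ ll
      have i3 : 0 ≤ (16*C1+15*(1+k))*(θ*δ) := pv
      show σ*(x R-u R)+k*(N*δ)*φ R ≤ _
      linarith only [hR, i1, i2, i3]) (fun r hr hD => by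
      replace hD : 0 < σ*(x r-u r)+k*(N*δ)*φ r := hD
      have hr0 : r ∈ Icc 0 R := ⟨hp0.trans hr.1.le, hr.2.le⟩
      obtain ⟨q1, q2, q3, q4⟩ := hpw r hr0
      obtain ⟨g1, g2⟩ := hgn r hr
      obtain ⟨G1, G2⟩ := hGG r (hp0.trans_lt hr.1)
      obtain ⟨x1, x2⟩ := hxb r (Ioo_subset_Icc_self hr)
      have huw' := abs_le.1 (huw r hr0)
      have hwb := hB.Hr.bd hB.H hr0.1
      obtain ⟨-, ua⟩ := h.fs.ub r hr0
      have hu1 : U-η ≤ u r := ll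
      set E := eθ
      have hE0 : 0 < E := exp_pos _
      set ψ := k*(N*δ)*φ r with hψ
      have hψ0 : 0 < ψ := mul_pos hkt (p0 r)
      have T : σ*(x r-u r)+ψ-(1+l)*ψ-C1*(E+δ) ≤ σ*((if r < ρ then x r-a else Wf a m b (x r))-(u r*(1+(v r)^2)-a)) := by
        have hlψ : 0 < l*ψ := pv
        split_ifs with i
        · have := (q3 i.le).2
          rcases hσ with hh | hh <;> rw [hh] <;> linarith
        · have i1 := abs_le.1 ((q4 (not_lt.1 i)).2.2.2 (huw r hr0))
          have i2 := hQ (x r) (u r) ll hu1 ua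
          unfold Wf
          rcases le_total (x r) (u r) with j | j
          · have j1 := Qf_mono hm hb (hB.H.h4.trans_le x1) j
            rw [abs_of_nonpos ll, abs_of_nonpos ll] at i2
            rcases hσ with hh | hh <;> rw [hh] at hD ⊢
            · have := mL (show u r-x r ≤ ψ from ll) hl.le
              linarith
            · linarith
          · have j1 := Qf_mono hm hb (hB.h4.trans_le hu1) j
            rw [abs_of_nonneg ll, abs_of_nonneg ll] at i2
            rcases hσ with hh | hh <;> rw [hh] at hD ⊢
            · linarith
            · have := mL (show x r-u r ≤ ψ from ll) hl.le
              linarith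
      have T2 : (1+l)*ψ ≤ gn r+k*(N*δ)*G r := by
        rcases lt_or_ge |r-ρ| w0 with i | i
        · have j1 := mL (G2 i) hkt.le
          have j2 := g2 i
          have j3 := mL (p1 r) hkt.le
          have j5 := mL j3 (show 0 ≤ 1+l from ll)
          have j4 : g*(N*δ) = k*(N*δ)*(M+(1+l)) := by rw [hk]; field_simp
          exact lD j1 j2 j5 j4
        · have := mL (G1 i) hkt.le
          exact lB g1 this
      have T3 : C1*(E+δ) ≤ (C1+1+k)*(E+θ*δ) := mul_le_mul ll ll pv ll
      have T4 : σ*((if r < ρ then x r-a else Wf a m b (x r))+σ*gn r-(u r*(1+(v r)^2)-a)) =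
        σ*((if r < ρ then x r-a else Wf a m b (x r))-(u r*(1+(v r)^2)-a))+gn r := by linear_combination gn r*hσ2
      beta_reduce
      rw [T4]
      linarith only [T, T2, T3]) ρ ⟨hpρ.le, ll⟩
  have e1 : φ ρ = 1 := by rw [e]; simp
  beta_reduce at key
  rw [e1] at key
  linarith

lemma RL_shift (h : ∀ R, RL 0 R w w1 f) (hp : 0 ≤ p+τ) (q : ℝ) :
    RL p q (λr w (r+τ)) (λr w1 (r+τ)) (λr f (r+τ)+(w1 (r+τ)/r-w1 (r+τ)/(r+τ))) := by
  intro r hr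
  obtain ⟨h1, h2⟩ := h (r+τ+1) (r+τ) ⟨mA hr.1, ll⟩
  refine ⟨h1.comp_add_const r τ, ?_⟩
  exact (HasDerivWithinAt.comp r h2 (((hasDerivAt_id r).add_const τ).hasDerivWithinAt) (fun s hs => by
    simp only [mem_Ici, id] at *; linarith)).congr_deriv (by ring)

lemma Sm.face (hB : Bs_) : ∃ K > 0, ∃ k > 0, ∃ C > 0, ∀ N > 0, ∃ δ1 > 0,
    ∀ (δ R : ℝ) (u u1 v v1 : ℝ → ℝ) (ρ c σ : ℝ), δ < δ1 → Sm_ → N*exp (-(K*(R-ρ)^2)) ≤ 1 →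
    (σ = 1 ∨ σ = -1) → 3*(N*δ) ≤ rI → ρ = rI+σ*(N*δ) → σ*(b9-u ρ)+k*(N*δ) ≤ C*δ := by
  have ha := hB.H.ha; have hη := hB.η0; have hrI := hB.Hr.rI0; have hd1 := hB.Hr.d10
  obtain ⟨w0, hw0, hw01, hw⟩ : ∃ w0 > 0, w0 ≤ 1 ∧ ∀ s, |s-rI| < w0 → w1 s ≤ -(d1*rI/4) := by
    have h1 := hB.Hr.slope rI ⟨hrI, le_rfl⟩
    have h2 : ContinuousAt w1 rI := (hB.Hr.cw1 rI hrI).continuousAt (Ioi_mem_nhds hrI)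
    have h3 := h2.eventually (gt_mem_nhds (show w1 rI < -(d1*rI/4) by nlinarith [mul_pos hd1 hrI]))
    obtain ⟨e, he, h4⟩ := Metric.eventually_nhds_iff.1 h3
    exact ⟨min e 1, pv, min_le_right _ _, fun s hs => (h4 (by rw [Real.dist_eq]; exact hs.trans_le (min_le_left _ _))).le⟩
  have hg : 0 < d1*rI/4/(rI+2)^2 := pv
  obtain ⟨K, hK, k, hk, C, hC, δa, hδa, hs⟩ := Sm.sh hB hw0 hg
  obtain ⟨C1, hC1, θ, hθ, δb, hδb, hpw⟩ := Sm.pw hB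
  refine ⟨K, hK, k, hk, C, hC, fun N hN => ?_⟩
  obtain ⟨Cc, hCc, δc, hδc, hcr⟩ := Sm.crude hB hN
  refine ⟨min (min δa δb) (min δc (min (η/Cc) (d1/(Cc+C1*(θ/rI+1))))), pv, ?_⟩
  intro δ R u u1 v v1 ρ c σ hδ h hNR hσ hN3 hρ
  simp only [lt_min_iff] at hδ
  obtain ⟨⟨l1, l2⟩, l3, l4, l5⟩ := hδ
  have hd := h.d0
  have ht : 0 < N*δ := pv
  have hρ2 := abs_le.1 h.ρ2
  have hρrI : |ρ-rI| ≤ N*δ := by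
    rw [hρ]; rcases hσ with hh | hh <;> rw [hh] <;> exact abs_le.2 ⟨ll, ll⟩
  have huw0 := hcr δ R u u1 v v1 ρ c l3 h hρrI
  have hcη : Cc*δ ≤ η := by rw [lt_div_iff₀ hCc] at l4; linarith
  have hρR := h.ρR; have hR1 := h.R1
  have BC : ∃ p, 0 ≤ p ∧ p < ρ ∧ 0 ≤ p + -σN ∧ ∃ d ≥ 0, HasDerivWithinAt (λr σ*(w (r + -σN)-u r)) d (Ici p) p := by
    rcases hσ with hh | hh
    · subst hh
      have htR : N*δ ∈ Ioo 0 R := ⟨ht, lD hN3 ht hR1 hρ⟩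
      have i1 : u1 Nδ ≤ 0 := h.fs.u1n _ htR (fun s hs => by
        have hs' : s ∈ Icc 0 R := ⟨hs.1.le, hs.2.le.trans htR.2.le⟩
        have j1 := (abs_le.1 (huw0 s hs')).2
        have j2 := (hB.Hr.bin s ⟨hs.1.le, mA hs.2⟩).2
        have j3 := ((hpw δ R u u1 v v1 ρ c l2 h s hs').2.2.1 mA hs.2).2
        have j4 : exp (-|s-ρ|/(θ*δ)) ≤ θ/rI*δ := by
          have e1 : rI ≤ |s-ρ| := by rw [abs_of_nonpos lD hs.2 hN3 ht hρ]; exact lB hs.2 hρ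
          have e2 := add_one_le_exp (|s-ρ|/(θ*δ))
          have e3 : rI/(θ*δ) ≤ |s-ρ|/(θ*δ) := by gcongr
          rw [neg_div, exp_neg, show θ/rI*δ = (rI/(θ*δ))⁻¹ by field_simp]
          exact inv_anti₀ pv lD ht hρ e2 e3
        have j5 := mL (add_le_add_left j4 δ) hC1.le
        rw [lt_div_iff₀ pv] at l5
        linarith only [l5, j1, j2, j3, j5])
      have i2 : HasDerivWithinAt (λr w (r + -(1*(N*δ)))) 0 (Ici Nδ) Nδ :=
        (HasDerivWithinAt.comp Nδ (h₂ := w) (h := λr r + -(1*(N*δ))) (s' := Ici 0) (h₂' := 0) (by simpa using hB.Hr.z) (((hasDerivAt_id _).add_const _).hasDerivWithinAt)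
          (fun s hs => by simp only [mem_Ici] at *; linarith)).congr_deriv (by ring)
      exact ⟨N*δ, ht.le, lC hN3 ht hρ, ll, 1*(0-u1 Nδ), ll, (i2.sub (h.fs.Ru _ htR).1.hasDerivWithinAt).const_mul _⟩
    · subst hh
      have i3 : HasDerivAt (λr w (r + -(-1*(N*δ)))) (w1 (0 + -(-1*(N*δ)))) 0 :=
        ((hB.Hr.rl (N*δ+1) (0 + -(-1*(N*δ))) ⟨ll, ll⟩).1).comp_add_const 0 _
      have i4 := hB.Hr.neg (0 + -(-1*(N*δ))) ll
      exact ⟨0, le_rfl, ll, ll, _, ll, (i3.hasDerivWithinAt.sub h.fs.Zu).const_mul _⟩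
  obtain ⟨p, p0, pρ, pτ, d, d0, hdd⟩ := BC
  have hst : σ*(N*δ) ≤ N*δ ∧ -Nδ ≤ σ*(N*δ) := by
    rcases hσ with hh | hh <;> rw [hh] <;> constructor <;> linarith
  have hN12 : N*δ ≤ 1/2 := by
    have := h.ρ2; rw [hρ] at this
    rcases hσ with hh | hh <;> rw [hh] at this <;> have := abs_le.1 this <;> linarith
  have fin := hs δ R u u1 v v1 ρ c l1 h (λh (huw0 r hr).trans hcη) N p σ (λr w (r + -σN)) (λr w1 (r + -σN))
    (λr σ*(w1 (r + -σN)/r-w1 (r + -σN)/(r + -σN))) hN p0 pρ hNR hσ (hB.Hr.cw.comp (by fun_prop))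
    ((RL_shift hB.Hr.rl pτ R).congr (fun _ _ => rfl) (λh by
      have e1 : σ*(σ*(w1 (r + -σN)/r-w1 (r + -σN)/(r + -σN))) = w1 (r + -σN)/r-w1 (r + -σN)/(r + -σN) := by
        rcases hσ with hh | hh <;> rw [hh] <;> ring
      rw [e1]
      have e2 : (r + -σN < rI) ↔ r < ρ := by rw [hρ]; constructor <;> intro <;> linarith
      simp only [e2])) (λh by
      have r0 : 0 < r := lB hr.1 p0
      have r1 : 0 < r + -σN := lB hr.1 pτ
      have e3 : σ*(w1 (r + -σN)/r-w1 (r + -σN)/(r + -σN)) = (-w1 (r + -σN))*(N*δ)/(r*(r + -σN)) := by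
        rw [div_sub_div _ _ r0.ne' r1.ne', mul_div_assoc']
        congr 1
        have : σ*σ = 1 := by rcases hσ with hh | hh <;> rw [hh] <;> norm_num
        linear_combination (-w1 (r + -σN)*(N*δ))*this
      beta_reduce
      rw [e3]
      refine ⟨div_nonneg (mul_nonneg (by linarith only [hB.Hr.neg _ r1, r1]) ht.le) pv, fun hi => ?_⟩
      have hi' := abs_lt.1 hi
      have i1 := hw (r + -σN) (by rwa [show r + -σN-rI = r-ρ by rw [hρ]; ring])
      have i2 : r*(r + -σN) ≤ (rI+2)^2 := by
        rw [sq]; exact mul_le_mul ll ll r1.le ll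
      calc d1*rI/4/(rI+2)^2*(N*δ) = (d1*rI/4)*(N*δ)/(rI+2)^2 := by ring
        _ ≤ _ := div_le_div₀ (mul_nonneg (by linarith only [mul_pos hd1 hrI, i1, hd1, hrI]) ht.le) (mR lA i1 ht.le) pv i2)
    ⟨d, d0, hdd⟩ (by
      have j1 := hB.Hr.bout (R + -σN) ll
      have j2 : exp (-(R + -σN-rI)) ≤ exp (-(R-rI-1)) := exp_le_exp.2 ll
      have j3 := mL j2 ha.le
      have j4 := h.aR
      beta_reduce
      rw [h.fs.uR]
      rcases hσ with hh | hh
      · subst hh; linarith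
      · subst hh; linarith) (λh hB.Hr.bd hB.H mA hr.1)
  beta_reduce at fin
  rwa [show ρ + -σN = rI by rw [hρ]; ring, hB.Hr.wI] at fin

noncomputable def Hp (m b x y : ℝ) : ℝ := m*y^2/2-x*y^3/3+x*b*y^4/4
noncomputable def Hu (b y : ℝ) : ℝ := b*y^4/4-y^3/3

lemma int_bd {C : ℝ} (hpq : p ≤ q) (hε : 0 < ε) (hC : 0 ≤ C) (hc : ContinuousOn f (Icc p q))
    (h : Λp HasDerivWithinAt f (f' r) (Ici r) r) (hσ : σ = 1 ∨ σ = -1) (hs : ΛI σ*(r-ρ) ≤ 0)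
    (hb : Λp |f' r| ≤ C*(exp (σ*(r-ρ)/ε)+δ)) : |f q-f p| ≤ C*(2*ε+δ*(q-p)) := by
  let g : ℝ → ℝ := λr C*(σ*ε*exp (σ*(r-ρ)/ε)+δ*r)
  have dg : ∀ r, HasDerivAt g (C*(exp (σ*(r-ρ)/ε)+δ)) r := λr by
    have h1 : HasDerivAt (λr σ*(r-ρ)/ε) (σ/ε) r := ((((hasDerivAt_id r).sub_const ρ).const_mul σ).div_const ε).congr_deriv (by ring)
    refine ((((h1.exp).const_mul (σ*ε)).add ((hasDerivAt_id r).const_mul δ)).const_mul C).congr_deriv ?_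
    have : σ*σ = 1 := by rcases hσ with hh | hh <;> rw [hh] <;> norm_num
    field_simp
    linear_combination (C*exp (σ*(r-ρ)/ε))*this
  have cg : Continuous g := continuous_iff_continuousAt.2 λr (dg r).continuousAt
  have gb : g q-g p ≤ C*(2*ε+δ*(q-p)) := by
    have e1 : ΛI exp (σ*(r-ρ)/ε) ≤ 1 := λh exp_le_one_iff.2 (div_nonpos_of_nonpos_of_nonneg (hs r hr) hε.le)
    have e2 := e1 p ⟨le_rfl, hpq⟩; have e3 := e1 q ⟨hpq, le_rfl⟩
    have e4 := exp_pos (σ*(p-ρ)/ε); have e5 := exp_pos (σ*(q-ρ)/ε)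
    have : g q-g p = C*(ε*(σ*(exp (σ*(q-ρ)/ε)-exp (σ*(p-ρ)/ε)))+δ*(q-p)) := by simp only [g]; ring
    rw [this]
    refine mL (add_le_add_left ?_ _) hC
    rw [mul_comm 2]
    refine mL ?_ hε.le
    rcases hσ with hh | hh <;> rw [hh] at e2 e3 e4 e5 ⊢ <;> linarith
  have m1 := mono_right (f := λr g r-f r) hpq (cg.continuousOn.sub hc) (λh (dg r).hasDerivWithinAt.sub (h r hr)) (λh by
    linarith [(abs_le.1 (hb r hr)).2])
  have m2 := mono_right (f := λr g r+f r) hpq (cg.continuousOn.add hc) (λh (dg r).hasDerivWithinAt.add (h r hr)) (λh by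
    linarith [(abs_le.1 (hb r hr)).1])
  beta_reduce at m1 m2
  exact abs_le.2 ⟨ll, ll⟩

lemma Hp_d {x' y' : ℝ} {s : Set ℝ} (hu : HasDerivWithinAt u x' s r) (hv : HasDerivWithinAt v y' s r) (ex : u r = x) (ey : v r = y) :
    HasDerivWithinAt (λr Hp m b (u r) (v r)) (Hu b y*x'+hf m b x y*y') s r := by
  subst ex ey
  refine (((((hv.pow 2).const_mul m).div_const 2).sub ((hu.mul (hv.pow 3)).div_const 3)).add (((hu.mul_const b).mul (hv.pow 4)).div_const 4)).congr_deriv ?_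
  simp only [Hu, hf, Pi.mul_apply, Pi.pow_apply]; push_cast; ring

lemma en {C : ℝ} {P Z Z1 : ℝ → ℝ} (hp : 0 < p) (hpq : p ≤ q) (hε : 0 < ε) (hC : 0 ≤ C) (hδ : 0 < δ)
    (cu : Continuous u) (cv : Continuous v) (cP : ContinuousOn P (Icc p q)) (cZ : ContinuousOn Z (Icc p q))
    (du : Λp HasDerivAt u (u1 r) r) (dZ : Λp HasDerivAt Z (Z1 r) r)
    (hv : RL p q v P (λr hf m b (u r) (v r)/δ^2)) (hσ : σ = 1 ∨ σ = -1) (hs : ΛI σ*(r-ρ) ≤ 0)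
    (hb : Λp |2*r*(Hp m b (u r) (v r)-Z r)+r^2*(Hu b (v r)*u1 r-Z1 r)| ≤ C*(exp (σ*(r-ρ)/ε)+δ)) :
    |q^2*(δ^2*(P q)^2/2-(Hp m b (u q) (v q)-Z q))-p^2*(δ^2*(P p)^2/2-(Hp m b (u p) (v p)-Z p))| ≤ C*(2*ε+δ*(q-p)) := by
  refine int_bd (f := λr r^2*(δ^2*(P r)^2/2-(Hp m b (u r) (v r)-Z r))) (f' := λr -(2*r*(Hp m b (u r) (v r)-Z r)+r^2*(Hu b (v r)*u1 r-Z1 r)))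
    hpq hε hC ?_ (λh ?_) hσ hs (λh by rw [abs_neg]; exact hb r hr)
  · have : Continuous (λr Hp m b (u r) (v r)) := by unfold Hp; fun_prop
    exact (continuousOn_id.pow 2).mul ((((cP.pow 2).const_mul _).div_const 2).sub (this.continuousOn.sub cZ))
  · obtain ⟨h1, h2⟩ := hv r hr
    have h3 := Hp_d (m := m) (b := b) (du r hr).hasDerivWithinAt h1.hasDerivWithinAt (s := Ici r) rfl rfl
    have r0 : r ≠ 0 := mA hr.1
    have i2 := ((((h2.pow 2).const_mul (δ^2)).div_const 2).sub (h3.sub (dZ r hr).hasDerivWithinAt))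
    refine (((hasDerivWithinAt_id r (Ici r)).pow 2).mul i2).congr_deriv ?_
    simp only [id, Pi.pow_apply, Pi.sub_apply, Nat.cast_ofNat]
    field_simp
    ring

lemma Hm_d (hm : 0 < m) (hb : 0 < b) (hx : 4*m*b < x) : HasDerivAt (λs Hp m b s (Vp m b s)) (Hu b (Vp m b x)) x := by
  have hmb : 0 < 4*m*b := pv
  have hx0 : 0 < x := ll
  have hy : 0 < 1-4*m*b/x := by rw [sub_pos, div_lt_one hx0]; exact hx
  have hd : DifferentiableAt ℝ (Vp m b) x := by
    unfold Vp
    have : DifferentiableAt ℝ (λs 1-4*m*b/s) x := by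
      refine (differentiableAt_const _).sub ((differentiableAt_const _).div differentiableAt_id hx0.ne')
    exact ((this.sqrt hy.ne').const_add 1).div_const _
  have h := Hp_d (m := m) (b := b) (s := univ) (u := id) (hasDerivAt_id x).hasDerivWithinAt hd.hasDerivAt.hasDerivWithinAt rfl rfl
  rw [hasDerivWithinAt_univ] at h
  refine h.congr_deriv ?_
  rw [hf_fac hm hb (by exact hx)]; simp

lemma Hm_eq (hm : 0 < m) (hb : 0 < b) (hx : 4*m*b < x) : Hp m b x (Vp m b x) = x*(Vp m b x)^3*b/4*(2/(3*b)-Vp m b x) := by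
  have h := (Vp_facts hm hb hx).1
  set y := Vp m b x
  have e : b*(2/(3*b)) = 2/3 := by field_simp
  unfold Hp
  linear_combination (-(y^2/2))*h-(x*y^3/4)*e

lemma Vp_low (hm : 0 < m) (hb : 0 < b) (hx : 4*m*b < x) (hxy : x ≤ y) (hy : y ≤ a) : m/a^2*(y-x) ≤ Vp m b y-Vp m b x := by
  have hmb : 0 < 4*m*b := pv
  obtain ⟨x1, x2, x3, -⟩ := Vp_facts hm hb hx
  obtain ⟨y1, y2, y3, -⟩ := Vp_facts hm hb (hx.trans_le hxy)
  have h := Vp_mono hm hb hx hxy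
  set X := Vp m b x
  set Y := Vp m b y
  have e : x*y*((Y-X)*(b*(X+Y)-1)) = m*(y-x) := by linear_combination y*x1-x*y1
  have i1 : (Y-X)*(b*(X+Y)-1) ≤ Y-X := mul_le_of_le_one_right ll ll
  have i2 : m*(y-x) ≤ x*y*(Y-X) := by rw [← e]; exact mL i1 (mul_nonneg ll ll)
  have i3 : x*y*(Y-X) ≤ a^2*(Y-X) := by
    rw [sq]; exact mR (mul_le_mul ll hy ll ll) ll
  have ha : 0 < a := ll
  rw [div_mul_eq_mul_div, div_le_iff₀ pv]
  linarith

lemma HpHu {z : ℝ} (hm : 0 < m) (hb : 0 < b) (hx : 0 ≤ x) (hxa : x ≤ a) (hy : 0 ≤ y) (hyb : y ≤ 1/b) (hz : 0 ≤ z) (hzb : z ≤ 1/b) :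
    |Hp m b x y-Hp m b x z| ≤ (m/b+2*a/b^2)*|y-z| ∧ |Hu b y-Hu b z| ≤ 2/b^2*|y-z| := by
  have eb : b*(1/b) = 1 := by field_simp
  have e1 : m/b = m*(1/b) := by ring
  have e2 : 2*a/b^2 = 2*a*(1/b)^2 := by field_simp
  have e3 : 2/b^2 = 2*(1/b)^2 := by field_simp
  rw [e1, e2, e3]
  set β := 1/b
  have hβ : 0 ≤ β := hy.trans hyb
  have y2 : y^2 ≤ β^2 := pow_le_pow_left₀ hy hyb 2
  have z2 : z^2 ≤ β^2 := pow_le_pow_left₀ hz hzb 2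
  have yz : y*z ≤ β^2 := by rw [sq]; exact mul_le_mul hyb hzb hz hβ
  set A := b*(y+z)*(y^2+z^2)/4 with hA
  set B := (y^2+y*z+z^2)/3 with hB
  have A0 : 0 ≤ A := pv
  have B0 : 0 ≤ B := pv
  have A1 : A ≤ β^2 := by
    have i1 : b*(y+z) ≤ 2 := by have := mL (add_le_add hyb hzb) hb.le; exact lB eb this
    have := mul_le_mul i1 (add_le_add y2 z2) pv (by norm_num); exact lB hA this
  have B1 : B ≤ β^2 := lD y2 z2 yz hB
  have h1 : Hp m b x y-Hp m b x z = (m*(y+z)/2+x*(A-B))*(y-z) := by simp only [Hp, hA, hB]; ring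
  have h2 : Hu b y-Hu b z = (A-B)*(y-z) := by simp only [Hu, hA, hB]; ring
  rw [h1, h2, abs_mul, abs_mul]
  have hAB : |A-B| ≤ 2*β^2 := abs_le.2 ⟨by linarith [sq_nonneg β], by linarith [sq_nonneg β]⟩
  refine ⟨mR ?_ (abs_nonneg _), mR hAB (abs_nonneg _)⟩
  refine (abs_add_le _ _).trans ?_
  rw [abs_of_nonneg pv, abs_mul, abs_of_nonneg hx]
  linarith [mul_le_mul hxa hAB (abs_nonneg _) (hx.trans hxa), mL (add_le_add hyb hzb) hm.le]

lemma exp_le_div (hx : 0 < x) : exp (-x) ≤ 1/x := by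
  rw [exp_neg, ← one_div]; exact one_div_le_one_div_of_le hx (by linarith [add_one_le_exp x])

set_option maxHeartbeats 1000000 in
lemma Sm.en (hB : Bs_) : ∃ C > 0, ∃ δ1 > 0, ∀ (δ R : ℝ) (u u1 v v1 : ℝ → ℝ) (ρ c : ℝ), δ < δ1 →
    Sm_ → (ΛR |u r-w r| ≤ η) →
    |ρ^2*(δ^2*(v1 ρ)^2/2-Hp m b (u ρ) (v ρ))| ≤ C*δ ∧
    |ρ^2*(δ^2*(v1 ρ+c/ρ)^2/2-(Hp m b (u ρ) (v ρ)-Hp m b (u ρ) (Vp m b (u ρ))))| ≤ C*δ := by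
  have ha := hB.H.ha; have hm := hB.H.hm; have hb := hB.H.hb; have hη := hB.η0; have hrI := hB.Hr.rI0; have hx0 := hB.x0
  obtain ⟨C1, hC1, θ, hθ, δ1, hδ1, hpw⟩ := Sm.pw hB
  have hb0 := hB.b0
  have hθ0 : 0 < θ := ll
  obtain ⟨K0, hK0⟩ : ∃ K0, K0 = B0+2*a+(a*(1+(1/b)^2)+a) := ⟨_, rfl⟩
  obtain ⟨c1, hc1⟩ : ∃ c1, c1 = m/b+2*a/b^2 := ⟨_, rfl⟩
  have hK00 : 0 < K0 := by rw [hK0]; positivity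
  have hc10 : 0 < c1 := by rw [hc1]; positivity
  obtain ⟨M, hM⟩ : ∃ M, M = 2*(rI+1)*c1+(rI+1)^2*(2/b^2*K0) := ⟨_, rfl⟩
  have hM0 : 0 < M := by rw [hM]; positivity
  refine ⟨M*C1*(2*θ+(rI+1))+1+(rI+1)^2*(8/b^2+c1*(C1*(4*θ+1))), pv, min δ1 1, pv, ?_⟩
  intro δ R u u1 v v1 ρ c hδ h huw
  obtain ⟨l1, l2⟩ := lt_min_iff.1 hδ
  have hp := hpw δ R u u1 v v1 ρ c l1 h
  have hd := h.d0; have hρR := h.ρR; have hρ1 := h.ρ1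
  have hρ2 := (abs_le.1 h.ρ2).2
  have hρ0 : 0 < ρ := lB hrI hρ1
  have hcl : ΛR cl (w r-η) (w r+η) (u r) = u r := λh by
    have := abs_le.1 (huw r hr); exact cl_id ⟨ll, ll⟩
  have hu4 : ΛR U-η ≤ u r := λh by rw [← hcl r hr]; exact (hB.sb hr.1).1
  have bnd : ΛR r ≤ rI+1 → ∀ z, 0 ≤ z → z ≤ 1/b → |v r-z| ≤ 1/b ∧ (0 < r → r < R →
      |2*r*(Hp m b (u r) (v r)-Hp m b (u r) z)+r^2*(Hu b (v r)*u1 r-Hu b z*u1 r)| ≤ M*|v r-z|) ∧ |Hp m b (u r) (v r)-Hp m b (u r) z| ≤ c1*|v r-z| := by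
    intro r hr hr1 z hz hzb
    obtain ⟨u0, ua⟩ := h.fs.ub r hr
    obtain ⟨v0, vb⟩ := h.vb hB.H r hr
    obtain ⟨g1, g2⟩ := HpHu hm hb u0 ua v0 vb hz hzb
    rw [← hc1] at g1
    refine ⟨abs_le.2 ⟨lB hzb v0, lB hz vb⟩, fun r0 rR => ?_, g1⟩
    have g3 := h.K hB r ⟨r0, rR⟩
    rw [← hK0] at g3
    rw [← sub_mul]
    refine (abs_add_le _ _).trans ?_
    rw [abs_mul, abs_mul (r^2), abs_mul (Hu b (v r)-Hu b z), abs_of_pos (show 0 < 2*r from ll), abs_of_pos (show 0 < r^2 from pv), hM, add_mul]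
    refine add_le_add ?_ ?_
    · rw [mul_assoc _ c1]; exact mul_le_mul lA hr1 g1 (abs_nonneg _) pv
    · rw [mul_assoc]
      refine mul_le_mul (by gcongr) ?_ pv pv
      calc _ ≤ (2/b^2*|v r-z|)*K0 := mul_le_mul g2 g3 (abs_nonneg _) pv
        _ = _ := by ring
  have fin1 : ∀ X, X ≤ rI+1 → M*C1*(2*(θ*δ)+δ*X) ≤ M*C1*(2*θ+(rI+1))*δ := fun X hX => by
    rw [mul_assoc (M*C1) (2*θ+(rI+1))]; refine mL ?_ pv
    have := mL hX hd.le; exact lA this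
  constructor
  · obtain ⟨B, hBv⟩ := h.fs.v1b
    have hBB : 0 ≤ B := by have := (abs_nonneg _).trans (hBv 1 one_pos); exact lA this
    obtain ⟨Y, hY⟩ : ∃ Y, Y = δ^2*(B*(rI+1))^2/2+c1*(1/b) := ⟨_, rfl⟩
    have hY0 : 0 < Y := by rw [hY]; positivity
    obtain ⟨p, p0, p1, p2, p3⟩ : ∃ p > 0, p ≤ 1 ∧ p < ρ ∧ p*Y ≤ δ := by
      refine ⟨min 1 (min (ρ/2) (δ/Y)), pv, min_le_left _ _, ?_, ?_⟩
      · exact ((min_le_right _ _).trans (min_le_left _ _)).trans_lt lA hρ0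
      · rw [← le_div_iff₀ hY0]; exact (min_le_right _ _).trans (min_le_right _ _)
    have key := _root_.en (ρ := ρ) (ε := θ*δ) (C := M*C1) (σ := 1) (Z := λ_ 0) (Z1 := λ_ 0) p0 p2.le pv pv hd h.fs.cu h.fs.cv
      (h.fs.cv1.mono (λh p0.trans_le hr.1)) continuousOn_const (λh (h.fs.Ru r ⟨lB hr.1 p0, lD hr.2 l2 hd hρR⟩).1) (λR hasDerivAt_const r (0:ℝ))
      ((h.fs.Rin.mono p0.le le_rfl).congr (fun _ _ => rfl) (λh by rw [hcl r ⟨lB hr.1 p0, lD hr.2 l2 hd hρR⟩])) (Or.inl rfl) (λh lA hr.2) (λh by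
        have hr' : r ∈ Icc 0 R := ⟨lB hr.1 p0, lD hr.2 l2 hd hρR⟩
        have j1 := (bnd r hr' lD hr.2 l2 hd hρ2 0 le_rfl pv).2.1 lB hr.1 p0 lD hr.2 l2 hd hρR
        have j2 := ((hp r hr').2.2.1 hr.2.le).1
        have j3 := (h.vb hB.H r hr').1
        rw [sub_zero, abs_of_nonneg j3, show Hp m b (u r) 0 = 0 by simp [Hp], show Hu b 0 = 0 by simp [Hu], zero_mul] at j1
        refine j1.trans ?_
        rw [mul_assoc]
        refine mL (j2.trans (mL ?_ hC1.le)) hM0.le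
        rw [abs_of_nonpos lA hr.2, neg_neg, one_mul]; linarith only [hd])
    have f1 := fin1 (ρ-p) lD l2 hd hρ2 p0
    have f2 : |p^2*(δ^2*(v1 p)^2/2-(Hp m b (u p) (v p)-0))| ≤ δ := by
      have j1 := (bnd p ⟨p0.le, lD l2 hd hρR p2⟩ lD l2 hd hρ2 p2 0 le_rfl pv)
      have j2 := j1.2.2.trans (mL j1.1 hc10.le)
      rw [show Hp m b (u p) 0 = 0 by simp [Hp]] at j2
      have j3 : |v1 p| ≤ B*(rI+1) := (hBv p p0).trans (by gcongr; linarith only [l2, hd, hρ2, p2])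
      have j4 : (v1 p)^2 ≤ (B*(rI+1))^2 := by rw [← sq_abs]; gcongr
      have j5 := mL j4 (sq_nonneg δ)
      rw [abs_mul, abs_of_pos pv]
      have j6 : |δ^2*(v1 p)^2/2-(Hp m b (u p) (v p)-0)| ≤ Y := by
        have := abs_sub (δ^2*(v1 p)^2/2) (Hp m b (u p) (v p)-0)
        rw [abs_of_nonneg (show 0 ≤ δ^2*(v1 p)^2/2 from pv)] at this
        rw [hY]; exact lC j2 j5 this
      have j7 : p^2 ≤ p := by rw [sq]; exact mul_le_of_le_one_right p0.le p1
      exact (mul_le_mul j7 j6 (abs_nonneg _) p0.le).trans p3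
    have f3 : 0 ≤ (rI+1)^2*(8/b^2+c1*(C1*(4*θ+1)))*δ := pv
    simp only [sub_zero] at key f2
    have := abs_sub_abs_le_abs_sub (ρ^2*(δ^2*(v1 ρ)^2/2-Hp m b (u ρ) (v ρ))) (p^2*(δ^2*(v1 p)^2/2-Hp m b (u p) (v p)))
    exact lE f1 f3 key f2 this
  · have sub : ∀ r ∈ Icc ρ (ρ+1/2), r ∈ Icc 0 R ∧ r ≤ rI+1 ∧ 0 ≤ Vp m b (u r) ∧ Vp m b (u r) ≤ 1/b ∧ 4*m*b < u r ∧
        |v r-Vp m b (u r)| ≤ C1*(eθ+δ) := λh by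
      have hr' : r ∈ Icc 0 R := ⟨mA hr.1, lB hr.2 hρR⟩
      have k4 := hB.h4.trans_le (hu4 r hr')
      obtain ⟨-, q1, q2, -⟩ := Vp_facts hm hb k4
      have k5 := ((hp r hr').2.2.2 hr.1).1
      rw [hcl r hr'] at k5
      refine ⟨hr', lB hr.2 hρ2, ?_, ?_, k4, k5⟩
      · exact ((mul_pos_iff_of_pos_left hb).1 lB q1 q2).le
      · rw [le_div_iff₀ hb]; exact lA q2
    obtain ⟨q, hq, hsl⟩ := exists_hasDerivAt_eq_slope v (λr v1 r+c/r) (show ρ+1/4 < ρ+1/2 from lB l2 hd) h.fs.cv.continuousOn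
      (λh (h.fs.Rout r ⟨lC hr.1 l2 hd, lB hr.2 hρR⟩).1)
    have hqm : q ∈ Icc ρ (ρ+1/2) := ⟨lC hq.1 l2 hd, hq.2.le⟩
    have hPq : |v1 q+c/q| ≤ 4/b := by
      beta_reduce at hsl
      rw [hsl]
      have i1 := h.vb hB.H (ρ+1/4) ⟨lC l2 hd hρ0, lC l2 hd hρR⟩
      have i2 := h.vb hB.H (ρ+1/2) ⟨lC l2 hd hρ0, lA hρR⟩
      have e : 4/b = 4*(1/b) := by ring
      have e2 : (v (ρ+1/2)-v (ρ+1/4))/(ρ+1/2-(ρ+1/4)) = 4*(v (ρ+1/2)-v (ρ+1/4)) := by ring_nf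
      rw [e, e2]; exact abs_le.2 ⟨ll, ll⟩
    have hsR : ∀ r ∈ Ioo ρ q, r ∈ Icc ρ (ρ+1/2) := λh ⟨hr.1.le, lB hr.2 hq.2⟩
    have key := _root_.en (ρ := ρ) (ε := θ*δ) (C := M*C1) (σ := -1) (P := λr v1 r+c/r) (Z := λr Hp m b (u r) (Vp m b (u r))) (Z1 := λr Hu b (Vp m b (u r))*u1 r) hρ0 hqm.1 pv pv hd h.fs.cu h.fs.cv
      ((h.fs.cv1.mono (λh hρ0.trans_le hr.1)).add (continuousOn_const.div continuousOn_id (λh (hρ0.trans_le hr.1).ne')))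
      (λh (ContinuousAt.comp (g := λs Hp m b s (Vp m b s)) (Hm_d hm hb (sub r ⟨hr.1, hr.2.trans hqm.2⟩).2.2.2.2.1).continuousAt h.fs.cu.continuousAt).continuousWithinAt)
      (λh (h.fs.Ru r ⟨lB hr.1 hρ0, lC hr.2 hq.2 hρR⟩).1)
      (λh HasDerivAt.comp r (h₂ := λs Hp m b s (Vp m b s)) (Hm_d hm hb (sub r (hsR r hr)).2.2.2.2.1) (h.fs.Ru r ⟨lB hr.1 hρ0, lC hr.2 hq.2 hρR⟩).1)
      ((h.fs.Rout.mono le_rfl lB hq.2 hρR).congr (fun _ _ => rfl) (λh by rw [hcl r (sub r (hsR r hr)).1])) (Or.inr rfl) (λh lA hr.1) (λh by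
        obtain ⟨s1, s2, s3, s4, s5, s6⟩ := sub r (hsR r hr)
        have j1 := (bnd r s1 s2 _ s3 s4).2.1 lB hr.1 hρ0 lC hr.2 hq.2 hρR
        refine j1.trans ?_
        rw [mul_assoc]
        refine mL (s6.trans (le_of_eq ?_)) hM0.le
        rw [abs_of_nonneg lA hr.1, neg_one_mul])
    have f1 := fin1 (q-ρ) lD hq.2 hrI l2 hd
    have f2 : |q^2*(δ^2*(v1 q+c/q)^2/2-(Hp m b (u q) (v q)-Hp m b (u q) (Vp m b (u q))))| ≤ (rI+1)^2*(8/b^2+c1*(C1*(4*θ+1)))*δ := by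
      obtain ⟨s1, s2, s3, s4, s5, s6⟩ := sub q hqm
      have j2 := (bnd q s1 s2 _ s3 s4).2.2
      have j3 : exp (-|q-ρ|/(θ*δ)) ≤ 4*θ*δ := by
        rw [abs_of_nonneg lC hq.1 l2 hd, neg_div]
        refine (exp_le_exp.2 (neg_le_neg (div_le_div_of_nonneg_right (show 1/4 ≤ q-ρ from lA hq.1) pv))).trans ((exp_le_div pv).trans (le_of_eq ?_))
        field_simp
      have j4 : |v q-Vp m b (u q)| ≤ C1*(4*θ+1)*δ := s6.trans (by rw [mul_assoc]; exact mL lA j3 hC1.le)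
      have j5 := mL j4 hc10.le
      have j6 : δ^2*(v1 q+c/q)^2/2 ≤ 8/b^2*δ := by
        have k1 : (v1 q+c/q)^2 ≤ (4/b)^2 := by rw [← sq_abs]; gcongr
        have k2 : δ^2 ≤ δ := by rw [sq]; exact mul_le_of_le_one_right hd.le l2.le
        have k3 := mul_le_mul k2 k1 (sq_nonneg _) hd.le
        have k4 : (4/b)^2 = 2*(8/b^2) := by ring
        rw [k4] at k3; exact lA k3
      rw [abs_mul, abs_of_nonneg (sq_nonneg q), mul_assoc]
      refine mul_le_mul (by have := s1.1; gcongr) ?_ (abs_nonneg _) pv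
      have := abs_sub (δ^2*(v1 q+c/q)^2/2) (Hp m b (u q) (v q)-Hp m b (u q) (Vp m b (u q)))
      rw [abs_of_nonneg (show 0 ≤ δ^2*(v1 q+c/q)^2/2 from pv)] at this
      exact lD j2 j5 j6 this
    have := abs_sub_abs_le_abs_sub (ρ^2*(δ^2*(v1 ρ+c/ρ)^2/2-(Hp m b (u ρ) (v ρ)-Hp m b (u ρ) (Vp m b (u ρ))))) (q^2*(δ^2*(v1 q+c/q)^2/2-(Hp m b (u q) (v q)-Hp m b (u q) (Vp m b (u q)))))
    beta_reduce at key
    rw [abs_sub_comm] at key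
    exact lE hd key f1 f2 this

set_option maxHeartbeats 1000000 in
lemma Sm.c0 (hB : Bs_) : ∃ K > 0, ∃ N > 0, ∃ C > 0, ∃ δ1 > 0, ∀ (δ R : ℝ) (u u1 v v1 : ℝ → ℝ) (ρ c : ℝ), δ < δ1 →
    Sm_ → N*exp (-(K*(R-ρ)^2)) ≤ 1 → 3*(N*δ) ≤ rI → |ρ-rI| ≤ N*δ →
    (c = 0 ∨ (ρ = rI-N*δ ∧ 0 < c) ∨ (ρ = rI+N*δ ∧ c < 0)) → c = 0 ∧ ΛR |u r-w r| ≤ C*δ ∧ |u r-w r| ≤ η := by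
  have ha := hB.H.ha; have hm := hB.H.hm; have hb := hB.H.hb; have hη := hB.η0; have hrI := hB.Hr.rI0; have hx0 := hB.x0
  obtain ⟨K, hK, k, hk, C, hC, hf⟩ := Sm.face hB
  obtain ⟨C', hC', δa, hδa, he⟩ := Sm.en hB
  obtain ⟨q, hq⟩ : ∃ q, q = (U-η)*(1/(2*b))^3*b/4 := ⟨_, rfl⟩
  have hq0 : 0 < q := by rw [hq]; positivity
  obtain ⟨p, hp⟩ : ∃ p, p = (2*rI/3)^2*(q*(m/a^2)) := ⟨_, rfl⟩
  have hp0 : 0 < p := by rw [hp]; positivity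
  obtain ⟨N, hN⟩ : ∃ N, N = (C+2*C'/p+1)/k := ⟨_, rfl⟩
  have hN0 : 0 < N := by rw [hN]; positivity
  have hNk : p*(k*N-C) = 2*C'+p := by rw [hN]; field_simp; ring
  obtain ⟨δb, hδb, hf⟩ := hf N hN0
  obtain ⟨C3, hC3, δc, hδc, hcr⟩ := Sm.crude hB hN0
  refine ⟨K, hK, N, hN0, C3, hC3, min (min δa δb) (min δc (η/C3)), pv, ?_⟩
  intro δ R u u1 v v1 ρ c hδ h hR h3 hρN hc
  obtain ⟨⟨l1, l2⟩, l3, l4⟩ := (lt_min_iff.1 hδ).imp lt_min_iff.1 lt_min_iff.1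
  rw [lt_div_iff₀ hC3, mul_comm] at l4
  have hd := h.d0; have hρR := h.ρR; have hρ1 := h.ρ1
  have hρ0 : 0 < ρ := ll
  have huC := hcr δ R u u1 v v1 ρ c l3 h hρN
  have huη : ΛR |u r-w r| ≤ η := λh (huC r hr).trans l4.le
  refine ⟨?_, λh ⟨huC r hr, huη r hr⟩⟩
  obtain ⟨e1, e2⟩ := he δ R u u1 v v1 ρ c l1 h huη
  have hρm : ρ ∈ Icc 0 R := ⟨hρ0.le, ll⟩
  have hu4 : U-η ≤ u ρ := by
    have := abs_le.1 (huη ρ hρm)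
    have h2 := (hB.sb hρ0.le (x := u ρ)).1
    rwa [cl_id ⟨ll, ll⟩] at h2
  have hua := (h.fs.ub ρ hρm).2
  have k4 := hB.h4.trans_le hu4
  obtain ⟨-, f1, f2, -⟩ := Vp_facts hm hb k4
  have hHm := Hm_eq hm hb k4
  set W := Vp m b (u ρ) with hW
  have hqW : q ≤ u ρ*W^3*b/4 := by
    have : 1/(2*b) ≤ W := by rw [div_le_iff₀ pv]; exact lA f1
    rw [hq]; gcongr; exact lB hx0 hu4
  have main : ∀ σ, (σ = 1 ∨ σ = -1) → ρ = rI+σ*(N*δ) → 0 ≤ σ*((v1 ρ)^2-(v1 ρ+c/ρ)^2) → False := by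
    intro σ hσ hρσ hsq
    have g1 := hf δ R u u1 v v1 ρ c σ l2 h hR hσ h3 hρσ
    have hkN : 0 < k*N-C := by
      by_contra hh; push Not at hh
      have := mul_nonpos_of_nonneg_of_nonpos hp0.le hh; exact lD hC' hp0 hNk this
    have hkd : 0 < (k*N-C)*δ := pv
    have g2 : m/a^2*((k*N-C)*δ) ≤ σ*(W-2/(3*b)) := by
      rw [← hB.H.Vpf]
      rcases hσ with rfl | rfl
      · have := Vp_low hm hb (show 4*m*b < b9 from lD hB.H.h4 hB.H.h5 hη hx0) (show b9 ≤ u ρ from lB hkd g1) hua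
        have i := mL (show (k*N-C)*δ ≤ u ρ-b9 from lA g1) (show 0 ≤ m/a^2 from pv)
        exact lB this i
      · have := Vp_low hm hb k4 (show u ρ ≤ b9 from lB hkd g1) hB.H.h6.le
        have i := mL (show (k*N-C)*δ ≤ b9-u ρ from lA g1) (show 0 ≤ m/a^2 from pv)
        exact lB this i
    have g3 : q*(m/a^2*((k*N-C)*δ)) ≤ σ*(-(Hp m b (u ρ) W)) := by
      rw [hHm]
      calc _ ≤ q*(σ*(W-2/(3*b))) := mL g2 hq0.le
        _ ≤ (u ρ*W^3*b/4)*(σ*(W-2/(3*b))) := mR hqW ((by positivity : 0 ≤ m/a^2*((k*N-C)*δ)).trans g2)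
        _ = _ := by ring
    have g4 : p*((k*N-C)*δ) ≤ ρ^2*(σ*(-(Hp m b (u ρ) W))) := by
      rw [hp, mul_assoc, mul_assoc]
      exact mul_le_mul (by gcongr) g3 pv pv
    have g5 : 0 ≤ ρ^2*(δ^2*(σ*((v1 ρ)^2-(v1 ρ+c/ρ)^2))) := pv
    have g6 : p*((k*N-C)*δ) = (2*C'+p)*δ := by rw [← hNk]; ring
    have g7 : 0 < p*δ := pv
    obtain ⟨e3, e4⟩ := abs_le.1 e1
    obtain ⟨e5, e6⟩ := abs_le.1 e2
    rcases hσ with rfl | rfl <;> linarith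
  rcases hc with hc | ⟨h1, h2⟩ | ⟨h1, h2⟩
  · exact hc
  · refine (main (-1) (Or.inr rfl) lA h1 ?_).elim
    have i : 0 < c/ρ := pv
    have := mul_nonneg i.le (show 0 ≤ 2*v1 ρ+c/ρ from lB h.fs.s1 i)
    exact lA this
  · refine (main 1 (Or.inl rfl) lA h1 ?_).elim
    have i : c/ρ < 0 := div_neg_of_neg_of_pos h2 hρ0
    have := mul_nonneg (neg_pos.2 i).le (show 0 ≤ v1 ρ+(v1 ρ+c/ρ) from lB h.fs.s2 i)
    exact lA this

lemma bar1 (hp : 0 ≤ p) (hpR : p < R) (hN : 0 ≤ N) (he : 0 ≤ e) {D D1 : ℝ → ℝ} (hc : ContinuousOn D (Icc p R)) (h : RL p R D D1 f)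
    (h0 : D p ≤ N) (hR : D R ≤ 0) (hf : ∀ r ∈ Ioo p R, 0 < D r → D r-e ≤ f r) : ∀ r ∈ Icc p R, D r ≤ N*exp (-(r-p))+e := by
  have d1 : ∀ r : ℝ, HasDerivAt (λr exp (-(r-p))) (-exp (-(r-p))) r := λr by
    refine (((hasDerivAt_id r).sub_const p).neg.exp).congr_deriv ?_
    simp
  have k : RL p R (λr N*exp (-(r-p))+e) (λr -(N*exp (-(r-p)))) (λr N*exp (-(r-p))+(-(N*exp (-(r-p))))/r) :=
    RL_of (λR (((d1 r).const_mul N).add_const e).congr_deriv (by ring)) (λR (((d1 r).const_mul N).neg).congr_deriv (by ring))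
      (λR rfl)
  have := cmpr hp hpR (w := λr D r-(N*exp (-(r-p))+e)) (hc.sub (by fun_prop)) (h.sub k) (Or.inl (by simp only [sub_self, neg_zero, exp_zero]; linarith)) (by
    have : 0 ≤ N*exp (-(R-p)) := pv
    linarith) (fun r hr hr0 => by
    have e1 : 0 ≤ N*exp (-(r-p)) := pv
    have e2 : 0 ≤ N*exp (-(r-p))/r := div_nonneg e1 mA hr.1
    have := hf r hr ll
    rw [neg_div]; linarith)
  intro r hr
  linarith [this r hr]

set_option maxHeartbeats 1000000 in
lemma Sm.far (hB : Bs_) : ∃ T > 0, ∃ M > 0, ∃ δ1 > 0, ∀ (δ R : ℝ) (u u1 v v1 : ℝ → ℝ) (ρ : ℝ), δ < δ1 →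
    Sm a m b U V rI η κ1 κ2 B0 δ R w u u1 v v1 ρ 0 → (ΛR |u r-w r| ≤ η) →
    ∀ n : ℕ, ∀ r ∈ Icc (rI+1+n*T) R, |u r-U| ≤ M/2^n ∧ |v r-V| ≤ M/2^n := by
  have ha := hB.H.ha; have hm := hB.H.hm; have hb := hB.H.hb; have hη := hB.η0; have hrI := hB.Hr.rI0; have hx0 := hB.x0; have hUa := hB.Ua
  have hV0 : 0 < V := (mul_pos_iff_of_pos_left hb).1 mA hB.H.h1
  have hVb : V ≤ 1/b := by rw [le_div_iff₀ hb]; linarith [hB.H.h2]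
  have hU0 : 0 < U := ll
  obtain ⟨γ, hγ, μ, hμ, K, hK, hZ⟩ := ZZ hm hb hB.h4
  obtain ⟨L, hL, hLip⟩ := Vp_lip hm hb hB.h4
  obtain ⟨c1, hc1⟩ : ∃ c1, c1 = 1+(1/b)^2+U*(2*(1/b)) := ⟨_, rfl⟩
  have hc10 : 0 < c1 := by rw [hc1]; positivity
  obtain ⟨C2, hC2⟩ : ∃ C2, C2 = (1+L)/μ+K*(2+c1) := ⟨_, rfl⟩
  have hC20 : 0 < C2 := by rw [hC2]; positivity
  obtain ⟨C3, hC3⟩ : ∃ C3, C3 = a*(2*(1/b))*C2 := ⟨_, rfl⟩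
  have hC30 : 0 < C3 := by rw [hC3]; positivity
  obtain ⟨T, hT⟩ : ∃ T, T = 2+4*(1+L) := ⟨_, rfl⟩
  have hT0 : 0 < T := by rw [hT]; positivity
  have hTe : (1+L)*exp (-(T-2)) ≤ 1/4 := by
    have i := exp_le_div (x := T-2) (by rw [hT]; ring_nf; positivity)
    have i2 := mL i (show 0 ≤ 1+L from pv)
    have e : (1+L)*(1/(T-2)) = 1/4 := by rw [hT, add_sub_cancel_left]; field_simp
    exact lB i2 e
  have hM0 : 0 < a+1/b := pv
  refine ⟨T, hT0, a+1/b, hM0, min (min μ (κ2/2*γ)) (1/4/(C2+(1+L)*C3)), by have := hB.k2; positivity, ?_⟩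
  intro δ R u u1 v v1 ρ hδ h huw
  obtain ⟨⟨l1, l2⟩, l3⟩ := (lt_min_iff.1 hδ).imp_left lt_min_iff.1
  rw [lt_div_iff₀ pv] at l3
  have hd := h.d0; have hρR := h.ρR; have hρ1 := h.ρ1
  have hρ2 := (abs_le.1 h.ρ2).2
  have hρ0 : 0 < ρ := lB hrI hρ1
  have hcl : ΛR cl (w r-η) (w r+η) (u r) = u r := λh by
    have := abs_le.1 (huw r hr); exact cl_id ⟨ll, ll⟩
  have hu4 : ΛR U-η ≤ u r := λh by rw [← hcl r hr]; exact (hB.sb hr.1).1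
  have hRv : RL ρ R v v1 (λr hf m b (u r) (v r)/δ^2) := h.fs.Rout.congr (λR by simp) (λh by rw [hcl r ⟨lB hr.1 hρ0, hr.2.le⟩])
  have hbv : ∀ r ∈ Icc (rI+1) R, 1/2-γ ≤ b*v r := λh by
    refine le_trans ?_ (h.fs.vout r ⟨lB hr.1 hρ2, hr.2⟩).2.2
    have k2 := hB.k2
    have i1 : κ2/2/δ ≤ κ2*(r-ρ)/δ := by gcongr; rw [div_eq_mul_one_div]; exact mL lB hr.1 hρ2 k2.le
    have i2 := exp_le_exp.2 (neg_le_neg i1)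
    have i3 := exp_le_div (x := κ2/2/δ) pv
    have i4 : 1/(κ2/2/δ) ≤ γ := by rw [div_le_iff₀ pv, mul_div_assoc', le_div_iff₀ hd]; exact lA l2
    exact lC i2 i3 i4
  have sqd : ∀ x y, 0 ≤ x → x ≤ 1/b → 0 ≤ y → y ≤ 1/b → |x^2-y^2| ≤ 2*(1/b)*|x-y| := fun x y h1 h2 h3 h4 => by
    rw [sq_sub_sq, abs_mul, abs_of_nonneg lB h1 h3]; exact mR lB h2 h4 (abs_nonneg _)
  have half : ∀ p N, rI+1 ≤ p → 0 ≤ N → (∀ r ∈ Icc p R, |u r-U| ≤ N ∧ |v r-V| ≤ N) → ∀ r ∈ Icc (p+T) R, |u r-U| ≤ N/2 ∧ |v r-V| ≤ N/2 := by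
    intro p N hp hN hb1 r hr
    have hpR : p+2 < R := by have := hr.1.trans hr.2; rw [hT] at this; exact lB hL this
    have sub : ∀ x ∈ Icc p R, x ∈ Icc 0 R := fun x hx => ⟨lC hx.1 hrI hp, hx.2⟩
    have fb : ∀ x ∈ Ioo p R, |u x*(1+(v x)^2)-a| ≤ c1*N := fun x hx => by
      have hx' : x ∈ Icc p R := ⟨hx.1.le, hx.2.le⟩
      obtain ⟨v0, vb⟩ := h.vb hB.H x (sub x hx')
      obtain ⟨j1, j2⟩ := hb1 x hx'
      have e : u x*(1+(v x)^2)-a = (u x-U)*(1+(v x)^2)+U*((v x)^2-V^2) := by rw [← hB.H.hA]; ring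
      rw [e]
      refine (abs_add_le _ _).trans ?_
      rw [abs_mul, abs_mul, abs_of_nonneg (show 0 ≤ 1+(v x)^2 from pv), abs_of_pos hU0]
      have i1 := mul_le_mul j1 (show 1+(v x)^2 ≤ 1+(1/b)^2 by gcongr) pv hN
      have i2 := mL ((sqd _ _ v0 vb hV0.le hVb).trans (mL j2 pv)) hU0.le
      rw [hc1]; exact lB i1 i2
    have RuU : RL p R (λr u r-U) u1 (λr u r*(1+(v r)^2)-a) := fun x hx => by
      have := h.fs.Ru x ⟨lC hx.1 hrI hp, hx.2⟩
      exact ⟨this.1.sub_const U, this.2⟩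
    have hc1' : ContinuousOn u1 (Ioo p R) := h.fs.cu1.mono (fun x hx => show 0 < x from lC hx.1 hrI hp)
    have hlu : ∀ x ∈ Icc (p+1) R, ∀ y ∈ Icc (p+1) R, |u x-u y| ≤ (2*N+c1*N)*|x-y| := fun x hx y hy =>
      lip_of_d h.fs.cu.continuousOn (λh (h.fs.Ru r ⟨lC hr.1 hrI hp, hr.2⟩).1)
        (λh dbd (w := λr u r-U) lB hrI hp (h.fs.cu.sub continuous_const).continuousOn RuU hc1' (λh (hb1 r hr).1) fb hr.1.le hr.2) hx hy
    have hVV : ∀ x ∈ Icc p R, |Vp m b (u x)-V| ≤ L*|u x-U| := fun x hx => by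
      have := hLip (u x) U (hu4 x (sub x hx)) lA hη
      rwa [hB.H.VpU] at this
    have hvV : ∀ x ∈ Icc (p+2) R, |v x-Vp m b (u x)| ≤ C2*N*δ := fun x hx => by
      have hp1 : p+1 ∈ Icc p R := ⟨by linarith only, lA hpR⟩
      have z := hZ (p+1) R δ (2*N+c1*N) (N+L*N) u v v1 lB hrI hp lA hpR hd (by
          have := mL (show 1 ≤ p+1 from lB hrI hp) hμ.le; linarith only [l1, this]) h.fs.cv.continuousOn
        (hRv.mono lB hρ2 hp le_rfl) pv hlu (fun x hx => hu4 x (sub x ⟨lA hx.1, hx.2⟩))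
        (fun x hx => hbv x ⟨lB hx.1 hp, hx.2⟩) (by
          have i1 := (hb1 _ hp1).2
          have i2 := (hVV _ hp1).trans (mL (hb1 _ hp1).1 hL.le)
          rw [abs_sub_comm] at i2
          have := abs_sub_le (v (p+1)) V (Vp m b (u (p+1)))
          linarith only [i1, i2, this]) (by rw [h.fs.vR, h.fs.uR, hB.H.VpU]) x ⟨lA hx.1, hx.2⟩
      have i1 : exp (-(μ*(x-(p+1))/δ)) ≤ δ/μ := by
        have j1 : μ/δ ≤ μ*(x-(p+1))/δ := by gcongr; exact le_mul_of_one_le_right hμ.le lA hx.1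
        refine (exp_le_exp.2 (neg_le_neg j1)).trans ((exp_le_div pv).trans (le_of_eq ?_))
        field_simp
      have i2 := mL i1 (show 0 ≤ N+L*N from pv)
      have e : C2*N*δ = (N+L*N)*(δ/μ)+K*(2*N+c1*N)*δ := by rw [hC2]; field_simp
      exact lC z i2 e
    have fest : ∀ x ∈ Ioo (p+2) R, |u x*(1+(v x)^2)-a-(u x+Qf m b (u x)-a)| ≤ C3*N*δ := fun x hx => by
      have hx' : x ∈ Icc 0 R := ⟨lC hx.1 hrI hp, hx.2.le⟩
      obtain ⟨v0, vb⟩ := h.vb hB.H x hx'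
      obtain ⟨u0, ua⟩ := h.fs.ub x hx'
      obtain ⟨-, q1, q2, q3⟩ := Vp_facts hm hb (hB.h4.trans_le (hu4 x hx'))
      have p0 : 0 ≤ Vp m b (u x) := ((mul_pos_iff_of_pos_left hb).1 lB q1 q2).le
      have p1 : Vp m b (u x) ≤ 1/b := by rw [le_div_iff₀ hb]; exact lA q2
      have e : u x*(1+(v x)^2)-a-(u x+Qf m b (u x)-a) = u x*((v x)^2-(Vp m b (u x))^2) := by rw [q3]; ring
      rw [e, abs_mul, abs_of_nonneg u0, show C3*N*δ = a*(2*(1/b)*(C2*N*δ)) by rw [hC3]; ring]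
      exact mul_le_mul ua ((sqd _ _ v0 vb p0 p1).trans (mL (hvV x ⟨hx.1.le, hx.2.le⟩) pv)) (abs_nonneg _) ha.le
    have hQU := hB.H.QU
    have hp2 : p+2 ∈ Icc p R := ⟨by linarith only, hpR.le⟩
    have RuU' := RuU.mono (show p ≤ p+2 by linarith only) le_rfl
    have b1 := bar1 (N := N) (e := C3*N*δ) lB hrI hp hpR hN pv (D := λr u r-U) (h.fs.cu.sub continuous_const).continuousOn RuU'
      (abs_le.1 (hb1 _ hp2).1).2 (by simp [h.fs.uR]) (fun x hx hx0 => by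
        have i1 := (abs_le.1 (fest x hx)).1
        have i2 := Qf_mono hm hb hB.H.h4 (show U ≤ u x from lA hx0)
        linarith only [hQU, i1, i2])
    have b2 := bar1 (N := N) (e := C3*N*δ) lB hrI hp hpR hN pv (D := λr -(u r-U)) (h.fs.cu.sub continuous_const).neg.continuousOn RuU'.neg
      (by linarith only [(abs_le.1 (hb1 _ hp2).1).1]) (by simp [h.fs.uR]) (fun x hx hx0 => by
        have i1 := (abs_le.1 (fest x hx)).2
        have i2 := Qf_mono hm hb (hB.h4.trans_le (hu4 x ⟨lC hx.1 hrI hp, hx.2.le⟩)) (show u x ≤ U from lA hx0)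
        linarith only [hQU, i1, i2])
    have hr2 : r ∈ Icc (p+2) R := ⟨by have := hr.1; rw [hT] at this; linarith only [hL, this], hr.2⟩
    have huU : |u r-U| ≤ N*exp (-(T-2))+C3*N*δ := by
      have i1 := mL (exp_le_exp.2 (show -(r-(p+2)) ≤ -(T-2) from lA hr.1)) hN
      exact abs_le.2 ⟨by linarith only [b2 r hr2, i1], by linarith only [b1 r hr2, i1]⟩
    have i3 := mL hTe hN
    have i4 := mL l3.le hN
    have i5 : 0 ≤ L*(N*exp (-(T-2))+C3*N*δ) := pv
    have i6 : 0 ≤ C2*N*δ := pv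
    have i8 : 0 ≤ N*exp (-(T-2))+C3*N*δ := pv
    have i7 := mL huU hL.le
    refine ⟨lE huU i3 i4 i5 i6, ?_⟩
    have := abs_sub_le (v r) (Vp m b (u r)) V
    linarith only [hVV r ⟨lA hr2.1, hr.2⟩, hvV r hr2, i3, i4, i8, i7, this]
  intro n
  induction n with
  | zero =>
    intro r hr
    have hr' : r ∈ Icc 0 R := ⟨by have := hr.1; push_cast at this; linarith only [hrI, this], hr.2⟩
    obtain ⟨v0, vb⟩ := h.vb hB.H r hr'
    obtain ⟨u0, ua⟩ := h.fs.ub r hr'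
    have : 0 < 1/b := pv
    rw [pow_zero, div_one]
    exact ⟨abs_le.2 ⟨lD hUa hV0 hVb u0, lE hη hx0 hV0 hVb ua⟩, abs_le.2 ⟨lE hη hx0 hUa hVb v0, lE hη hx0 hUa hV0 vb⟩⟩
  | succ n ih =>
    intro r hr
    have := half _ _ (by have : 0 ≤ n*T := pv; linarith only [this]) pv ih r ⟨by have := hr.1; push_cast at this; linarith only [this], hr.2⟩
    rwa [div_div, ← pow_succ] at this

structure Ap (a m b U V rI κ N T M K δ R : ℝ) (u v : ℝ → ℝ) (ρ : ℝ) : Prop where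
  hρ : ρ ∈ Icc (rI-N*δ) (rI+N*δ)
  cu : Continuous u
  cv : Continuous v
  vρ : v ρ = 1/(3*b)
  bd : ΛR (0 ≤ u r ∧ u r ≤ a) ∧ 0 ≤ v r ∧ v r ≤ 1/b
  v0 : v 0 ≤ 1/b*exp (-(κ*ρ/δ))
  eu : ΛR u r = u 0+rJ (λt FFc a b (u t) (v t)) r
  ev : ΛR v r = v 0+rJ (λt GGc a m b δ (u t) (v t)) r
  lu : ∀ x ∈ Icc 0 R, ∀ y ∈ Icc 0 R, |u x-u y| ≤ K*|x-y|
  far : ∀ n : ℕ, ∀ r ∈ Icc (rI+1+n*T) R, |u r-U| ≤ M/2^n ∧ |v r-V| ≤ M/2^n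

lemma approx (H : PH_) : ∃ rI > 0, ∃ κ > 0, ∃ N > 0, ∃ T > 0, ∃ M > 0, ∃ K, ∃ δ0 > 0, ∀ δ ∈ Ioo 0 δ0,
    3*(N*δ) ≤ rI ∧ N*δ ≤ 1/2 ∧ ∃ R0, rI+1 < R0 ∧ ∀ R, R0 ≤ R → ∃ u v ρ, Ap a m b U V rI κ N T M K δ R u v ρ := by
  obtain ⟨rI, L0, d1, w, w1, Hr⟩ := red_exists H
  obtain ⟨η, hη, h4, κ1, hκ1, κ2, hκ2, B0, hB0, hFS⟩ := FS_exists H Hr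
  have hB : Bs_ := ⟨H, Hr, hη, h4, hκ1, hκ2, hB0⟩
  obtain ⟨K, hK, N, hN, C, hC, δ1, hδ1, hc0⟩ := Sm.c0 hB
  obtain ⟨T, hT, M, hM, δ2, hδ2, hfar⟩ := Sm.far hB
  obtain ⟨δN, hδN, hFS⟩ := hFS N hN
  have ha := H.ha; have hrI := Hr.rI0
  refine ⟨rI, hrI, κ1, hκ1, N, hN, T, hT, M, hM, B0+2*a+(a*(1+(1/b)^2)+a), min (min δ1 δ2) δN, pv, fun δ hδ => ?_⟩
  obtain ⟨⟨l1, l2⟩, l3⟩ := (lt_min_iff.1 hδ.2).imp_left lt_min_iff.1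
  have hd := hδ.1
  have hAd : 0 < a/δ := pv
  have hNK : 0 < N/K := pv
  obtain ⟨s1, s2, -⟩ := hFS δ ⟨hd, l3⟩ (rI+2) ll
  refine ⟨s1, s2, rI+2+a/δ+N/K, ll, fun R hR => ?_⟩
  obtain ⟨-, -, u, u1, v, v1, ρ, hρ, c, hc, fs⟩ := hFS δ ⟨hd, l3⟩ R ll
  have hρN : |ρ-rI| ≤ N*δ := abs_le.2 ⟨mA hρ.1, mA hρ.2⟩
  have S : Sm_ := by
    refine ⟨hd, ll, mA hρ.1, hρN.trans s2, ?_, fs⟩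
    have i1 := exp_le_div (x := R-rI-1) ll
    have i2 := mL i1 ha.le
    have i3 : a*(1/(R-rI-1)) ≤ δ := by
      rw [mul_one_div, div_le_iff₀ ll, mul_comm, ← div_le_iff₀ hd]; linarith
    linarith
  have hRρ : N*exp (-(K*(R-ρ)^2)) ≤ 1 := by
    have hy : 1 ≤ R-ρ := mA hρ.2
    have hy2 : N/K ≤ R-ρ := mA hρ.2
    rw [div_le_iff₀ hK] at hy2
    have hy3 : N ≤ K*(R-ρ)^2 := by
      linarith [mL (le_self_pow₀ hy two_ne_zero) hK.le]
    have i1 := mL (exp_le_div (x := K*(R-ρ)^2) ll) hN.le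
    refine i1.trans ?_
    rw [mul_one_div, div_le_one ll]; exact hy3
  obtain ⟨rfl, hu⟩ := hc0 δ R u u1 v v1 ρ c l1 S hRρ s1 hρN hc
  have hu' := λh (hu r hr).2
  have hρ0 : 0 ≤ ρ := mA hρ.1
  exact ⟨u, v, ρ, hρ, fs.cu, fs.cv, fs.vρ, λh ⟨fs.ub r hr, S.vb H r hr⟩, by simpa using (fs.vin 0 ⟨le_rfl, hρ0⟩).2.2,
    fs.eu, fs.ev rfl hu', S.lipu hB, hfar δ R u u1 v v1 ρ l2 S hu'⟩

lemma lipv (hf : Continuous f) (hB : ∀ t, |f t| ≤ B) (hw : Continuous w) (e : ΛR w r = w 0+rJ f r)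
    (hA : ΛR |w r| ≤ A) : ∀ x ∈ Icc 0 R, ∀ y ∈ Icc 0 R, |w x-w y| ≤ (2*A+B)*|x-y| := by
  have h : RL 0 R w (λr rH f r+0/r) f := sol_RL hf.measurable hB le_rfl (λt hf.continuousWithinAt) (λh by
    rw [e r hI_]; ring)
  have hB0 : 0 ≤ B := (abs_nonneg _).trans (hB 0)
  refine fun x hx y hy => lip_of_d hw.continuousOn (λh (h r hr).1) (λh ?_) hx hy
  have hA0 : 0 ≤ A := (abs_nonneg _).trans (hA r hI_)
  rcases le_total r 1 with h1 | h1
  · have := rH_bd hB hr.1.le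
    rw [zero_div, add_zero]
    linarith [mL h1 hB0]
  · refine dbd (w1 := λr rH f r+0/r) le_rfl hw.continuousOn h ?_ hA (λR hB r) ll hr.2
    intro s hs
    simp only [zero_div, add_zero]
    exact (rH_cont hf.measurable hB hs.1).continuousWithinAt

lemma reg (hf : Continuous f) (hB : ∀ t, |f t| ≤ B) (e : ∀ r, 0 ≤ r → w r = w 0+rJ f r) :
    ContDiffOn ℝ 2 w (Ioi 0) ∧ ∀ r > 0, deriv (deriv w) r+deriv w r/r = f r := by
  have d1 : ∀ r > 0, HasDerivAt w (rH f r) r := λh by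
    refine ((rJ_deriv hf.measurable hB hr).const_add (w 0)).congr_of_eventuallyEq ?_
    filter_upwards [isOpen_Ioi.mem_nhds hr] with s hs using e s (le_of_lt hs)
  have e1 : ∀ r > 0, deriv w r = rH f r := λh (d1 r hr).deriv
  have d2 : ∀ r > 0, HasDerivAt (deriv w) (f r-rH f r/r) r := λh by
    refine (rH_deriv hf.measurable hB hr hf.continuousAt).congr_of_eventuallyEq ?_
    filter_upwards [isOpen_Ioi.mem_nhds hr] with s hs using e1 s hs
  refine ⟨?_, λh by rw [(d2 r hr).deriv, e1 r hr]; ring⟩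
  rw [show (2 : WithTop ℕ∞) = 1+1 by norm_num, contDiffOn_succ_iff_deriv_of_isOpen isOpen_Ioi]
  refine ⟨λh (d1 r hr).differentiableAt.differentiableWithinAt, by simp, ?_⟩
  rw [show (1 : WithTop ℕ∞) = 0+1 by norm_num, contDiffOn_succ_iff_deriv_of_isOpen isOpen_Ioi]
  refine ⟨λh (d2 r hr).differentiableAt.differentiableWithinAt, by simp, ?_⟩
  rw [contDiffOn_zero]
  refine ContinuousOn.congr (f := λr f r-rH f r/r) ?_ (λh (d2 r hr).deriv)
  exact λh (hf.continuousAt.sub ((rH_cont hf.measurable hB hr).div continuousAt_id (ne_of_gt hr))).continuousWithinAt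

lemma farlim {T L : ℝ} (h : ∀ n : ℕ, ∀ r, s+n*T ≤ r → |f r-L| ≤ M/2^n) : Tendsto f atTop (nhds L) := by
  rw [Metric.tendsto_atTop]
  intro ε hε
  have h1 : Tendsto (fun n : ℕ => M/2^n) atTop (nhds 0) := by
    have := (tendsto_pow_atTop_nhds_zero_of_lt_one (r := (1/2:ℝ)) (by norm_num) (by norm_num)).const_mul M
    rw [mul_zero] at this
    refine this.congr (λn ?_)
    rw [div_pow, one_pow, mul_one_div]
  obtain ⟨n, hn⟩ := (h1.eventually (gt_mem_nhds hε)).exists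
  exact ⟨s+n*T, λh by rw [Real.dist_eq]; exact (h n r hr).trans_lt hn⟩

end

theorem gap_existence
    (a m b : ℝ) (ha : 0 < a) (hm : 0 < m) (hb : 0 < b)
    (hparam₁ : max (9*b/2) (4*b + 1/b) < a/m) (hparam₂ : a/m < 9*b/2 + 2/b)
    (V₂ : ℝ) (hV₂ : V₂ = (a/m + Real.sqrt ((a/m)^2 - 4*(1 + a*b/m))) / (2*(1 + a*b/m)))
    (U₂ : ℝ) (hU₂ : U₂ = m * (a/m - V₂ / (1 - b*V₂)))
    (hcond : (∫ s in U₂..(9*b*m/2), (s - 2*m*b + Real.sqrt (s^2 - 4*s*m*b)) / (2*b^2))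
        < (1/2) * (a - U₂)^2) :
    ∃ rI > (0:ℝ), ∃ ν > (0:ℝ), ∃ δ₀ > (0:ℝ), ∃ C > (0:ℝ),
      ∀ δ ∈ Set.Ioo (0:ℝ) δ₀,
        ∃ u v : ℝ → ℝ,
          -- boundedness
          (∃ M : ℝ, ∀ r ∈ Set.Ioi (0:ℝ), |u r| ≤ M ∧ |v r| ≤ M) ∧
          -- twice continuous differentiability
          ContDiffOn ℝ 2 u (Set.Ioi 0) ∧ ContDiffOn ℝ 2 v (Set.Ioi 0) ∧
          -- the stationary radially symmetric equations
          (∀ r ∈ Set.Ioi (0:ℝ),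
            deriv (deriv u) r + deriv u r / r + a - u r - u r * (v r)^2 = 0 ∧
            δ^2 * (deriv (deriv v) r + deriv v r / r) - m * v r
              + u r * (v r)^2 * (1 - b * v r) = 0) ∧
          -- core behavior: v(0⁺) exists and is exponentially small
          (∃ v0 : ℝ, Filter.Tendsto v (nhdsWithin 0 (Set.Ioi 0)) (nhds v0) ∧
            0 ≤ v0 ∧ v0 ≤ C * Real.exp (-ν/δ)) ∧
          -- far-field behavior: limits exist and are O(δ)-close to (U₂, V₂)
          (∃ uInf vInf : ℝ,
            Filter.Tendsto u Filter.atTop (nhds uInf) ∧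
            Filter.Tendsto v Filter.atTop (nhds vInf) ∧
            |vInf - V₂| ≤ C * δ ∧ |uInf - U₂| ≤ C * δ) ∧
          -- single interface at radius rI + O(δ)
          (∃ rδ : ℝ, |rδ - rI| ≤ C * δ ∧ v rδ = 1/(3*b)) := by
  have H := PH_of a m b ha hm hb hparam₁ hparam₂ V₂ hV₂ U₂ hU₂ hcond
  obtain ⟨rI, hrI, κ, hκ, N, hN, T, hT, M, hM, K, δ0, hδ0, hA⟩ := approx H
  refine ⟨rI, hrI, κ*rI/2, pv, δ0, hδ0, N+1/b, pv, fun δ hδ => ?_⟩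
  obtain ⟨s1, s2, R0, hR0, hA⟩ := hA δ hδ
  have hd := hδ.1
  have hA' : ∀ n : ℕ, ∃ u v ρ, Ap a m b U₂ V₂ rI κ N T M K δ (R0+n) u v ρ := λn hA _ (by linarith only [n.cast_nonneg (α := ℝ)])
  choose u v ρ hS using hA'
  obtain ⟨BF, hBF⟩ : ∃ BF, BF = 2*a*(1+(1/b)^2)+a := ⟨_, rfl⟩
  obtain ⟨BG, hBG⟩ : ∃ BG, BG = (m/b+2*a/b^2)/δ^2 := ⟨_, rfl⟩
  have bF : ∀ x y, |FFc a b x y| ≤ BF := fun x y => hBF ▸ FF_bd ha hb x y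
  have bG : ∀ x y, |GGc a m b δ x y| ≤ BG := fun x y => hBG ▸ GG_bd ha hm hb hd x y
  have cF : ∀ {x y : ℝ → ℝ}, Continuous x → Continuous y → Continuous (λt FFc a b (x t) (y t)) := fun {x y} hx hy =>
    (FF_C4 a b).comp (f := fun t : ℝ => ((0:ℝ), (0:ℝ), x t, y t)) (by fun_prop)
  have cG : ∀ {x y : ℝ → ℝ}, Continuous x → Continuous y → Continuous (λt GGc a m b δ (x t) (y t)) := fun {x y} hx hy =>
    (GG_C4 a m b δ).comp (f := fun t : ℝ => ((0:ℝ), (0:ℝ), x t, y t)) (by fun_prop)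
  have hb0 : 0 < 1/b := pv
  have hsel : ∀ (F : ℝ → ℝ → ℝ) (p t x y : ℝ), sel (fun _ _ x y => F x y) (fun _ _ x y => F x y) p t x y = F x y := fun F p t x y => by
    unfold sel; split_ifs <;> rfl
  have hlim := lim_R (B := max BF BG) (M := a+1/b) (K := max K (2*(1/b)+BG)) (θ := 1/(3*b)) (FF_C4 a b) (FF_C4 a b) (GG_C4 a m b δ) (GG_C4 a m b δ)
    (fun _ _ x y => (bF x y).trans (le_max_left _ _)) (fun _ _ x y => (bF x y).trans (le_max_left _ _))
    (fun _ _ x y => (bG x y).trans (le_max_right _ _)) (fun _ _ x y => (bG x y).trans (le_max_right _ _))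
    (show 0 < rI-N*δ from lB hrI s1) (R := fun n : ℕ => R0+n) (tendsto_atTop_add_const_left _ _ tendsto_natCast_atTop_atTop)
    (rh := rI+N*δ) (λn by linarith only [n.cast_nonneg (α := ℝ), s2, hR0]) (λn (hS n).hρ) (λn (hS n).cu) (λn (hS n).cv) (λn (hS n).vρ)
    (λn by simpa only [hsel] using (hS n).eu) (λn by simpa only [hsel] using (hS n).ev)
    (λN by have := (hS n).bd r hr; exact abs_le.2 ⟨lC this.1.1 ha hb0, lB this.1.2 hb0⟩)
    (λN by have := (hS n).bd r hr; exact abs_le.2 ⟨lC this.2.1 ha hb0, lB this.2.2 ha⟩)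
    (fun n r hr s hs => ((hS n).lu r hr s hs).trans (mR (le_max_left _ _) (abs_nonneg _)))
    (fun n r hr s hs => (lipv (cG (hS n).cu (hS n).cv) (λt bG _ _) (hS n).cv (hS n).ev
      (λh by have := (hS n).bd r hr; exact abs_le.2 ⟨lB this.2.1 hb0, lA this.2.2⟩) r hr s hs).trans
      (mR (le_max_right _ _) (abs_nonneg _)))
  simp only [hsel] at hlim
  obtain ⟨φ, hφ, u', v', ρ', hρ', cu, cv, hvρ, -, hl, he⟩ := hlim
  have ev : ∀ r, ∀ᶠ n in atTop, r ≤ R0+(φ n : ℝ) := λr by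
    have h1 : Tendsto (λn R0+(φ n : ℝ)) atTop atTop := tendsto_atTop_add_const_left _ _ (tendsto_natCast_atTop_atTop.comp hφ.tendsto_atTop)
    exact h1.eventually (eventually_ge_atTop r)
  have bd : ∀ r, 0 ≤ r → (0 ≤ u' r ∧ u' r ≤ a) ∧ 0 ≤ v' r ∧ v' r ≤ 1/b := λh by
    have hev := (ev r).mono (fun n hn => (hS (φ n)).bd r ⟨hr, hn⟩)
    exact ⟨⟨ge_of_tendsto (hl r hr).1 (hev.mono fun n hn => hn.1.1), le_of_tendsto (hl r hr).1 (hev.mono fun n hn => hn.1.2)⟩,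
      ge_of_tendsto (hl r hr).2 (hev.mono fun n hn => hn.2.1), le_of_tendsto (hl r hr).2 (hev.mono fun n hn => hn.2.2)⟩
  have far : ∀ n : ℕ, ∀ r, rI+1+n*T ≤ r → |u' r-U₂| ≤ M/2^n ∧ |v' r-V₂| ≤ M/2^n := λN by
    have hr0 : 0 ≤ r := by have : 0 ≤ n*T := pv; exact lC hrI hr this
    have hev := (ev r).mono (fun k hk => (hS (φ k)).far n r ⟨hr, hk⟩)
    exact ⟨le_of_tendsto ((hl r hr0).1.sub_const U₂).abs (hev.mono fun n hn => hn.1), le_of_tendsto ((hl r hr0).2.sub_const V₂).abs (hev.mono fun n hn => hn.2)⟩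
  obtain ⟨ru, eu⟩ := reg (cF cu cv) (λt bF _ _) (λh (he r hr).1)
  obtain ⟨rv, ev'⟩ := reg (cG cu cv) (λt bG _ _) (λh (he r hr).2)
  refine ⟨u', v', ⟨a+1/b, λh ?_⟩, ru, rv, λh ?_, ⟨v' 0, (cv.tendsto 0).mono_left nhdsWithin_le_nhds, (bd 0 le_rfl).2.1, ?_⟩,
    ⟨U₂, V₂, farlim (λN (far n r hr).1), farlim (λN (far n r hr).2), ?_, ?_⟩, ρ', ?_, hvρ⟩
  · obtain ⟨⟨h1, h2⟩, h3, h4⟩ := bd r (le_of_lt hr)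
    exact ⟨abs_le.2 ⟨lC ha hb0 h1, lB hb0 h2⟩, abs_le.2 ⟨lC ha hb0 h3, lB ha h4⟩⟩
  · obtain ⟨⟨h1, h2⟩, h3, h4⟩ := bd r (le_of_lt hr)
    have e1 := eu r hr
    have e2 := ev' r hr
    have c1 : cl 0 (2*a) (u' r) = u' r := cl_id ⟨h1, lB ha h2⟩
    have c2 : cl 0 (1/b) (v' r) = v' r := cl_id ⟨h3, h4⟩
    simp only [FFc, GGc, c1, c2, hf] at e1 e2
    refine ⟨by rw [e1]; ring, ?_⟩
    rw [e2]; field_simp; ring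
  · refine le_of_tendsto (hl 0 le_rfl).2 (Eventually.of_forall λn (hS (φ n)).v0.trans ?_)
    have h1 := (hS (φ n)).hρ.1
    refine mul_le_mul lA hN (exp_le_exp.2 ?_) (exp_pos _).le pv
    rw [neg_div]; apply neg_le_neg; gcongr
    have := mL (show rI/2 ≤ ρ (φ n) from lC hrI s1 h1) hκ.le
    exact lA this
  · simp; positivity
  · simp; positivity
  · have := hρ'.1; have := hρ'.2
    have : 0 < 1/b*δ := pv
    exact abs_le.2 ⟨ll, ll⟩
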